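/- Under the stated construction, the set X' = X^{t+1} is homotopy equivalent to X. -/

import Mathlib

open scoped BigOperators

/-- The `k`-th Betti number (over `ℚ`) of a topological space: the rank of the `k`-th
singular homology group, computed via the alternating face map complex of the singular
simplicial set with `ℚ`-coefficients. -/
noncomputable def bettiNumber (X : Type) [TopologicalSpace X] (k : ℕ) : ℕ :=
  Module.finrank ℚ
    (((AlgebraicTopology.alternatingFaceMapComplex (C := ModuleCat.{0} ℚ)).obj
        (((CategoryTheory.SimplicialObject.whiskering (Type 0) (ModuleCat.{0} ℚ)).obj
            (ModuleCat.free ℚ)).obj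
          (TopCat.toSSet.obj (TopCat.of X)))).homology k)

/-- A structure expanding the real field: a collection of "definable" subsets of each `ℝⁿ`
containing all real algebraic sets, forming a Boolean subalgebra in each dimension, and
closed under products and projections. -/
structure RealStructure where
  defin : ∀ n : ℕ, Set (Set (Fin n → ℝ))
  algebraic_mem : ∀ (n : ℕ) (p : MvPolynomial (Fin n) ℝ),
      {x : Fin n → ℝ | MvPolynomial.eval x p = 0} ∈ defin n
  empty_mem : ∀ n : ℕ, (∅ : Set (Fin n → ℝ)) ∈ defin n
  compl_mem : ∀ (n : ℕ) (A : Set (Fin n → ℝ)), A ∈ defin n → Aᶜ ∈ defin n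
  union_mem : ∀ (n : ℕ) (A B : Set (Fin n → ℝ)),
      A ∈ defin n → B ∈ defin n → A ∪ B ∈ defin n
  prod_mem : ∀ (m n : ℕ) (A : Set (Fin m → ℝ)) (B : Set (Fin n → ℝ)),
      A ∈ defin m → B ∈ defin n →
      {x : Fin (m + n) → ℝ |
        (fun i => x (Fin.castAdd n i)) ∈ A ∧ (fun i => x (Fin.natAdd m i)) ∈ B} ∈ defin (m + n)
  proj_mem : ∀ (n : ℕ) (A : Set (Fin (n + 1) → ℝ)), A ∈ defin (n + 1) →
      {x : Fin n → ℝ | ∃ y : ℝ, Fin.snoc x y ∈ A} ∈ defin n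

/-- O-minimality: the definable subsets of `ℝ¹` are precisely the finite unions of points and
intervals (equivalently, finite unions of order-connected subsets of `ℝ`). -/
def RealStructure.IsOMinimal (S : RealStructure) : Prop :=
  ∀ A : Set (Fin 1 → ℝ), A ∈ S.defin 1 ↔
    ∃ (k : ℕ) (I : Fin k → Set ℝ), (∀ i, (I i).OrdConnected) ∧
      A = {x : Fin 1 → ℝ | ∃ i, x 0 ∈ I i}

/-- A function is definable when its graph is a definable subset. -/
def RealStructure.DefinableFun (S : RealStructure) (n : ℕ) (f : (Fin n → ℝ) → ℝ) : Prop :=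
  {x : Fin (n + 1) → ℝ | x (Fin.last n) = f (fun i => x (Fin.castSucc i))} ∈ S.defin (n + 1)

/-- `D` is a set of differentiable definable functions `ℝⁿ → ℝ` closed under addition,
multiplication and partial derivatives. -/
def GoodClass (S : RealStructure) (n : ℕ) (D : Set ((Fin n → ℝ) → ℝ)) : Prop :=
  (∀ f ∈ D, Differentiable ℝ f) ∧ (∀ f ∈ D, S.DefinableFun n f) ∧
  (∀ f ∈ D, ∀ g ∈ D, (fun x => f x + g x) ∈ D) ∧
  (∀ f ∈ D, ∀ g ∈ D, (fun x => f x * g x) ∈ D) ∧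
  (∀ f ∈ D, ∀ j : Fin n, (fun x => fderiv ℝ f x (Pi.single j 1)) ∈ D)

/-- An axiomatic complexity measure `(c, T)` on a class `D` of functions `ℝⁿ → ℝ`. -/
structure ComplexityMeasure (n m : ℕ) (D : Set ((Fin n → ℝ) → ℝ)) where
  /-- the multivariate complexity `c = (c₁, …, c_m)` -/
  c : ((Fin n → ℝ) → ℝ) → Fin m → ℕ
  /-- `t₊` bounding the complexity of sums -/
  tplus : (Fin m → ℕ) → (Fin m → ℕ) → Fin m → ℕ
  /-- `t×` bounding the complexity of products -/
  tmul : (Fin m → ℕ) → (Fin m → ℕ) → Fin m → ℕ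
  /-- `t∂` bounding the complexity of partial derivatives -/
  tpartial : (Fin m → ℕ) → Fin m → ℕ
  /-- `t_k` bounding the number of solutions of systems of `k` equations in `ℝᵏ` -/
  tsol : (k : ℕ) → (Fin k → Fin m → ℕ) → ℕ
  const_zero : ∀ (a : ℝ) (i : Fin m), c (fun _ => a) i = 0
  coord_one : ∀ (j : Fin n) (i : Fin m), c (fun x => x j) i = 1
  add_le : ∀ F ∈ D, ∀ G ∈ D, ∀ i : Fin m, c (fun x => F x + G x) i ≤ tplus (c F) (c G) i
  mul_le : ∀ F ∈ D, ∀ G ∈ D, ∀ i : Fin m, c (fun x => F x * G x) i ≤ tmul (c F) (c G) i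
  add_const : ∀ G ∈ D, ∀ (a : ℝ) (i : Fin m), c (fun x => a + G x) i = c G i
  mul_const : ∀ G ∈ D, ∀ a : ℝ, a ≠ 0 → ∀ i : Fin m, c (fun x => a * G x) i = c G i
  partial_le : ∀ F ∈ D, ∀ (j : Fin n) (i : Fin m),
      c (fun x => fderiv ℝ F x (Pi.single j 1)) i ≤ tpartial (c F) i
  sol_le : ∀ Fs : Fin n → ((Fin n → ℝ) → ℝ), (∀ j, Fs j ∈ D) →
      ∀ s : Finset (Fin n → ℝ), (∀ x ∈ s, ∀ j, Fs j x = 0) →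
        s.card ≤ tsol n fun j => c (Fs j)

namespace ComplexityMeasure

variable {n m : ℕ} {D : Set ((Fin n → ℝ) → ℝ)}

/-- `κᵢ(v) = t_{i,+}(t_{i,∂}(v), t_{i,×}(0, t_{i,∂}(v)))`. -/
def kappa (C : ComplexityMeasure n m D) (v : Fin m → ℕ) : Fin m → ℕ :=
  C.tplus (C.tpartial v) (C.tmul (fun _ => 0) (C.tpartial v))

/-- `γ(k, v) = t_k(v, κ(v), …, κ(v))`. -/
def gamma (C : ComplexityMeasure n m D) (k : ℕ) (v : Fin m → ℕ) : ℕ :=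
  C.tsol k fun j => if (j : ℕ) = 0 then v else C.kappa v

end ComplexityMeasure

/-- The square of the Euclidean norm on `ℝⁿ`, `|x|² = Σ xⱼ²`. -/
def normSq (n : ℕ) (x : Fin n → ℝ) : ℝ := ∑ j, x j ^ 2

/-- An `(F,G)`-closed formula: a monotone Boolean combination (only `∧` and `∨`) of atoms
`(⋀_{g∈G} g = 0) ∧ f = 0`, `(⋀_{g∈G} g = 0) ∧ f ≥ 0`, `(⋀_{g∈G} g = 0) ∧ f ≤ 0`, `f ∈ F`. -/
inductive FGFormula (s : ℕ) : Type
  | eq : Fin s → FGFormula s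
  | ge : Fin s → FGFormula s
  | le : Fin s → FGFormula s
  | and : FGFormula s → FGFormula s → FGFormula s
  | or : FGFormula s → FGFormula s → FGFormula s

/-- The realisation of an `(F,G)`-closed formula. -/
def FGFormula.eval {s : ℕ} (n q : ℕ) (f : Fin s → ((Fin n → ℝ) → ℝ))
    (g : Fin q → ((Fin n → ℝ) → ℝ)) : FGFormula s → Set (Fin n → ℝ)
  | eq i => {x | (∀ l, g l x = 0) ∧ f i x = 0}
  | ge i => {x | (∀ l, g l x = 0) ∧ 0 ≤ f i x}
  | le i => {x | (∀ l, g l x = 0) ∧ f i x ≤ 0}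
  | and φ ψ => φ.eval n q f g ∩ ψ.eval n q f g
  | or φ ψ => φ.eval n q f g ∪ ψ.eval n q f g

/-- The realisation of the sign condition `σ` on the tuple `f`. -/
def signRe (n : ℕ) {s : ℕ} (f : Fin s → ((Fin n → ℝ) → ℝ)) (σ : Fin s → SignType) :
    Set (Fin n → ℝ) :=
  {x | ∀ i, SignType.sign (f i x) = σ i}

/-- The level of a sign condition: the number of `i` with `σ i = 0`. -/
def levelOf {s : ℕ} (σ : Fin s → SignType) : ℕ :=
  (Finset.univ.filter fun i => σ i = 0).card

/-- `Reali(σ₊ᶜ)`: the closed thickening of the realisation of `σ` inside `Sset`, using the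
infinitesimal `ε_{2m}` where `m` is the level of `σ`. -/
def RealiCp (n : ℕ) {s : ℕ} (f : Fin s → ((Fin n → ℝ) → ℝ)) (Sset : Set (Fin n → ℝ))
    (ε : ℕ → ℝ) (σ : Fin s → SignType) : Set (Fin n → ℝ) :=
  Sset ∩ {x | ∀ i, (σ i = 0 → |f i x| ≤ ε (2 * levelOf σ)) ∧
    (σ i = 1 → 0 ≤ f i x) ∧ (σ i = -1 → f i x ≤ 0)}

/-- `Reali(σ₊ᵒ)`: the open thickening of the realisation of `σ` inside `Sset`, using the
infinitesimal `ε_{2m−1}` where `m` is the level of `σ`. -/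
def RealiOp (n : ℕ) {s : ℕ} (f : Fin s → ((Fin n → ℝ) → ℝ)) (Sset : Set (Fin n → ℝ))
    (ε : ℕ → ℝ) (σ : Fin s → SignType) : Set (Fin n → ℝ) :=
  Sset ∩ {x | ∀ i, (σ i = 0 → |f i x| < ε (2 * levelOf σ - 1)) ∧
    (σ i = 1 → 0 < f i x) ∧ (σ i = -1 → f i x < 0)}

/-- The inductive construction `X⁰ = X`,
`X^{m+1} = (X^m ∪ ⋃_{σ∈Σ_m} Reali(σ₊ᶜ)) ∖ ⋃_{σ∈SIGN_m(S)∖Σ_m} Reali(σ₊ᵒ)`. -/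
def Xseq (n : ℕ) {s : ℕ} (f : Fin s → ((Fin n → ℝ) → ℝ)) (Sset : Set (Fin n → ℝ))
    (SIGNS Sig : Set (Fin s → SignType)) (ε : ℕ → ℝ) : ℕ → Set (Fin n → ℝ)
  | 0 => ⋃ σ ∈ Sig, signRe n f σ
  | p + 1 =>
      (Xseq n f Sset SIGNS Sig ε p ∪
          ⋃ σ ∈ {σ ∈ Sig | levelOf σ = p}, RealiCp n f Sset ε σ) \
        ⋃ σ ∈ {σ ∈ SIGNS | σ ∉ Sig ∧ levelOf σ = p}, RealiOp n f Sset ε σ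

open Set Metric Filter Topology

/-- `K ∩ closedBall y ρ` can be contracted to a point inside `K ∩ closedBall y r`. -/
def Contr {n : ℕ} (K : Set (Fin n → ℝ)) (y : Fin n → ℝ) (ρ r : ℝ) : Prop :=
  ∃ (c : (Fin n → ℝ) × ℝ → (Fin n → ℝ)) (y₁ : Fin n → ℝ),
    ContinuousOn c ((K ∩ closedBall y ρ) ×ˢ Icc 0 1) ∧
    ∀ z ∈ K ∩ closedBall y ρ, c (z, 0) = z ∧ c (z, 1) = y₁ ∧
      ∀ τ ∈ Icc (0 : ℝ) 1, c (z, τ) ∈ K ∩ closedBall y r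

theorem Contr.mono {n : ℕ} {K : Set (Fin n → ℝ)} {y y' : Fin n → ℝ} {ρ ρ' r r' : ℝ}
    (h : Contr K y ρ r) (hρ : dist y' y + ρ' ≤ ρ) (hr : r + dist y' y ≤ r') :
    Contr K y' ρ' r' := by
  obtain ⟨c, y₁, hc, h⟩ := h
  have hsub : K ∩ closedBall y' ρ' ⊆ K ∩ closedBall y ρ :=
    inter_subset_inter_right _ (closedBall_subset_closedBall' (by linarith))
  refine ⟨c, y₁, hc.mono (prod_mono hsub Subset.rfl), fun z hz => ?_⟩
  obtain ⟨h0, h1, h2⟩ := h z (hsub hz)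
  exact ⟨h0, h1, fun τ hτ => ⟨(h2 τ hτ).1,
    closedBall_subset_closedBall' (by rw [dist_comm y y']; exact hr) (h2 τ hτ).2⟩⟩

/-- Finite colourability of `Ω` at all scales: bump functions with finitely many colours such that
each colour class splits into pieces of small diameter. -/
def ColorCover (Ω κ : Type) [PseudoMetricSpace Ω] : Prop :=
  ∀ h > 0, ∃ (Λ : Type) (ψ : κ → Ω → ℝ) (lab : κ → Ω → Λ),
    (∀ c, Continuous (ψ c)) ∧ (∀ c x, ψ c x ∈ Icc (0 : ℝ) 1) ∧ (∀ x, ∃ c, ψ c x = 1) ∧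
    (∀ c x, 0 < ψ c x → ∀ᶠ y in 𝓝 x, lab c y = lab c x) ∧
    ∀ c x y, 0 < ψ c x → 0 < ψ c y → lab c x = lab c y → dist x y < h

theorem colorCover_of_coords {Ω ι : Type} [PseudoMetricSpace Ω] [Fintype ι] (p : ι → Ω → ℝ)
    (hp : ∀ i, Continuous (p i))
    (hd : ∀ x y h, 0 < h → (∀ i, |p i x - p i y| < h) → dist x y < h) :
    ColorCover Ω (ι → Bool) := by
  classical
  intro h hh
  let u : (ι → Bool) → ι → Ω → ℝ := fun c i x => p i x / h + (if c i then 1 / 2 else 0)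
  have hu : ∀ c i, Continuous (u c i) := fun c i => ((hp i).div_const h).add continuous_const
  let θ : ℝ → ℝ := fun v => min 1 (2 * Real.sin (Real.pi * v) ^ 2)
  have hθ : Continuous θ := by fun_prop
  have hθ01 : ∀ v, θ v ∈ Icc (0 : ℝ) 1 := fun v => ⟨le_min zero_le_one (by positivity), min_le_left _ _⟩
  refine ⟨ι → ℤ, fun c x => ∏ i, θ (u c i x), fun c x i => ⌊u c i x⌋, fun c => ?_, fun c x => ?_,
    fun x => ?_, fun c x hx => ?_, fun c x y _ _ hl => ?_⟩
  · exact continuous_finsetProd _ fun i _ => hθ.comp (hu c i)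
  · exact ⟨Finset.prod_nonneg fun i _ => (hθ01 _).1,
      Finset.prod_le_one (fun i _ => (hθ01 _).1) fun i _ => (hθ01 _).2⟩
  · refine ⟨fun i => decide (Real.sin (Real.pi * (p i x / h)) ^ 2 ≤ 1 / 2), ?_⟩
    refine Finset.prod_eq_one fun i _ => min_eq_left ?_
    have hsc := Real.sin_sq_add_cos_sq (Real.pi * (p i x / h))
    by_cases hs : Real.sin (Real.pi * (p i x / h)) ^ 2 ≤ 1 / 2
    · have : Real.pi * (p i x / h + 1 / 2) = Real.pi * (p i x / h) + Real.pi / 2 := by ring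
      simp only [u, hs, decide_true, if_true, this, Real.sin_add_pi_div_two]
      linarith
    · simp only [u, hs, decide_false, Bool.false_eq_true, if_false, add_zero]
      linarith
  · have h1 : ∀ i, ∀ᶠ y in 𝓝 x, ⌊u c i y⌋ = ⌊u c i x⌋ := by
      intro i
      have hne : θ (u c i x) ≠ 0 := fun h0 => hx.ne' (Finset.prod_eq_zero (Finset.mem_univ i) h0)
      have hlt : (⌊u c i x⌋ : ℝ) < u c i x := by
        refine lt_of_le_of_ne (Int.floor_le _) fun he => hne ?_
        have : Real.sin (Real.pi * u c i x) = 0 :=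
          Real.sin_eq_zero_iff.2 ⟨⌊u c i x⌋, by rw [he]; ring⟩
        simp [θ, this]
      have : u c i ⁻¹' Ioo (⌊u c i x⌋ : ℝ) (⌊u c i x⌋ + 1) ∈ 𝓝 x :=
        (hu c i).continuousAt.preimage_mem_nhds (Ioo_mem_nhds hlt (Int.lt_floor_add_one _))
      filter_upwards [this] with y hy
      exact Int.floor_eq_iff.2 ⟨hy.1.le, hy.2⟩
    filter_upwards [eventually_all.2 h1] with y hy
    exact funext hy
  · refine hd x y h hh fun i => ?_
    have h1 : ⌊u c i x⌋ = ⌊u c i y⌋ := congrFun hl i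
    have h2 := Int.abs_sub_lt_one_of_floor_eq_floor h1
    have h3 : u c i x - u c i y = (p i x - p i y) / h := by simp only [u]; ring
    rwa [h3, abs_div, abs_of_pos hh, div_lt_one hh] at h2

section Selection
variable {Ω : Type} [PseudoMetricSpace Ω] {n : ℕ}

/-- `z` is at distance less than `μ` from `K`. -/
def NearSet (K : Set (Fin n → ℝ)) (z : Fin n → ℝ) (μ : ℝ) : Prop := ∃ y ∈ K, dist z y < μ

/-- A family of closed sets over a compact base which is Hausdorff continuous and equi-locally
contractible with modulus `ρ`. -/
structure LCField (ρ : ℝ → ℝ) (M : Set Ω) (K : Ω → Set (Fin n → ℝ)) : Prop where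
  isCompact : IsCompact M
  isClosed : ∀ m ∈ M, IsClosed (K m)
  hcont : ∀ m ∈ M, ∀ e > 0, ∃ d > 0, ∀ x ∈ M, dist x m < d →
    (∀ y ∈ K x, NearSet (K m) y e) ∧ ∀ y ∈ K m, NearSet (K x) y e
  contr : ∀ m ∈ M, ∀ y ∈ K m, ∀ r > 0, Contr (K m) y (ρ r) r

theorem exists_local_contraction {ρ : ℝ → ℝ} {M : Set Ω} {K : Ω → Set (Fin n → ℝ)}
    (hK : LCField ρ M K) {r δ : ℝ} (hδ : 0 < δ) (hr : 0 < r) (h4 : 4 * δ ≤ ρ (r / 4))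
    (h8 : 8 * δ ≤ r)
    {f : Ω → Fin n → ℝ} (hf : Continuous f) {m : Ω} (hm : m ∈ M) (hnear : NearSet (K m) (f m) δ)
    {μ : ℝ} (hμ : 0 < μ) :
    ∃ C : (Fin n → ℝ) × ℝ → (Fin n → ℝ), Continuous C ∧ (∀ z, C (z, 0) = z) ∧
      ∃ μ' > 0, ∃ h > 0, ∀ x ∈ M, dist x m < h → ∀ z, dist z (f x) ≤ δ → ∀ τ ∈ Icc (0 : ℝ) 1,
        dist (C (z, τ)) (f x) ≤ r ∧ (NearSet (K x) z μ' → NearSet (K x) (C (z, τ)) μ) ∧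
        NearSet (K x) (C (z, 1)) μ := by
  obtain ⟨ym, hym, hfy⟩ := hnear
  obtain ⟨c, y₁, hc, hc2⟩ := hK.contr m hm ym hym (r / 4) (by positivity)
  set B := closedBall ym (4 * δ) with hB
  have hBρ : B ⊆ closedBall ym (ρ (r / 4)) := closedBall_subset_closedBall h4
  have hBcl : IsClosed B := isClosed_closedBall
  have hKcl := hK.isClosed m hm
  let F : (Fin n → ℝ) × ℝ → (Fin n → ℝ) := fun p =>
    if p.2 = 0 then p.1 else if p.2 = 1 then y₁ else c p
  let D0 : Set ((Fin n → ℝ) × ℝ) := B ×ˢ {0}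
  let D1 : Set ((Fin n → ℝ) × ℝ) := B ×ˢ {1}
  let D2 : Set ((Fin n → ℝ) × ℝ) := (K m ∩ B) ×ˢ Icc 0 1
  have hD0 : IsClosed D0 := hBcl.prod isClosed_singleton
  have hD1 : IsClosed D1 := hBcl.prod isClosed_singleton
  have hD2 : IsClosed D2 := (hKcl.inter hBcl).prod isClosed_Icc
  have hF0 : ContinuousOn F D0 := continuousOn_fst.congr fun p hp => by
    have : p.2 = 0 := hp.2
    simp [F, this]
  have hF1 : ContinuousOn F D1 := (continuousOn_const (c := y₁)).congr fun p hp => by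
    have : p.2 = 1 := hp.2
    simp [F, this]
  have hF2' : ∀ p ∈ D2, F p = c p := by
    rintro ⟨z, τ⟩ ⟨⟨hz, hz'⟩, hτ⟩
    obtain ⟨h0, h1, -⟩ := hc2 z ⟨hz, hBρ hz'⟩
    by_cases h : τ = 0
    · subst h; simp [F, h0]
    by_cases h' : τ = 1
    · subst h'; simp [F, h1]
    · simp [F, h, h']
  have hF2 : ContinuousOn F D2 :=
    (hc.mono (prod_mono (inter_subset_inter_right _ hBρ) Subset.rfl)).congr hF2'
  have hF : ContinuousOn F (D0 ∪ D1 ∪ D2) :=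
    (hF0.union_of_isClosed hF1 hD0 hD1).union_of_isClosed hF2 (hD0.union hD1) hD2
  have hymB : ym ∈ B := mem_closedBall_self (by positivity)
  have hy1 : y₁ ∈ K m ∩ closedBall ym (r / 4) := by
    obtain ⟨-, h1, h2⟩ := hc2 ym ⟨hym, hBρ hymB⟩
    rw [← h1]; exact h2 1 (by simp)
  have hFb : ∀ p ∈ D0 ∪ D1 ∪ D2, F p ∈ closedBall ym (r / 2) := by
    rintro p ((hp | hp) | hp)
    · have : p.2 = 0 := hp.2
      simp only [F, this, if_true]
      exact closedBall_subset_closedBall (by linarith) hp.1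
    · have : p.2 = 1 := hp.2
      simp only [F, this, one_ne_zero, if_false, if_true]
      exact closedBall_subset_closedBall (by linarith) hy1.2
    · rw [hF2' p hp]
      exact closedBall_subset_closedBall (by linarith)
        ((hc2 p.1 ⟨hp.1.1, hBρ hp.1.2⟩).2.2 p.2 hp.2).2
  have hDcl : IsClosed (D0 ∪ D1 ∪ D2) := (hD0.union hD1).union hD2
  have := Metric.instTietzeExtensionClosedBall ℝ ym (r := r / 2) (by positivity)
  obtain ⟨g, hg, hgF⟩ := ContinuousMap.exists_forall_mem_restrict_eq hDcl
    (⟨(D0 ∪ D1 ∪ D2).domRestrict F, hF.domRestrict⟩ : C((D0 ∪ D1 ∪ D2 : Set _), Fin n → ℝ))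
    (t := closedBall ym (r / 2)) (fun x => hFb x x.2)
  have hgD : ∀ p ∈ D0 ∪ D1 ∪ D2, g p = F p := fun p hp => DFunLike.congr_fun hgF ⟨p, hp⟩
  have hg0 : ∀ z ∈ B, g (z, 0) = z := fun z hz => by
    rw [hgD (z, 0) (Or.inl (Or.inl ⟨hz, rfl⟩))]; simp [F]
  have hg1 : ∀ z ∈ B, g (z, 1) = y₁ := fun z hz => by
    rw [hgD (z, 1) (Or.inl (Or.inr ⟨hz, rfl⟩))]; simp [F]
  have hgK : ∀ z ∈ K m ∩ B, ∀ τ ∈ Icc (0 : ℝ) 1, g (z, τ) ∈ K m := fun z hz τ hτ => by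
    rw [hgD _ (Or.inr ⟨hz, hτ⟩), hF2' _ ⟨hz, hτ⟩]
    exact ((hc2 z ⟨hz.1, hBρ hz.2⟩).2.2 τ hτ).1
  have huc : UniformContinuousOn g (B ×ˢ Icc (0 : ℝ) 1) :=
    ((isCompact_closedBall _ _).prod isCompact_Icc).uniformContinuousOn_of_continuous
      g.continuous.continuousOn
  obtain ⟨η, hη, huc⟩ := Metric.uniformContinuousOn_iff.1 huc (μ / 2) (by positivity)
  have he : 0 < min (min (η / 2) (δ / 2)) (μ / 2) := by positivity
  obtain ⟨d, hd, hH⟩ := hK.hcont m hm _ he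
  obtain ⟨d', hd', hfd⟩ := Metric.continuous_iff.1 hf m δ hδ
  refine ⟨fun p => g p - g (p.1, 0) + p.1, by fun_prop, fun z => by simp,
    min (η / 2) (δ / 2), by positivity, min d d', by positivity, fun x hx hxm z hz τ hτ => ?_⟩
  obtain ⟨hH1, hH2⟩ := hH x hx (hxm.trans_le (min_le_left _ _))
  have hfx := hfd x (hxm.trans_le (min_le_right _ _))
  have hzm : dist z ym < 3 * δ := by
    linarith [dist_triangle z (f x) ym, dist_triangle (f x) (f m) ym]
  have hzB : z ∈ B := by rw [hB, mem_closedBall]; linarith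
  have e1 : ∀ τ, g (z, τ) - g (z, 0) + z = g (z, τ) := fun τ => by rw [hg0 z hzB]; abel
  simp only [e1]
  refine ⟨?_, ?_, ?_⟩
  · have := hg (z, τ)
    rw [mem_closedBall] at this
    linarith [dist_triangle (g (z, τ)) ym (f x), dist_triangle ym (f m) (f x), dist_comm ym (f m),
      dist_comm (f m) (f x)]
  · rintro ⟨y, hy, hzy⟩
    obtain ⟨y', hy', hyy'⟩ := hH1 y hy
    have t1 : dist z y' < η := by
      have := min_le_left (η / 2) (δ / 2)
      have := (min_le_left (min (η / 2) (δ / 2)) (μ / 2)).trans (min_le_left (η / 2) (δ / 2))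
      linarith [dist_triangle z y y']
    have t2 : dist z y' < δ := by
      have := min_le_right (η / 2) (δ / 2)
      have := (min_le_left (min (η / 2) (δ / 2)) (μ / 2)).trans (min_le_right (η / 2) (δ / 2))
      linarith [dist_triangle z y y']
    have hyB : y' ∈ B := by
      rw [hB, mem_closedBall]
      linarith [dist_triangle y' z ym, dist_comm y' z]
    have t3 := huc (z, τ) ⟨hzB, hτ⟩ (y', τ) ⟨hyB, hτ⟩ (by simp [Prod.dist_eq, t1])
    obtain ⟨w, hw, hw2⟩ := hH2 _ (hgK y' ⟨hy', hyB⟩ τ hτ)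
    refine ⟨w, hw, ?_⟩
    have := min_le_right (min (η / 2) (δ / 2)) (μ / 2)
    linarith [dist_triangle (g (z, τ)) (g (y', τ)) w]
  · rw [hg1 z hzB]
    obtain ⟨w, hw, hw2⟩ := hH2 _ hy1.1
    refine ⟨w, hw, ?_⟩
    have := min_le_right (min (η / 2) (δ / 2)) (μ / 2)
    linarith

end Selection

theorem Finset.exists_pos_forall_le {α : Type*} (s : Finset α) (g : α → ℝ)
    (hg : ∀ a ∈ s, 0 < g a) : ∃ e > 0, ∀ a ∈ s, e ≤ g a := by
  classical
  induction s using Finset.induction_on with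
  | empty => exact ⟨1, one_pos, by simp⟩
  | insert a s ha ih =>
    obtain ⟨e, he, h⟩ := ih fun b hb => hg b (Finset.mem_insert_of_mem hb)
    refine ⟨min e (g a), lt_min he (hg a (Finset.mem_insert_self a s)), fun b hb => ?_⟩
    rcases Finset.mem_insert.1 hb with rfl | hb
    · exact min_le_right _ _
    · exact (min_le_left _ _).trans (h b hb)

section Selection
variable {Ω : Type} [PseudoMetricSpace Ω] {n : ℕ}

/-- A bump function with a label that is locally constant on its support, whose level sets have
diameter less than `h`. -/
structure IsPatch {Λ : Type} (h : ℝ) (ψ : Ω → ℝ) (lab : Ω → Λ) : Prop where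
  cont : Continuous ψ
  mem : ∀ x, ψ x ∈ Icc (0 : ℝ) 1
  loc : ∀ x, 0 < ψ x → ∀ᶠ y in 𝓝 x, lab y = lab x
  scale : ∀ x y, 0 < ψ x → 0 < ψ y → lab x = lab y → dist x y < h

theorem NearSet.mono {K : Set (Fin n → ℝ)} {z : Fin n → ℝ} {μ ν : ℝ} (h : NearSet K z μ)
    (hμ : μ ≤ ν) : NearSet K z ν := by
  obtain ⟨y, hy, h⟩ := h
  exact ⟨y, hy, h.trans_le hμ⟩

theorem exists_correction_on_patch {ρ : ℝ → ℝ} {M : Set Ω} {K : Ω → Set (Fin n → ℝ)}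
    (hK : LCField ρ M K) {r δ : ℝ} (hδ : 0 < δ) (hr : 0 < r) (h4 : 4 * δ ≤ ρ (r / 4))
    (h8 : 8 * δ ≤ r)
    {f : Ω → Fin n → ℝ} (hf : Continuous f) (hnear : ∀ m ∈ M, NearSet (K m) (f m) δ)
    {μ : ℝ} (hμ : 0 < μ) :
    ∃ μ' > 0, ∃ h > 0, ∀ {Λ : Type} (ψ : Ω → ℝ) (lab : Ω → Λ), IsPatch h ψ lab →
      ∀ ζ : Ω → ℝ, Continuous ζ → (∀ x, ζ x ∈ Icc (0 : ℝ) 1) →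
      ∀ g : Ω → Fin n → ℝ, Continuous g → (∀ x ∈ M, dist (g x) (f x) ≤ δ) →
      ∃ g' : Ω → Fin n → ℝ, Continuous g' ∧ (∀ x ∈ M, dist (g' x) (f x) ≤ r) ∧
        (∀ x ∈ M, NearSet (K x) (g x) μ' → NearSet (K x) (g' x) μ) ∧
        (∀ x ∈ M, ψ x = 1 → ζ x = 1 → NearSet (K x) (g' x) μ) ∧ ∀ x, ζ x = 0 → g' x = g x := by
  classical
  choose! C hC hC0 μ' hμ' h hh H using fun m hm =>
    exists_local_contraction hK hδ hr h4 h8 hf hm (hnear m hm) hμ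
  obtain ⟨t, htM, hcov⟩ := hK.isCompact.elim_nhds_subcover (fun m => ball m (h m / 2))
    fun m hm => ball_mem_nhds _ (by have := hh m hm; positivity)
  obtain ⟨h0, hh0, hle⟩ := t.exists_pos_forall_le (fun m => h m / 2)
    fun m hm => by have := hh m (htM m hm); positivity
  obtain ⟨μ0, hμ0, hμle⟩ := t.exists_pos_forall_le μ' fun m hm => hμ' m (htM m hm)
  refine ⟨min μ0 μ, lt_min hμ0 hμ, h0, hh0, fun {Λ} ψ lab hψ ζ hζ hζ1 g hg hgf => ?_⟩
  have key : ∀ l : Λ, ∃ c : (Fin n → ℝ) × ℝ → (Fin n → ℝ), Continuous c ∧ (∀ z, c (z, 0) = z) ∧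
      ∀ x ∈ M, 0 < ψ x → lab x = l → ∀ z, dist z (f x) ≤ δ → ∀ τ ∈ Icc (0 : ℝ) 1,
        dist (c (z, τ)) (f x) ≤ r ∧ (NearSet (K x) z μ0 → NearSet (K x) (c (z, τ)) μ) ∧
        NearSet (K x) (c (z, 1)) μ := by
    intro l
    by_cases hl : ∃ x ∈ M, 0 < ψ x ∧ lab x = l
    · obtain ⟨x, hxM, hx, hxl⟩ := hl
      obtain ⟨m, hm, hxm⟩ : ∃ m ∈ t, x ∈ ball m (h m / 2) := by simpa using hcov hxM
      refine ⟨C m, hC m (htM m hm), hC0 m (htM m hm), fun x' hx' hψx' hl' z hz τ hτ => ?_⟩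
      have h1 := hψ.scale x' x hψx' hx (hl'.trans hxl.symm)
      have h2 := hle m hm
      rw [mem_ball] at hxm
      obtain ⟨a1, a2, a3⟩ := H m (htM m hm) x' hx'
        (by linarith [dist_triangle x' x m]) z hz τ hτ
      exact ⟨a1, fun hz => a2 (hz.mono (hμle m hm)), a3⟩
    · exact ⟨Prod.fst, continuous_fst, fun z => rfl, fun x hx h1 h2 => (hl ⟨x, hx, h1, h2⟩).elim⟩
  choose c hc hc0 hcc using key
  let T : Ω → ℝ := fun x => max 0 (2 * ψ x - 1) * ζ x
  have hψc := hψ.cont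
  have hT : Continuous T := by fun_prop
  have hT1 : ∀ x, T x ∈ Icc (0 : ℝ) 1 := fun x => by
    have h1 : max 0 (2 * ψ x - 1) ≤ 1 := max_le zero_le_one (by linarith [(hψ.mem x).2])
    exact ⟨mul_nonneg (le_max_left _ _) (hζ1 x).1,
      mul_le_one₀ h1 (hζ1 x).1 (hζ1 x).2⟩
  have hT0 : ∀ x, ψ x ≤ 1 / 2 → T x = 0 := fun x hx => by
    simp only [T]; rw [max_eq_left (by linarith), zero_mul]
  refine ⟨fun x => c (lab x) (g x, T x), ?_, fun x hx => ?_, fun x hx hnx => ?_,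
    fun x hx h1 h2 => ?_, fun x hx => ?_⟩
  · refine continuous_iff_continuousAt.2 fun x => ?_
    by_cases hx : 0 < ψ x
    · have : ContinuousAt (fun y => c (lab x) (g y, T y)) x :=
        ((hc (lab x)).comp (hg.prodMk hT)).continuousAt
      refine this.congr ?_
      filter_upwards [hψ.loc x hx] with y hy
      rw [hy]
    · refine hg.continuousAt.congr ?_
      have : ∀ᶠ y in 𝓝 x, ψ y < 1 / 2 := hψc.continuousAt.eventually_lt continuousAt_const
        (by linarith)
      filter_upwards [this] with y hy
      rw [hT0 y hy.le, hc0]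
  · by_cases hψx : 0 < ψ x
    · exact (hcc _ x hx hψx rfl _ (hgf x hx) _ (hT1 x)).1
    · beta_reduce
      rw [hT0 x (by linarith), hc0]
      linarith [hgf x hx]
  · by_cases hψx : 0 < ψ x
    · exact (hcc _ x hx hψx rfl _ (hgf x hx) _ (hT1 x)).2.1 (hnx.mono (min_le_left _ _))
    · beta_reduce
      rw [hT0 x (by linarith), hc0]
      exact hnx.mono (min_le_right _ _)
  · have : T x = 1 := by simp only [T, h1, h2]; norm_num
    beta_reduce
    rw [this]
    exact (hcc _ x hx (by rw [h1]; exact one_pos) rfl _ (hgf x hx) _ (hT1 x)).2.2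
  · have : T x = 0 := by simp only [T, hx, mul_zero]
    beta_reduce
    rw [this, hc0]

theorem exists_correction_on_patches {κ : Type} {ρ : ℝ → ℝ} (hρ : ∀ r > 0, 0 < ρ r)
    (s : Finset κ) {r : ℝ} (hr : 0 < r) :
    ∃ δ > 0, δ ≤ r ∧ ∀ (M : Set Ω) (K : Ω → Set (Fin n → ℝ)), LCField ρ M K →
    ∀ (f : Ω → Fin n → ℝ), Continuous f → (∀ m ∈ M, NearSet (K m) (f m) δ) →
    ∀ μ > 0, ∃ μ' > 0, ∃ h > 0, ∀ {Λ : Type} (ψ : κ → Ω → ℝ) (lab : κ → Ω → Λ),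
      (∀ c, IsPatch h (ψ c) (lab c)) →
      ∀ ζ : Ω → ℝ, Continuous ζ → (∀ x, ζ x ∈ Icc (0 : ℝ) 1) →
      ∀ g : Ω → Fin n → ℝ, Continuous g → (∀ x ∈ M, dist (g x) (f x) ≤ δ) →
      ∃ g' : Ω → Fin n → ℝ, Continuous g' ∧ (∀ x ∈ M, dist (g' x) (f x) ≤ r) ∧
        (∀ x ∈ M, NearSet (K x) (g x) μ' → NearSet (K x) (g' x) μ) ∧
        (∀ x ∈ M, (∃ c ∈ s, ψ c x = 1) → ζ x = 1 → NearSet (K x) (g' x) μ) ∧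
        ∀ x, ζ x = 0 → g' x = g x := by
  classical
  induction s using Finset.induction_on generalizing r with
  | empty =>
    refine ⟨r, hr, le_rfl, fun M K hK f hf hn μ hμ => ⟨μ, hμ, 1, one_pos, ?_⟩⟩
    intro Λ ψ lab hψ ζ hζ hζ1 g hg hgf
    exact ⟨g, hg, hgf, fun _ _ => id, fun x _ ⟨c, hc, _⟩ => by simp at hc, fun _ _ => rfl⟩
  | insert a s ha ih =>
    have hρ4 := hρ (r / 4) (by positivity)
    set δ₁ := min (ρ (r / 4) / 4) (r / 8) with hδ₁
    have hδ₁0 : 0 < δ₁ := by positivity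
    have h4 : 4 * δ₁ ≤ ρ (r / 4) := by linarith [min_le_left (ρ (r / 4) / 4) (r / 8)]
    have h8 : 8 * δ₁ ≤ r := by linarith [min_le_right (ρ (r / 4) / 4) (r / 8)]
    obtain ⟨δ, hδ, hδle, H⟩ := ih hδ₁0
    refine ⟨δ, hδ, by linarith, fun M K hK f hf hn μ hμ => ?_⟩
    obtain ⟨μ₁, hμ₁, h₁, hh₁, H₁⟩ := exists_correction_on_patch hK hδ₁0 hr h4 h8 hf
      (fun m hm => (hn m hm).mono hδle) hμ
    obtain ⟨μ₂, hμ₂, h₂, hh₂, H₂⟩ := H M K hK f hf hn μ₁ hμ₁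
    refine ⟨μ₂, hμ₂, min h₁ h₂, lt_min hh₁ hh₂, ?_⟩
    intro Λ ψ lab hψ ζ hζ hζ1 g hg hgf
    have hp : ∀ c h', min h₁ h₂ ≤ h' → IsPatch h' (ψ c) (lab c) := fun c h' hle =>
      ⟨(hψ c).cont, (hψ c).mem, (hψ c).loc, fun x y h1 h2 h3 =>
        ((hψ c).scale x y h1 h2 h3).trans_le hle⟩
    obtain ⟨g₁, hg₁, a1, a2, a3, a4⟩ :=
      H₂ ψ lab (fun c => hp c _ (min_le_right _ _)) ζ hζ hζ1 g hg hgf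
    obtain ⟨g₂, hg₂, b1, b2, b3, b4⟩ :=
      H₁ (ψ a) (lab a) (hp a _ (min_le_left _ _)) ζ hζ hζ1 g₁ hg₁ a1
    refine ⟨g₂, hg₂, b1, fun x hx h => b2 x hx (a2 x hx h), ?_, fun x hx => by
      rw [b4 x hx, a4 x hx]⟩
    rintro x hx ⟨c, hc, hcx⟩ hζx
    rcases Finset.mem_insert.1 hc with rfl | hc
    · exact b3 x hx hcx hζx
    · exact b2 x hx (a3 x hx ⟨c, hc, hcx⟩ hζx)

theorem exists_improvement {κ : Type} [Finite κ] (hΩ : ColorCover Ω κ) {ρ : ℝ → ℝ}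
    (hρ : ∀ r > 0, 0 < ρ r) {r : ℝ} (hr : 0 < r) :
    ∃ δ > 0, ∀ (M : Set Ω) (K : Ω → Set (Fin n → ℝ)), LCField ρ M K →
    ∀ (f : Ω → Fin n → ℝ), Continuous f → (∀ m ∈ M, NearSet (K m) (f m) δ) →
    ∀ A ⊆ M, IsClosed A → (∀ m ∈ A, f m ∈ K m) → ∀ ν > 0,
      ∃ g : Ω → Fin n → ℝ, Continuous g ∧ (∀ x ∈ M, dist (g x) (f x) ≤ r) ∧
        (∀ x ∈ M, NearSet (K x) (g x) ν) ∧ ∀ x ∈ A, g x = f x := by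
  have := Fintype.ofFinite κ
  obtain ⟨δ, hδ, -, H⟩ := exists_correction_on_patches (Ω := Ω) (n := n) hρ
    (Finset.univ : Finset κ) hr
  refine ⟨δ, hδ, fun M K hK f hf hn A hAM hA hfA ν hν => ?_⟩
  obtain ⟨μ, hμ, h, hh, H⟩ := H M K hK f hf hn ν hν
  obtain ⟨Λ, ψ, lab, p1, p2, p3, p4, p5⟩ := hΩ h hh
  have hnear : ∀ x ∈ M, NearSet (K x) (f x) μ → ∀ᶠ y in 𝓝[M] x, NearSet (K y) (f y) μ := by
    rintro x hx ⟨y, hy, hxy⟩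
    have he : 0 < (μ - dist (f x) y) / 2 := by linarith
    obtain ⟨d, hd, hH⟩ := hK.hcont x hx _ he
    obtain ⟨d', hd', hfd⟩ := Metric.continuous_iff.1 hf x _ he
    filter_upwards [self_mem_nhdsWithin, mem_nhdsWithin_of_mem_nhds (ball_mem_nhds x hd),
      mem_nhdsWithin_of_mem_nhds (ball_mem_nhds x hd')] with z hzM hz hz'
    obtain ⟨w, hw, hyw⟩ := (hH z hzM hz).2 y hy
    refine ⟨w, hw, ?_⟩
    have := hfd z hz'
    linarith [dist_triangle (f z) (f x) w, dist_triangle (f x) y w]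
  let B : Set Ω := {x | x ∈ M ∧ ¬ NearSet (K x) (f x) μ}
  have hM := hK.isCompact
  obtain ⟨ζ, hζ0, hζ1, hζ01⟩ : ∃ ζ : C(Ω, ℝ), (∀ x ∈ A, ζ x = 0) ∧ (∀ x ∈ B, ζ x = 1) ∧
      ∀ x, ζ x ∈ Icc (0 : ℝ) 1 := by
    have hAc : Disjoint A (closure B) := by
      refine Set.disjoint_left.2 fun x hx hxB => ?_
      have h1 := hnear x (hAM hx) ⟨f x, hfA x hx, by simpa using hμ⟩
      rw [mem_closure_iff_frequently] at hxB
      rw [eventually_nhdsWithin_iff] at h1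
      obtain ⟨y, hy, hy'⟩ := (hxB.and_eventually h1).exists
      exact hy.2 (hy' hy.1)
    obtain ⟨ζ, h0, h1, h01⟩ := exists_continuous_zero_one_of_isClosed hA isClosed_closure hAc
    exact ⟨ζ, h0, fun x hx => h1 (subset_closure hx), h01⟩
  obtain ⟨g, hg, a1, a2, a3, a4⟩ := H ψ lab (fun c => ⟨p1 c, p2 c, p4 c, p5 c⟩) ζ ζ.continuous hζ01
    f hf (fun x _ => by simpa using hδ.le)
  refine ⟨g, hg, a1, fun x hx => ?_, fun x hx => a4 x (hζ0 x hx)⟩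
  by_cases hxn : NearSet (K x) (f x) μ
  · exact a2 x hx hxn
  · obtain ⟨c, hc⟩ := p3 x
    exact a3 x hx ⟨c, Finset.mem_univ c, hc⟩ (hζ1 x ⟨hx, hxn⟩)

/-- A selection theorem for equi-locally contractible families over finite-dimensional bases. -/
theorem exists_selection {κ : Type} [Finite κ] (hΩ : ColorCover Ω κ) {ρ : ℝ → ℝ}
    (hρ : ∀ r > 0, 0 < ρ r) {r : ℝ} (hr : 0 < r) :
    ∃ δ > 0, ∀ (M : Set Ω) (K : Ω → Set (Fin n → ℝ)), LCField ρ M K →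
    ∀ (f : Ω → Fin n → ℝ), Continuous f → (∀ m ∈ M, NearSet (K m) (f m) δ) →
    ∀ A ⊆ M, IsClosed A → (∀ m ∈ A, f m ∈ K m) →
      ∃ g : Ω → Fin n → ℝ, ContinuousOn g M ∧ (∀ x ∈ M, dist (g x) (f x) ≤ r) ∧
        (∀ x ∈ M, g x ∈ K x) ∧ ∀ x ∈ A, g x = f x := by
  have hrk : ∀ k : ℕ, 0 < r / 2 / 2 ^ k := fun k => by positivity
  choose δ hδ H using fun k : ℕ => exists_improvement (n := n) hΩ hρ (hrk k)
  refine ⟨δ 0, hδ 0, fun M K hK f hf hn A hAM hA hfA => ?_⟩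
  let P : ℕ → (Ω → Fin n → ℝ) → Prop := fun k g => Continuous g ∧
    (∀ m ∈ M, NearSet (K m) (g m) (min (δ k) (1 / 2 ^ k))) ∧ ∀ x ∈ A, g x = f x
  have step : ∀ k g, (Continuous g ∧ (∀ m ∈ M, NearSet (K m) (g m) (δ k)) ∧ ∀ x ∈ A, g x = f x) →
      ∃ g', P (k + 1) g' ∧ ∀ x ∈ M, dist (g' x) (g x) ≤ r / 2 / 2 ^ k := by
    rintro k g ⟨h1, h2, h3⟩
    obtain ⟨g', a1, a2, a3, a4⟩ := H k M K hK g h1 h2 A hAM hA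
      (fun m hm => by rw [h3 m hm]; exact hfA m hm) (min (δ (k + 1)) (1 / 2 ^ (k + 1)))
      (lt_min (hδ _) (by positivity))
    exact ⟨g', ⟨a1, a3, fun x hx => (a4 x hx).trans (h3 x hx)⟩, a2⟩
  have step' : ∀ k (g : {g // Continuous g ∧ (∀ m ∈ M, NearSet (K m) (g m) (δ k)) ∧
      ∀ x ∈ A, g x = f x}), ∃ g' : {g // Continuous g ∧
      (∀ m ∈ M, NearSet (K m) (g m) (δ (k + 1))) ∧ ∀ x ∈ A, g x = f x},
      (∀ x ∈ M, dist (g'.1 x) (g.1 x) ≤ r / 2 / 2 ^ k) ∧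
      ∀ m ∈ M, NearSet (K m) (g'.1 m) (1 / 2 ^ (k + 1)) := by
    intro k g
    obtain ⟨g', ⟨a1, a2, a3⟩, a4⟩ := step k g.1 g.2
    exact ⟨⟨g', a1, fun m hm => (a2 m hm).mono (min_le_left _ _), a3⟩, a4,
      fun m hm => (a2 m hm).mono (min_le_right _ _)⟩
  choose nxt hnxt hnxt' using step'
  let F : ∀ k, {g // Continuous g ∧ (∀ m ∈ M, NearSet (K m) (g m) (δ k)) ∧
      ∀ x ∈ A, g x = f x} := fun k => Nat.rec ⟨f, hf, hn, fun _ _ => rfl⟩ (fun k g => nxt k g) k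
  have hF : ∀ k, F (k + 1) = nxt k (F k) := fun k => rfl
  have hd : ∀ x ∈ M, ∀ k, dist ((F k).1 x) ((F (k + 1)).1 x) ≤ r / 2 / 2 ^ k := fun x hx k => by
    rw [dist_comm, hF]; exact hnxt k (F k) x hx
  have hlim : ∀ x, ∃ y, x ∈ M → Tendsto (fun k => (F k).1 x) atTop (𝓝 y) := fun x => by
    by_cases hx : x ∈ M
    · obtain ⟨y, hy⟩ := cauchySeq_tendsto_of_complete
        (cauchySeq_of_le_geometric_two (C := r) (hd x hx))
      exact ⟨y, fun _ => hy⟩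
    · exact ⟨0, fun h => (hx h).elim⟩
  choose g hg using hlim
  have hdist : ∀ x ∈ M, ∀ k, dist ((F k).1 x) (g x) ≤ r / 2 ^ k := fun x hx k =>
    dist_le_of_le_geometric_two_of_tendsto (hd x hx) (hg x hx) k
  refine ⟨g, ?_, fun x hx => ?_, fun x hx => ?_, fun x hx => ?_⟩
  · have hu : TendstoUniformlyOn (fun k => (F k).1) g atTop M := by
      rw [Metric.tendstoUniformlyOn_iff]
      intro e he
      have ht : Tendsto (fun k : ℕ => r / 2 ^ k) atTop (𝓝 0) := by
        have := (tendsto_pow_atTop_nhds_zero_of_lt_one (r := (1 / 2 : ℝ)) (by norm_num)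
          (by norm_num)).const_mul r
        simpa [div_eq_mul_inv] using this
      filter_upwards [ht.eventually_lt_const he] with k hk x hx
      rw [dist_comm]
      exact (hdist x hx k).trans_lt hk
    exact hu.continuousOn (Frequently.of_forall fun k => (F k).2.1.continuousOn)
  · have := hdist x hx 0
    rw [dist_comm]; simpa [F] using this
  · rw [← (hK.isClosed x hx).closure_eq, Metric.mem_closure_iff]
    intro e he
    have ht : Tendsto (fun k : ℕ => (r + 1) / 2 ^ k) atTop (𝓝 0) := by
      have := (tendsto_pow_atTop_nhds_zero_of_lt_one (r := (1 / 2 : ℝ)) (by norm_num)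
        (by norm_num)).const_mul (r + 1)
      simpa [div_eq_mul_inv] using this
    obtain ⟨k, hk, hk1⟩ := ((ht.eventually_lt_const he).and (eventually_ge_atTop 1)).exists
    obtain ⟨k, rfl⟩ := Nat.exists_eq_add_of_le' hk1
    obtain ⟨y, hy, hyd⟩ := hnxt' k (F k) x hx
    refine ⟨y, hy, ?_⟩
    have h1 := hdist x hx (k + 1)
    rw [hF] at h1
    rw [add_div] at hk
    linarith [dist_triangle (g x) ((nxt k (F k)).1 x) y, dist_comm (g x) ((nxt k (F k)).1 x)]
  · have h1 : Tendsto (fun k => (F k).1 x) atTop (𝓝 (f x)) :=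
      tendsto_const_nhds.congr fun k => ((F k).2.2.2 x hx).symm
    exact tendsto_nhds_unique (hg x (hAM hx)) h1

end Selection

section SelectionList
variable {Ω : Type} [MetricSpace Ω] {n : ℕ}

/-- `LCField` for `K` and for all its intersections with the listed sets `Q`, each over the
corresponding part `M ∩ N` of the base. -/
def LCFields (ρ : ℝ → ℝ) : List (Set Ω × Set (Fin n → ℝ)) → Set Ω → (Ω → Set (Fin n → ℝ)) → Prop
  | [], M, K => LCField ρ M K
  | (N, Q) :: l, M, K => LCFields ρ l M K ∧ LCFields ρ l (M ∩ N) fun x => K x ∩ Q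

/-- `f` is `δ`-close to `K` and to its intersections with the listed sets. -/
def NearSets (δ : ℝ) (f : Ω → Fin n → ℝ) :
    List (Set Ω × Set (Fin n → ℝ)) → Set Ω → (Ω → Set (Fin n → ℝ)) → Prop
  | [], M, K => ∀ m ∈ M, NearSet (K m) (f m) δ
  | (N, Q) :: l, M, K => NearSets δ f l M K ∧ NearSets δ f l (M ∩ N) fun x => K x ∩ Q

theorem NearSets.of_dist {δ δ' : ℝ} {f f' : Ω → Fin n → ℝ} {l : List (Set Ω × Set (Fin n → ℝ))}
    {M : Set Ω} {K : Ω → Set (Fin n → ℝ)} (h : NearSets δ f l M K)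
    (hd : ∀ x ∈ M, dist (f' x) (f x) + δ ≤ δ') : NearSets δ' f' l M K := by
  induction l generalizing M K with
  | nil =>
    intro m hm
    obtain ⟨y, hy, hy'⟩ := h m hm
    exact ⟨y, hy, by linarith [hd m hm, dist_triangle (f' m) (f m) y]⟩
  | cons p l ih =>
    obtain ⟨N, Q⟩ := p
    exact ⟨ih h.1 hd, ih h.2 fun x hx => hd x hx.1⟩

theorem LCField.mono {ρ ρ' : ℝ → ℝ} {M : Set Ω} {K : Ω → Set (Fin n → ℝ)} (h : LCField ρ M K)
    (hρ : ∀ r > 0, ρ' r ≤ ρ r) : LCField ρ' M K :=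
  ⟨h.isCompact, h.isClosed, h.hcont, fun m hm y hy r hr =>
    (h.contr m hm y hy r hr).mono (by simpa using hρ r hr) (by simp)⟩

theorem LCFields.mono {ρ ρ' : ℝ → ℝ} {l : List (Set Ω × Set (Fin n → ℝ))} {M : Set Ω}
    {K : Ω → Set (Fin n → ℝ)} (h : LCFields ρ l M K)
    (hρ : ∀ r > 0, ρ' r ≤ ρ r) : LCFields ρ' l M K := by
  induction l generalizing M K with
  | nil => exact LCField.mono h hρ
  | cons p l ih => exact ⟨ih h.1, ih h.2⟩

theorem LCFields.isCompact {ρ : ℝ → ℝ} {l : List (Set Ω × Set (Fin n → ℝ))} {M : Set Ω}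
    {K : Ω → Set (Fin n → ℝ)} (h : LCFields ρ l M K) : IsCompact M := by
  induction l generalizing M K with
  | nil => exact LCField.isCompact h
  | cons p l ih => exact ih h.1

theorem exists_selection_list {κ : Type} [Finite κ] (hΩ : ColorCover Ω κ) {ρ : ℝ → ℝ}
    (hρ : ∀ r > 0, 0 < ρ r) (l : List (Set Ω × Set (Fin n → ℝ))) (hl : ∀ p ∈ l, IsClosed p.1)
    {r : ℝ} (hr : 0 < r) :
    ∃ δ > 0, ∀ (M : Set Ω) (K : Ω → Set (Fin n → ℝ)), LCFields ρ l M K →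
    ∀ (f : Ω → Fin n → ℝ), Continuous f → NearSets δ f l M K →
    ∀ A ⊆ M, IsClosed A → (∀ m ∈ A, f m ∈ K m) → (∀ m ∈ A, ∀ p ∈ l, m ∈ p.1 → f m ∈ p.2) →
      ∃ g : Ω → Fin n → ℝ, ContinuousOn g M ∧ (∀ x ∈ M, dist (g x) (f x) ≤ r) ∧
        (∀ x ∈ M, g x ∈ K x) ∧ (∀ x ∈ M, ∀ p ∈ l, x ∈ p.1 → g x ∈ p.2) ∧
        ∀ x ∈ A, g x = f x := by
  induction l generalizing r with
  | nil =>
    obtain ⟨δ, hδ, H⟩ := exists_selection (n := n) hΩ hρ hr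
    refine ⟨δ, hδ, fun M K hK f hf hn A hAM hA hfA _ => ?_⟩
    obtain ⟨g, a1, a2, a3, a4⟩ := H M K hK f hf hn A hAM hA hfA
    exact ⟨g, a1, a2, a3, by simp, a4⟩
  | cons p l ih =>
    obtain ⟨N, Q⟩ := p
    have hN : IsClosed N := hl (N, Q) (by simp)
    replace ih := fun {r} (hr : 0 < r) => ih (fun p hp => hl p (List.mem_cons_of_mem _ hp)) hr
    obtain ⟨δ₁, hδ₁, H₁⟩ := ih (half_pos hr)
    set r₁ := min (δ₁ / 2) (r / 2) with hr₁
    have hr₁0 : 0 < r₁ := by positivity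
    obtain ⟨δ₂, hδ₂, H₂⟩ := ih hr₁0
    refine ⟨min δ₂ (δ₁ / 2), by positivity, fun M K hK f hf hn A hAM hA hfA hfl => ?_⟩
    have hMcl : IsClosed M := hK.1.isCompact.isClosed
    obtain ⟨g, g1, g2, g3, g4, g5⟩ := H₂ (M ∩ N) (fun x => K x ∩ Q) hK.2 f hf
      (hn.2.of_dist fun x _ => by simp) (A ∩ N) (inter_subset_inter_left _ hAM) (hA.inter hN)
      (fun m hm => ⟨hfA m hm.1, hfl m hm.1 (N, Q) (by simp) hm.2⟩)
      (fun m hm p hp => hfl m hm.1 p (List.mem_cons_of_mem _ hp))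
    have hMN : IsClosed (M ∩ N) := hMcl.inter hN
    have hA'cl : IsClosed (A ∪ M ∩ N) := hA.union hMN
    classical
    let e : Ω → Fin n → ℝ := fun x => if x ∈ A then 0 else g x - f x
    have he1 : ∀ x ∈ A, e x = 0 := fun x hx => by simp [e, hx]
    have he2 : ∀ x ∈ M ∩ N, e x = g x - f x := fun x hx => by
      by_cases h : x ∈ A
      · rw [he1 x h, g5 x ⟨h, hx.2⟩, sub_self]
      · simp [e, h]
    have hec : ContinuousOn e (A ∪ M ∩ N) :=
      (continuousOn_const.congr he1).union_of_isClosed ((g1.sub hf.continuousOn).congr he2) hA hMN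
    have heb : ∀ x ∈ A ∪ M ∩ N, e x ∈ closedBall 0 r₁ := by
      rintro x (hx | hx)
      · rw [he1 x hx]; exact mem_closedBall_self hr₁0.le
      · rw [he2 x hx, mem_closedBall, dist_zero_right, ← dist_eq_norm]; exact g2 x hx
    have := Metric.instTietzeExtensionClosedBall ℝ (0 : Fin n → ℝ) hr₁0
    obtain ⟨E, hE, hEe⟩ := ContinuousMap.exists_forall_mem_restrict_eq hA'cl
      (⟨(A ∪ M ∩ N).domRestrict e, hec.domRestrict⟩ : C((A ∪ M ∩ N : Set Ω), Fin n → ℝ))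
      (t := closedBall 0 r₁) (fun x => heb x x.2)
    have hEe' : ∀ p ∈ A ∪ M ∩ N, E p = e p := fun p hp => DFunLike.congr_fun hEe ⟨p, hp⟩
    have hEn : ∀ x, ‖E x‖ ≤ r₁ := fun x => by simpa using hE x
    have hf'A : ∀ x ∈ A, f x + E x = f x := fun x hx => by
      rw [hEe' x (Or.inl hx), he1 x hx, add_zero]
    have hf'M : ∀ x ∈ M ∩ N, f x + E x = g x := fun x hx => by
      rw [hEe' x (Or.inr hx), he2 x hx]; abel
    obtain ⟨g', a1, a2, a3, a4, a5⟩ := H₁ M K hK.1 (fun x => f x + E x) (by fun_prop)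
      (hn.1.of_dist fun x _ => by
        have := hEn x
        have := min_le_left (δ₁ / 2) (r / 2)
        have := min_le_right δ₂ (δ₁ / 2)
        rw [dist_eq_norm, add_sub_cancel_left]
        linarith) (A ∪ M ∩ N) (union_subset hAM inter_subset_left) hA'cl
      (by
        rintro m (hm | hm)
        · rw [hf'A m hm]; exact hfA m hm
        · rw [hf'M m hm]; exact (g3 m hm).1)
      (by
        rintro m (hm | hm) p hp hmp
        · rw [hf'A m hm]; exact hfl m hm p (List.mem_cons_of_mem _ hp) hmp
        · rw [hf'M m hm]; exact g4 m hm p hp hmp)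
    refine ⟨g', a1, fun x hx => ?_, a3, fun x hx p hp hxp => ?_, fun x hx => ?_⟩
    · have h1 := a2 x hx
      have h2 := hEn x
      have h3 : dist (f x + E x) (f x) = ‖E x‖ := by rw [dist_eq_norm, add_sub_cancel_left]
      have := min_le_right (δ₁ / 2) (r / 2)
      linarith [dist_triangle (g' x) (f x + E x) (f x)]
    · rcases List.mem_cons.1 hp with rfl | hp
      · rw [a5 x (Or.inr ⟨hx, hxp⟩), hf'M x ⟨hx, hxp⟩]
        exact (g3 x ⟨hx, hxp⟩).2
      · exact a4 x hx p hp hxp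
    · rw [a5 x (Or.inl hx), hf'A x hx]

end SelectionList

/-- Local tameness of a one-parameter family at a parameter value: Hausdorff continuity and
equi-local contractibility near `s₀`. -/
structure TameAt {n : ℕ} (K : ℝ → Set (Fin n → ℝ)) (s₀ : ℝ) : Prop where
  hcont : ∀ e > 0, ∃ d > 0, ∀ s, |s - s₀| < d →
    (∀ y ∈ K s, NearSet (K s₀) y e) ∧ ∀ y ∈ K s₀, NearSet (K s) y e
  contr : ∀ r > 0, ∃ ρ > 0, ∃ d > 0, ∀ s, |s - s₀| < d → ∀ y ∈ K s, Contr (K s) y ρ r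

/-- Tameness of `K` together with all its intersections with members of a list. -/
def TameAtL {n : ℕ} : List (Set (Fin n → ℝ)) → (ℝ → Set (Fin n → ℝ)) → ℝ → Prop
  | [], K, s₀ => TameAt K s₀
  | Q :: l, K, s₀ => TameAtL l K s₀ ∧ TameAtL l (fun s => K s ∩ Q) s₀

section Transport
variable {n : ℕ}

theorem TameAt.exists_uniform_near {K : ℝ → Set (Fin n → ℝ)} {a b : ℝ}
    (h : ∀ s ∈ Icc a b, TameAt K s) {δ : ℝ} (hδ : 0 < δ) :
    ∃ η > 0, ∀ s ∈ Icc a b, ∀ s' ∈ Icc a b, |s - s'| ≤ η → ∀ x ∈ K s, NearSet (K s') x δ := by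
  choose! d hd H using fun s hs => (h s hs).hcont (δ / 2) (half_pos hδ)
  obtain ⟨η, hη, hc⟩ := lebesgue_number_lemma_of_metric (c := fun s : Icc a b => ball (s : ℝ) (d s))
    (isCompact_Icc (a := a) (b := b)) (fun _ => isOpen_ball)
    (fun s hs => mem_iUnion.2 ⟨⟨s, hs⟩, mem_ball_self (hd s hs)⟩)
  refine ⟨η / 2, half_pos hη, fun s hs s' hs' hss x hx => ?_⟩
  obtain ⟨i, hi⟩ := hc s hs
  have h1 : s ∈ ball (i : ℝ) (d i) := hi (mem_ball_self hη)
  have h2 : s' ∈ ball (i : ℝ) (d i) := hi (by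
    rw [mem_ball, dist_comm, Real.dist_eq]; linarith)
  rw [mem_ball, Real.dist_eq] at h1 h2
  obtain ⟨y, hy, hxy⟩ := (H i i.2 s h1).1 x hx
  obtain ⟨z, hz, hyz⟩ := (H i i.2 s' h2).2 y hy
  exact ⟨z, hz, by linarith [dist_triangle x y z]⟩

theorem TameAt.exists_uniform_contr {K : ℝ → Set (Fin n → ℝ)} {a b : ℝ}
    (h : ∀ s ∈ Icc a b, TameAt K s) {r : ℝ} (hr : 0 < r) :
    ∃ ρ > 0, ∀ s ∈ Icc a b, ∀ y ∈ K s, Contr (K s) y ρ r := by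
  choose! ρ hρ d hd H using fun s hs => (h s hs).contr r hr
  obtain ⟨t, ht, hcov⟩ := (isCompact_Icc (a := a) (b := b)).elim_nhds_subcover
    (fun s => ball s (d s)) fun s hs => ball_mem_nhds _ (hd s hs)
  obtain ⟨e, he, hle⟩ := t.exists_pos_forall_le ρ fun s hs => hρ s (ht s hs)
  refine ⟨e, he, fun s hs y hy => ?_⟩
  obtain ⟨i, hi, hsi⟩ : ∃ i ∈ t, s ∈ ball i (d i) := by simpa using hcov hs
  exact (H i (ht i hi) s (by rwa [mem_ball, Real.dist_eq] at hsi) y hy).mono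
    (by simpa using hle i hi) (by simp)

theorem TameAtL.nil {l : List (Set (Fin n → ℝ))} {K : ℝ → Set (Fin n → ℝ)} {s : ℝ}
    (h : TameAtL l K s) : TameAt K s := by
  induction l generalizing K with
  | nil => exact h
  | cons Q l ih => exact ih h.1

/-- The list of constraints `(s, x, s') ↦ x ∈ Q`. -/
def constraintList (l : List (Set (Fin n → ℝ))) :
    List (Set (ℝ × (Fin n → ℝ) × ℝ) × Set (Fin n → ℝ)) :=
  l.map fun Q => ({ω | ω.2.1 ∈ Q}, Q)

theorem TameAtL.exists_lcFields {l : List (Set (Fin n → ℝ))} (hl : ∀ Q ∈ l, IsClosed Q)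
    {K : ℝ → Set (Fin n → ℝ)} {a b : ℝ}
    (hK : ∀ s ∈ Icc a b, IsClosed (K s)) (h : ∀ s ∈ Icc a b, TameAtL l K s) :
    ∃ ρ : ℝ → ℝ, (∀ r > 0, 0 < ρ r) ∧ ∀ M : Set (ℝ × (Fin n → ℝ) × ℝ), IsCompact M →
      (∀ ω ∈ M, ω.2.2 ∈ Icc a b) → LCFields ρ (constraintList l) M fun ω => K ω.2.2 := by
  induction l generalizing K with
  | nil =>
    have h' : ∀ s ∈ Icc a b, TameAt K s := h
    choose! ρ hρ H using fun r (hr : 0 < r) => TameAt.exists_uniform_contr h' hr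
    refine ⟨ρ, hρ, fun M hM hMab => ?_⟩
    refine LCField.mk hM (fun m hm => hK _ (hMab m hm)) (fun m hm e he => ?_)
      fun m hm y hy r hr => H r hr _ (hMab m hm) y hy
    obtain ⟨d, hd, hH⟩ := (h' _ (hMab m hm)).hcont e he
    refine ⟨d, hd, fun x _ hxm => hH _ ?_⟩
    have h1 : dist x.2.2 m.2.2 ≤ dist x m :=
      (le_max_right _ _).trans (le_max_right (dist x.1 m.1) (dist x.2 m.2))
    rw [Real.dist_eq] at h1
    linarith
  | cons Q l ih =>
    have hl' := fun Q hQ => hl Q (List.mem_cons_of_mem _ hQ)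
    obtain ⟨ρ₁, hρ₁, H₁⟩ := ih hl' hK fun s hs => (h s hs).1
    obtain ⟨ρ₂, hρ₂, H₂⟩ := ih hl' (fun s hs => (hK s hs).inter (hl Q (by simp)))
      fun s hs => (h s hs).2
    refine ⟨fun r => min (ρ₁ r) (ρ₂ r), fun r hr => lt_min (hρ₁ r hr) (hρ₂ r hr),
      fun M hM hMab => ⟨(H₁ M hM hMab).mono fun r _ => min_le_left _ _,
        (H₂ _ ?_ fun ω hω => hMab ω hω.1).mono fun r _ => min_le_right _ _⟩⟩
    exact hM.inter_right ((hl Q (by simp)).preimage (by fun_prop))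

theorem TameAtL.exists_nearSets {l : List (Set (Fin n → ℝ))}
    {K : ℝ → Set (Fin n → ℝ)} {a b : ℝ} (h : ∀ s ∈ Icc a b, TameAtL l K s) {δ : ℝ} (hδ : 0 < δ) :
    ∃ η > 0, ∀ M : Set (ℝ × (Fin n → ℝ) × ℝ), (∀ ω ∈ M, ω.1 ∈ Icc a b ∧ ω.2.2 ∈ Icc a b ∧
      |ω.1 - ω.2.2| ≤ η ∧ ω.2.1 ∈ K ω.1) →
      NearSets δ (fun ω => ω.2.1) (constraintList l) M fun ω => K ω.2.2 := by
  induction l generalizing K with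
  | nil =>
    obtain ⟨η, hη, H⟩ := TameAt.exists_uniform_near h hδ
    refine ⟨η, hη, fun M hM ω hω => ?_⟩
    obtain ⟨h1, h2, h3, h4⟩ := hM ω hω
    exact H _ h1 _ h2 h3 _ h4
  | cons Q l ih =>
    obtain ⟨η₁, hη₁, H₁⟩ := ih fun s hs => (h s hs).1
    obtain ⟨η₂, hη₂, H₂⟩ := ih fun s hs => (h s hs).2
    refine ⟨min η₁ η₂, lt_min hη₁ hη₂, fun M hM => ⟨H₁ M fun ω hω => ?_, H₂ _ fun ω hω => ?_⟩⟩
    · obtain ⟨h1, h2, h3, h4⟩ := hM ω hω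
      exact ⟨h1, h2, h3.trans (min_le_left _ _), h4⟩
    · obtain ⟨h1, h2, h3, h4⟩ := hM ω hω.1
      exact ⟨h1, h2, h3.trans (min_le_right _ _), h4, hω.2⟩

theorem colorCover_transport :
    ColorCover (ℝ × (Fin n → ℝ) × ℝ) (Option (Option (Fin n)) → Bool) := by
  refine colorCover_of_coords (fun i ω => match i with
    | none => ω.1
    | some none => ω.2.2
    | some (some i) => ω.2.1 i) ?_ ?_
  · rintro (_ | _ | i)
    · exact continuous_fst
    · exact continuous_snd.comp continuous_snd
    · exact (continuous_apply i).comp (continuous_fst.comp continuous_snd)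
  · intro x y h hh H
    refine max_lt (H none) (max_lt ?_ (H (some none)))
    exact (dist_pi_lt_iff hh).2 fun i => H (some (some i))

theorem TameAt.isClosed_graph {K : ℝ → Set (Fin n → ℝ)} {a b : ℝ}
    (hK : ∀ s ∈ Icc a b, IsClosed (K s)) (h : ∀ s ∈ Icc a b, TameAt K s) :
    IsClosed {p : ℝ × (Fin n → ℝ) | p.1 ∈ Icc a b ∧ p.2 ∈ K p.1} := by
  refine isClosed_of_closure_subset fun p hp => ?_
  have hp1 : p.1 ∈ Icc a b := by
    have : closure {p : ℝ × (Fin n → ℝ) | p.1 ∈ Icc a b ∧ p.2 ∈ K p.1} ⊆ Prod.fst ⁻¹' Icc a b :=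
      closure_minimal (fun q hq => hq.1) (isClosed_Icc.preimage continuous_fst)
    exact this hp
  refine ⟨hp1, ?_⟩
  rw [← (hK _ hp1).closure_eq, Metric.mem_closure_iff]
  intro e he
  obtain ⟨d, hd, H⟩ := (h _ hp1).hcont (e / 2) (half_pos he)
  obtain ⟨q, hq, hpq⟩ := Metric.mem_closure_iff.1 hp (min d (e / 2)) (by positivity)
  have h1 : dist p.1 q.1 < d := (le_max_left _ _).trans_lt (hpq.trans_le (min_le_left _ _))
  have h2 : dist p.2 q.2 < e / 2 := (le_max_right _ _).trans_lt (hpq.trans_le (min_le_right _ _))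
  rw [dist_comm, Real.dist_eq] at h1
  obtain ⟨y, hy, hqy⟩ := (H q.1 h1).1 q.2 hq.2
  exact ⟨y, hy, by linarith [dist_triangle p.2 q.2 y]⟩

theorem exists_transport {l : List (Set (Fin n → ℝ))} (hl : ∀ Q ∈ l, IsClosed Q)
    {K : ℝ → Set (Fin n → ℝ)} {a b R : ℝ} (hK : ∀ s ∈ Icc a b, IsClosed (K s))
    (hR : ∀ s ∈ Icc a b, K s ⊆ closedBall 0 R) (h : ∀ s ∈ Icc a b, TameAtL l K s) :
    ∃ η > 0, ∃ T : ℝ × (Fin n → ℝ) × ℝ → Fin n → ℝ,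
      ContinuousOn T {ω | ω.1 ∈ Icc a b ∧ ω.2.2 ∈ Icc a b ∧ |ω.1 - ω.2.2| ≤ η ∧ ω.2.1 ∈ K ω.1} ∧
      ∀ s ∈ Icc a b, ∀ s' ∈ Icc a b, |s - s'| ≤ η → ∀ x ∈ K s,
        T (s, x, s') ∈ K s' ∧ (x ∈ K s' → T (s, x, s') = x) ∧ ∀ Q ∈ l, x ∈ Q → T (s, x, s') ∈ Q := by
  obtain ⟨ρ, hρ, H⟩ := TameAtL.exists_lcFields hl hK h
  have hcl : ∀ p ∈ constraintList l, IsClosed p.1 := by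
    intro p hp
    obtain ⟨Q, hQ, rfl⟩ := List.mem_map.1 hp
    exact (hl Q hQ).preimage (by fun_prop)
  obtain ⟨δ, hδ, hsel⟩ := exists_selection_list (colorCover_transport (n := n)) hρ
    (constraintList l) hcl one_pos
  obtain ⟨η, hη, hnear⟩ := TameAtL.exists_nearSets h hδ
  set M : Set (ℝ × (Fin n → ℝ) × ℝ) :=
    {ω | ω.1 ∈ Icc a b ∧ ω.2.2 ∈ Icc a b ∧ |ω.1 - ω.2.2| ≤ η ∧ ω.2.1 ∈ K ω.1} with hM
  have hgr := TameAt.isClosed_graph hK fun s hs => (h s hs).nil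
  have hMcl : IsClosed M := by
    have h1 := hgr.preimage (f := fun ω : ℝ × (Fin n → ℝ) × ℝ => (ω.1, ω.2.1)) (by fun_prop)
    have h2 : IsClosed {ω : ℝ × (Fin n → ℝ) × ℝ | ω.2.2 ∈ Icc a b} :=
      isClosed_Icc.preimage (by fun_prop)
    have h3 : IsClosed {ω : ℝ × (Fin n → ℝ) × ℝ | |ω.1 - ω.2.2| ≤ η} :=
      isClosed_le (by fun_prop) continuous_const
    convert h1.inter (h2.inter h3) using 1
    ext ω
    simp only [hM, mem_ofPred_eq, mem_inter_iff, mem_preimage]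
    tauto
  have hMc : IsCompact M := by
    refine (isCompact_Icc.prod ((isCompact_closedBall (0 : Fin n → ℝ) R).prod
      isCompact_Icc)).of_isClosed_subset hMcl (t := M) (s := Icc a b ×ˢ _ ×ˢ Icc a b) ?_
    rintro ω ⟨h1, h2, -, h4⟩
    exact ⟨h1, hR _ h1 h4, h2⟩
  let A : Set (ℝ × (Fin n → ℝ) × ℝ) := {ω | ω ∈ M ∧ ω.2.1 ∈ K ω.2.2}
  have hA : IsClosed A := by
    have h1 := hgr.preimage (f := fun ω : ℝ × (Fin n → ℝ) × ℝ => (ω.2.2, ω.2.1)) (by fun_prop)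
    convert hMcl.inter h1 using 1
    ext ω
    simp only [A, hM, mem_ofPred_eq, mem_inter_iff, mem_preimage]
    tauto
  obtain ⟨T, t1, -, t3, t4, t5⟩ := hsel M _ (H M hMc fun ω hω => hω.2.1) (fun ω => ω.2.1)
    (by fun_prop) (hnear M fun ω hω => hω) A (fun ω hω => hω.1) hA (fun ω hω => hω.2)
    (by
      intro ω _ p hp hωp
      obtain ⟨Q, hQ, rfl⟩ := List.mem_map.1 hp
      exact hωp)
  refine ⟨η, hη, T, t1, fun s hs s' hs' hss x hx => ?_⟩
  have hmem : (s, x, s') ∈ M := ⟨hs, hs', hss, hx⟩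
  exact ⟨t3 _ hmem, fun hx' => t5 _ ⟨hmem, hx'⟩,
    fun Q hQ hxQ => t4 _ hmem ({ω | ω.2.1 ∈ Q}, Q) (List.mem_map.2 ⟨Q, hQ, rfl⟩) hxQ⟩

end Transport

/-- Infinite concatenation of homotopies converging locally uniformly. -/
theorem exists_infinite_concat {X Z : Type*} [TopologicalSpace X] [TopologicalSpace Z]
    (H : ℕ → X × ℝ → Z) (hH : ∀ k, ContinuousOn (H k) (univ ×ˢ Icc 0 1))
    (hHH : ∀ k x, H k (x, 1) = H (k + 1) (x, 0)) (φ : X → Z) (hφ : Continuous φ)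
    (hlim : ∀ x, ∀ U ∈ 𝓝 (φ x), ∃ W ∈ 𝓝 x, ∃ N, ∀ k ≥ N, ∀ x' ∈ W, ∀ τ ∈ Icc (0 : ℝ) 1,
      H k (x', τ) ∈ U) :
    ∃ G : X × ℝ → Z, ContinuousOn G (univ ×ˢ Icc 0 1) ∧ (∀ x, G (x, 0) = H 0 (x, 0)) ∧
      (∀ x, G (x, 1) = φ x) ∧ ∀ x, ∀ τ ∈ Icc (0 : ℝ) 1, G (x, τ) = φ x ∨
        ∃ k, ∃ τ' ∈ Icc (0 : ℝ) 1, G (x, τ) = H k (x, τ') := by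
  let clip : ℝ → ℝ := fun s => max 0 (min 1 s)
  have hclip : ∀ s, clip s ∈ Icc (0 : ℝ) 1 := fun s =>
    ⟨le_max_left _ _, max_le zero_le_one (min_le_left _ _)⟩
  let P : X × ℝ → Z := fun p => H ⌊p.2⌋₊ (p.1, clip (p.2 - ⌊p.2⌋₊))
  let C : ℕ → Set (X × ℝ) := fun k => {p | (k = 0 ∨ (k : ℝ) ≤ p.2) ∧ p.2 ≤ k + 1}
  have hPC : ∀ k, ∀ p ∈ C k, P p = H k (p.1, clip (p.2 - k)) := by
    rintro k ⟨x, s⟩ ⟨h1, h2⟩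
    simp only at h1 h2
    rcases h2.lt_or_eq with h2 | h2
    · have : ⌊s⌋₊ = k := by
        rcases h1 with rfl | h1
        · exact Nat.floor_eq_zero.2 (by simpa using h2)
        · exact (Nat.floor_eq_iff (by have : (0 : ℝ) ≤ k := k.cast_nonneg; linarith)).2 ⟨h1, h2⟩
      simp [P, this]
    · have : ⌊s⌋₊ = k + 1 := by
        rw [h2]; exact_mod_cast Nat.floor_natCast (k + 1)
      have h3 : s - ((k + 1 : ℕ) : ℝ) = 0 := by push_cast; linarith
      have h4 : s - (k : ℝ) = 1 := by linarith
      change H ⌊s⌋₊ (x, clip (s - ⌊s⌋₊)) = H k (x, clip (s - k))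
      rw [this, h3, h4]
      simp [clip, hHH]
  have hP : Continuous P := by
    refine LocallyFinite.continuous (f := C) ?_ ?_ ?_ ?_
    · intro p
      refine ⟨Prod.snd ⁻¹' Iio (p.2 + 1), (isOpen_Iio.preimage continuous_snd).mem_nhds
        (by simp), (finite_Iic ⌈|p.2| + 1⌉₊).subset ?_⟩
      rintro k ⟨q, ⟨h1, -⟩, h2⟩
      rw [mem_Iic]
      rcases h1 with rfl | h1
      · exact Nat.zero_le _
      · have h3 : q.2 < p.2 + 1 := h2
        have : (k : ℝ) ≤ ⌈|p.2| + 1⌉₊ := by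
          linarith [Nat.le_ceil (|p.2| + 1), le_abs_self p.2]
        exact_mod_cast this
    · refine eq_univ_of_forall fun p => mem_iUnion.2 ⟨⌊p.2⌋₊, ?_, (Nat.lt_floor_add_one _).le⟩
      by_cases h : p.2 < 0
      · left; exact Nat.floor_of_nonpos h.le
      · right; exact Nat.floor_le (not_lt.1 h)
    · intro k
      have h2 : IsClosed {p : X × ℝ | p.2 ≤ k + 1} := isClosed_le continuous_snd continuous_const
      have h1 : IsClosed {p : X × ℝ | (k : ℝ) ≤ p.2} := isClosed_le continuous_const continuous_snd
      by_cases hk : k = 0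
      · convert h2 using 1; ext p; simp [C, hk]
      · convert h1.inter h2 using 1; ext p; simp [C, hk]
    · intro k
      refine ContinuousOn.congr ?_ (hPC k)
      refine ((hH k).comp_continuous (f := fun p : X × ℝ => (p.1, clip (p.2 - k)))
        (by fun_prop) fun p => ⟨mem_univ _, hclip _⟩).continuousOn
  let G : X × ℝ → Z := fun p => if p.2 < 1 then P (p.1, p.2 / (1 - p.2)) else φ p.1
  refine ⟨G, ?_, fun x => ?_, fun x => by simp [G], fun x τ hτ => ?_⟩
  · rintro ⟨x, t⟩ ⟨-, ht⟩
    rcases ht.2.lt_or_eq with ht1 | ht1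
    · refine ContinuousAt.continuousWithinAt ?_
      have h1 : ContinuousAt (fun p : X × ℝ => P (p.1, p.2 / (1 - p.2))) (x, t) := by
        refine hP.continuousAt.comp (continuousAt_fst.prodMk
          (continuousAt_snd.div (continuousAt_const.sub continuousAt_snd) ?_))
        simp only; linarith
      refine h1.congr ?_
      filter_upwards [(isOpen_Iio.preimage continuous_snd).mem_nhds (x := (x, t)) ht1] with p hp
      have : p.2 < 1 := hp
      simp [G, this]
    · simp only at ht1
      subst ht1
      have hG1 : G (x, 1) = φ x := by simp [G]
      rw [ContinuousWithinAt, hG1]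
      intro U hU
      obtain ⟨W, hW, N, hN⟩ := hlim x U hU
      have hW' : W ∩ φ ⁻¹' U ∈ 𝓝 x := inter_mem hW (hφ.continuousAt.preimage_mem_nhds hU)
      have hN1 : ((N : ℝ) / (N + 1)) < 1 := by
        rw [div_lt_one (by positivity)]; linarith
      rw [mem_map, mem_nhdsWithin_iff_exists_mem_nhds_inter]
      refine ⟨(W ∩ φ ⁻¹' U) ×ˢ Ioi ((N : ℝ) / (N + 1)), prod_mem_nhds hW' (Ioi_mem_nhds hN1), ?_⟩
      rintro ⟨x', t⟩ ⟨⟨⟨hx', hx''⟩, ht⟩, -, ht0, ht1⟩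
      simp only [mem_Ioi] at ht ht0 ht1
      rw [mem_preimage]
      by_cases h1 : t < 1
      · simp only [G, h1, if_true, P]
        refine hN _ (Nat.le_floor ?_) x' hx' _ (hclip _)
        rw [le_div_iff₀ (by linarith)]
        rw [div_lt_iff₀ (by positivity)] at ht
        linarith
      · simp only [G, h1, if_false]
        exact hx''
  · simp [G, P, clip]
  · by_cases h : τ < 1
    · right
      refine ⟨⌊τ / (1 - τ)⌋₊, clip (τ / (1 - τ) - ⌊τ / (1 - τ)⌋₊), hclip _, ?_⟩
      simp [G, P, h]
    · left; simp [G, h]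

section Deform
variable {n : ℕ}

/-- A strong deformation of `B` into `A` preserving each of the listed sets. -/
def Deform (l : List (Set (Fin n → ℝ))) (B A : Set (Fin n → ℝ)) : Prop :=
  ∃ h : (Fin n → ℝ) × ℝ → (Fin n → ℝ), ContinuousOn h (B ×ˢ Icc 0 1) ∧
    ∀ x ∈ B, h (x, 0) = x ∧ h (x, 1) ∈ A ∧ ∀ τ ∈ Icc (0 : ℝ) 1, h (x, τ) ∈ B ∧
      (x ∈ A → h (x, τ) = x) ∧ ∀ Q ∈ l, x ∈ Q → h (x, τ) ∈ Q

theorem Deform.refl (l : List (Set (Fin n → ℝ))) (A : Set (Fin n → ℝ)) : Deform l A A :=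
  ⟨Prod.fst, continuousOn_fst, fun _ hx => ⟨rfl, hx, fun _ _ => ⟨hx, fun _ => rfl,
    fun _ _ => id⟩⟩⟩

theorem Deform.trans {l : List (Set (Fin n → ℝ))} {A B C : Set (Fin n → ℝ)} (hC : IsClosed C)
    (hBC : B ⊆ C) (hAB : A ⊆ B) (h₁ : Deform l C B) (h₂ : Deform l B A) : Deform l C A := by
  obtain ⟨h₁, c₁, H₁⟩ := h₁
  obtain ⟨h₂, c₂, H₂⟩ := h₂
  let h : (Fin n → ℝ) × ℝ → (Fin n → ℝ) := fun p =>
    if p.2 ≤ 1 / 2 then h₁ (p.1, 2 * p.2) else h₂ (h₁ (p.1, 1), 2 * p.2 - 1)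
  have e1 : ∀ x, ∀ τ ≤ (1 / 2 : ℝ), h (x, τ) = h₁ (x, 2 * τ) := fun x τ hτ => by
    simp only [h, hτ, if_true]
  have e2 : ∀ x ∈ C, ∀ τ ≥ (1 / 2 : ℝ), h (x, τ) = h₂ (h₁ (x, 1), 2 * τ - 1) := fun x hx τ hτ => by
    rcases hτ.lt_or_eq with hτ | hτ
    · simp only [h, not_le.2 hτ, if_false]
    · rw [e1 x τ hτ.symm.le, ← hτ]
      norm_num
      rw [(H₂ _ (H₁ x hx).2.1).1]
  refine ⟨h, ?_, fun x hx => ⟨?_, ?_, fun τ hτ => ?_⟩⟩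
  · have hu : C ×ˢ Icc (0 : ℝ) 1 = C ×ˢ Icc 0 (1 / 2) ∪ C ×ˢ Icc (1 / 2) 1 := by
      rw [← prod_union, Icc_union_Icc_eq_Icc (by norm_num) (by norm_num)]
    rw [hu]
    refine ContinuousOn.union_of_isClosed ?_ ?_ (hC.prod isClosed_Icc) (hC.prod isClosed_Icc)
    · refine ContinuousOn.congr (f := fun p : (Fin n → ℝ) × ℝ => h₁ (p.1, 2 * p.2)) ?_
        fun p hp => e1 p.1 p.2 hp.2.2
      refine c₁.comp (by fun_prop) fun p hp => ⟨hp.1, ?_, ?_⟩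
      · linarith [hp.2.1]
      · linarith [hp.2.2]
    · refine ContinuousOn.congr
        (f := fun p : (Fin n → ℝ) × ℝ => h₂ (h₁ (p.1, 1), 2 * p.2 - 1)) ?_
        fun p hp => e2 p.1 hp.1 p.2 hp.2.1
      refine c₂.comp (ContinuousOn.prodMk ?_ (by fun_prop)) fun p hp => ⟨(H₁ p.1 hp.1).2.1, ?_, ?_⟩
      · exact c₁.comp (by fun_prop) fun p hp => ⟨hp.1, by simp⟩
      · linarith [hp.2.1]
      · linarith [hp.2.2]
  · rw [e1 x 0 (by norm_num), mul_zero, (H₁ x hx).1]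
  · rw [e2 x hx 1 (by norm_num)]
    norm_num
    exact (H₂ _ (H₁ x hx).2.1).2.1
  · by_cases hτ2 : τ ≤ 1 / 2
    · rw [e1 x τ hτ2]
      obtain ⟨b1, b2, b3⟩ := (H₁ x hx).2.2 (2 * τ) ⟨by linarith [hτ.1], by linarith⟩
      exact ⟨b1, fun hA => b2 (hAB hA), b3⟩
    · rw [e2 x hx τ (by linarith)]
      obtain ⟨-, b1, b2⟩ := H₁ x hx
      obtain ⟨-, b3, b4⟩ := b2 1 (by simp)
      obtain ⟨d1, d2, d3⟩ := (H₂ _ b1).2.2 (2 * τ - 1) ⟨by linarith, by linarith [hτ.2]⟩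
      refine ⟨hBC d1, fun hA => ?_, fun Q hQ hx => d3 Q hQ (b4 Q hQ hx)⟩
      have := b3 (hAB hA)
      rw [this] at d2 ⊢
      exact d2 hA

theorem deform_chain {l : List (Set (Fin n → ℝ))} {K : ℝ → Set (Fin n → ℝ)} {u v η : ℝ}
    (huv : u ≤ v) (hη : 0 < η) (hcl : ∀ s ∈ Icc u v, IsClosed (K s)) (hanti : AntitoneOn K (Icc u v))
    (hloc : ∀ s ∈ Icc u v, ∀ s' ∈ Icc u v, s ≤ s' → s' - s ≤ η → Deform l (K s) (K s')) :
    Deform l (K u) (K v) := by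
  have key : ∀ k : ℕ, ∀ s ∈ Icc u v, s - u ≤ k * η → Deform l (K u) (K s) := by
    intro k
    induction k with
    | zero =>
      intro s hs h
      have : s = u := le_antisymm (by simpa using h) hs.1
      rw [this]; exact Deform.refl l _
    | succ k ih =>
      intro s hs h
      push_cast at h
      have hu : u ∈ Icc u v := ⟨le_rfl, huv⟩
      have hm : max u (s - η) ∈ Icc u v := ⟨le_max_left _ _, max_le huv (by linarith [hs.2])⟩
      have hms : max u (s - η) ≤ s := max_le hs.1 (by linarith)
      refine Deform.trans (hcl u hu) (hanti hu hm hm.1) (hanti hm hs hms) (ih _ hm ?_)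
        (hloc _ hm _ hs hms (by linarith [le_max_right u (s - η)]))
      have : (0 : ℝ) ≤ k * η := by positivity
      rcases max_cases u (s - η) with ⟨h, -⟩ | ⟨h, -⟩ <;> rw [h] <;> linarith
  obtain ⟨k, hk⟩ := exists_nat_ge ((v - u) / η)
  exact key k v ⟨huv, le_rfl⟩ (by rwa [div_le_iff₀ hη] at hk)

theorem TameAt.comp_affine {K : ℝ → Set (Fin n → ℝ)} {s₀ c : ℝ} (h : TameAt K (c - s₀)) :
    TameAt (fun s => K (c - s)) s₀ := by
  have e : ∀ s, |c - s - (c - s₀)| = |s - s₀| := fun s => by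
    rw [abs_sub_comm]; congr 1; ring
  refine ⟨fun e' he => ?_, fun r hr => ?_⟩
  · obtain ⟨d, hd, H⟩ := h.hcont e' he
    exact ⟨d, hd, fun s hs => H (c - s) (by rwa [e])⟩
  · obtain ⟨ρ, hρ, d, hd, H⟩ := h.contr r hr
    exact ⟨ρ, hρ, d, hd, fun s hs => H (c - s) (by rwa [e])⟩

theorem TameAtL.comp_affine {l : List (Set (Fin n → ℝ))} {K : ℝ → Set (Fin n → ℝ)} {s₀ c : ℝ}
    (h : TameAtL l K (c - s₀)) : TameAtL l (fun s => K (c - s)) s₀ := by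
  induction l generalizing K with
  | nil => exact TameAt.comp_affine h
  | cons Q l ih => exact ⟨ih h.1, ih (K := fun s => K s ∩ Q) h.2⟩

theorem deform_of_antitone {l : List (Set (Fin n → ℝ))} (hl : ∀ Q ∈ l, IsClosed Q)
    {K : ℝ → Set (Fin n → ℝ)} {a b R : ℝ} (hab : a ≤ b) (hK : ∀ s ∈ Icc a b, IsClosed (K s))
    (hR : ∀ s ∈ Icc a b, K s ⊆ closedBall 0 R) (h : ∀ s ∈ Icc a b, TameAtL l K s)
    (hanti : AntitoneOn K (Icc a b)) : Deform l (K a) (K b) := by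
  obtain ⟨η, hη, T, hT, H⟩ := exists_transport hl hK hR h
  refine deform_chain hab hη hK hanti fun u hu v hv huv hvu => ?_
  have hw : ∀ τ ∈ Icc (0 : ℝ) 1, u + τ * (v - u) ∈ Icc u v := fun τ hτ =>
    ⟨by nlinarith [hτ.1], by nlinarith [hτ.2]⟩
  have hw' : ∀ τ ∈ Icc (0 : ℝ) 1, u + τ * (v - u) ∈ Icc a b := fun τ hτ =>
    ⟨hu.1.trans (hw τ hτ).1, (hw τ hτ).2.trans hv.2⟩
  have hd : ∀ τ ∈ Icc (0 : ℝ) 1, |u - (u + τ * (v - u))| ≤ η := fun τ hτ => by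
    rw [abs_le]; constructor <;> linarith [(hw τ hτ).1, (hw τ hτ).2]
  refine ⟨fun p => T (u, p.1, u + p.2 * (v - u)), ?_, fun x hx => ⟨?_, ?_, fun τ hτ => ?_⟩⟩
  · exact hT.comp (by fun_prop) fun p hp => ⟨hu, hw' _ hp.2, hd _ hp.2, hp.1⟩
  · have := (H u hu u hu (by simpa using hη.le) x hx).2.1 hx
    simpa using this
  · have := (H u hu v hv (by rw [abs_sub_comm, abs_of_nonneg (by linarith)]; exact hvu) x hx).1
    simpa using this
  · obtain ⟨b1, b2, b3⟩ := H u hu _ (hw' τ hτ) (hd τ hτ) x hx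
    exact ⟨hanti hu (hw' τ hτ) (hw τ hτ).1 b1, fun hv' =>
      b2 (hanti (hw' τ hτ) hv (hw τ hτ).2 hv'), b3⟩

theorem deform_of_monotone {l : List (Set (Fin n → ℝ))} (hl : ∀ Q ∈ l, IsClosed Q)
    {K : ℝ → Set (Fin n → ℝ)} {a b R : ℝ} (hab : a ≤ b) (hK : ∀ s ∈ Icc a b, IsClosed (K s))
    (hR : ∀ s ∈ Icc a b, K s ⊆ closedBall 0 R) (h : ∀ s ∈ Icc a b, TameAtL l K s)
    (hmono : MonotoneOn K (Icc a b)) : Deform l (K b) (K a) := by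
  have hm : ∀ s ∈ Icc a b, a + b - s ∈ Icc a b := fun s hs =>
    ⟨by linarith [hs.2], by linarith [hs.1]⟩
  have := deform_of_antitone hl (K := fun s => K (a + b - s)) hab (fun s hs => hK _ (hm s hs))
    (fun s hs => hR _ (hm s hs)) (fun s hs => TameAtL.comp_affine (h _ (hm s hs)))
    fun s hs s' hs' hss => hmono (hm s' hs') (hm s hs) (by linarith)
  simpa using this

end Deform

/-- A type with a fixed identification with some `ℝᵏ`. -/
class Coord (E : Type) where
  dim : ℕ
  vec : E ≃ (Fin dim → ℝ)

instance : Coord ℝ := ⟨1, (Equiv.funUnique (Fin 1) ℝ).symm⟩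

instance (n : ℕ) : Coord (Fin n → ℝ) := ⟨n, Equiv.refl _⟩

instance {E F : Type} [Coord E] [Coord F] : Coord (E × F) :=
  ⟨Coord.dim E + Coord.dim F, (Coord.vec.prodCongr Coord.vec).trans
    (Fin.appendEquiv (Coord.dim E) (Coord.dim F))⟩

namespace RealStructure
variable (S : RealStructure)

theorem univ_mem (n : ℕ) : (univ : Set (Fin n → ℝ)) ∈ S.defin n := by
  rw [← compl_empty]; exact S.compl_mem _ _ (S.empty_mem n)

theorem inter_mem {n : ℕ} {A B : Set (Fin n → ℝ)} (hA : A ∈ S.defin n) (hB : B ∈ S.defin n) :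
    A ∩ B ∈ S.defin n := by
  rw [← compl_compl (A ∩ B), compl_inter]
  exact S.compl_mem _ _ (S.union_mem _ _ _ (S.compl_mem _ _ hA) (S.compl_mem _ _ hB))

theorem iInter_mem {n : ℕ} {ι : Type*} [Finite ι] {A : ι → Set (Fin n → ℝ)}
    (hA : ∀ i, A i ∈ S.defin n) : (⋂ i, A i) ∈ S.defin n := by
  have := Fintype.ofFinite ι
  classical
  have key : ∀ s : Finset ι, (⋂ i ∈ s, A i) ∈ S.defin n := by
    intro s
    induction s using Finset.induction_on with
    | empty => simpa using S.univ_mem n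
    | insert a s _ ih =>
      rw [Finset.set_biInter_insert]
      exact S.inter_mem (hA a) ih
  simpa using key Finset.univ

theorem proj_append_mem {n m : ℕ} {B : Set (Fin (n + m) → ℝ)} (hB : B ∈ S.defin (n + m)) :
    {v : Fin n → ℝ | ∃ u : Fin m → ℝ, Fin.append v u ∈ B} ∈ S.defin n := by
  induction m with
  | zero =>
    refine (congrArg (· ∈ S.defin n) ?_).mpr hB
    ext v
    have : ∀ u : Fin 0 → ℝ, Fin.append v u = v := fun u => by
      rw [Subsingleton.elim u Fin.elim0, Fin.append_elim0]; rfl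
    constructor
    · rintro ⟨u, hu⟩
      rwa [this] at hu
    · exact fun hv => ⟨Fin.elim0, by rwa [this]⟩
  | succ m ih =>
    refine (congrArg (· ∈ S.defin n) ?_).mpr (ih (S.proj_mem (n + m) B hB))
    ext v
    constructor
    · rintro ⟨u, hu⟩
      refine ⟨Fin.init u, u (Fin.last m), ?_⟩
      rw [← Fin.append_snoc, Fin.snoc_init_self]
      exact hu
    · rintro ⟨u, y, hu⟩
      refine ⟨Fin.snoc u y, ?_⟩
      rw [Fin.append_snoc]
      exact hu

theorem subst_mem {n m : ℕ} {A : Set (Fin m → ℝ)} (hA : A ∈ S.defin m) (σ : Fin m → Fin n) :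
    {v : Fin n → ℝ | v ∘ σ ∈ A} ∈ S.defin n := by
  have h1 := S.prod_mem n m univ A (S.univ_mem n) hA
  have h2 : (⋂ j : Fin m, {w : Fin (n + m) → ℝ | MvPolynomial.eval w
      (MvPolynomial.X (Fin.natAdd n j) - MvPolynomial.X (Fin.castAdd m (σ j))) = 0}) ∈
      S.defin (n + m) := S.iInter_mem fun j => S.algebraic_mem _ _
  refine (congrArg (· ∈ S.defin n) ?_).mpr (S.proj_append_mem (S.inter_mem h1 h2))
  ext v
  constructor
  · intro hv
    refine ⟨v ∘ σ, ⟨mem_univ _, ?_⟩, mem_iInter.2 fun j => ?_⟩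
    · simp only [Fin.append_right]
      exact hv
    · simp
  · rintro ⟨u, ⟨-, hu⟩, h⟩
    have : u = v ∘ σ := funext fun j => by
      have := mem_iInter.1 h j
      simpa [sub_eq_zero] using this
    change v ∘ σ ∈ A
    rw [← this]
    change (fun i => Fin.append v u (Fin.natAdd n i)) ∈ A at hu
    simpa only [Fin.append_right] using hu

end RealStructure

section Definable
variable {E F G : Type} [Coord E] [Coord F] [Coord G]

/-- A predicate is definable when the corresponding subset of `ℝᵏ` is. -/
def DefP (S : RealStructure) (P : E → Prop) : Prop :=
  {v | P (Coord.vec.symm v)} ∈ S.defin (Coord.dim E)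

/-- A map is definable when its graph is. -/
@[fun_prop]
def DefMap (S : RealStructure) (φ : E → F) : Prop := DefP S fun p : E × F => p.2 = φ p.1

/-- A map whose coordinates are among the coordinates of the argument. -/
def IsCoordMap (φ : E → F) : Prop :=
  ∃ σ : Fin (Coord.dim F) → Fin (Coord.dim E), ∀ x j, Coord.vec (φ x) j = Coord.vec x (σ j)

variable {S : RealStructure}

theorem vec_symm_append (v : Fin (Coord.dim E) → ℝ) (u : Fin (Coord.dim F) → ℝ) :
    (Coord.vec (E := E × F)).symm (Fin.append v u) = (Coord.vec.symm v, Coord.vec.symm u) := by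
  rw [Equiv.symm_apply_eq]
  simp [Coord.vec, Fin.appendEquiv]

theorem vec_prod (x : E) (y : F) :
    Coord.vec (x, y) = Fin.append (Coord.vec x) (Coord.vec y) := rfl

theorem DefP.congr {P Q : E → Prop} (h : DefP S P) (hPQ : ∀ x, Q x ↔ P x) : DefP S Q := by
  have : Q = P := funext fun x => propext (hPQ x)
  rwa [this]

theorem DefP.and {P Q : E → Prop} (hP : DefP S P) (hQ : DefP S Q) : DefP S fun x => P x ∧ Q x :=
  S.inter_mem hP hQ

theorem DefP.or {P Q : E → Prop} (hP : DefP S P) (hQ : DefP S Q) : DefP S fun x => P x ∨ Q x :=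
  S.union_mem _ _ _ hP hQ

theorem DefP.not {P : E → Prop} (hP : DefP S P) : DefP S fun x => ¬ P x :=
  S.compl_mem _ _ hP

theorem DefP.imp {P Q : E → Prop} (hP : DefP S P) (hQ : DefP S Q) : DefP S fun x => P x → Q x :=
  (hP.not.or hQ).congr fun _ => imp_iff_not_or

theorem DefP.const (c : Prop) : DefP S fun _ : E => c := by
  by_cases h : c
  · simpa [DefP, h] using S.univ_mem _
  · simpa [DefP, h] using S.empty_mem _

theorem DefP.forall_finite {ι : Type*} [Finite ι] {P : ι → E → Prop} (h : ∀ i, DefP S (P i)) :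
    DefP S fun x => ∀ i, P i x := by
  have := S.iInter_mem h
  rwa [← ofPred_forall] at this

theorem DefP.exists_finite {ι : Type*} [Finite ι] {P : ι → E → Prop} (h : ∀ i, DefP S (P i)) :
    DefP S fun x => ∃ i, P i x :=
  (DefP.forall_finite fun i => (h i).not).not.congr fun x => by simp

theorem DefP.ex {P : E → F → Prop} (h : DefP S fun q : E × F => P q.1 q.2) :
    DefP S fun x => ∃ y, P x y := by
  have h1 := S.proj_append_mem (n := Coord.dim E) (m := Coord.dim F) h
  refine (congrArg (· ∈ S.defin (Coord.dim E)) ?_).mpr h1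
  ext v
  have key : ∀ u : Fin (Coord.dim F) → ℝ,
      Fin.append v u ∈ {w | P ((Coord.vec (E := E × F)).symm w).1 (Coord.vec.symm w).2} ↔
        P (Coord.vec.symm v) (Coord.vec.symm u) := fun u => by
    change P ((Coord.vec (E := E × F)).symm (Fin.append v u)).1
      ((Coord.vec (E := E × F)).symm (Fin.append v u)).2 ↔ _
    rw [vec_symm_append]
  exact ⟨fun ⟨y, hy⟩ => ⟨Coord.vec y, (key _).2 (by simpa using hy)⟩,
    fun ⟨u, hu⟩ => ⟨_, (key u).1 hu⟩⟩

theorem DefP.all {P : E → F → Prop} (h : DefP S fun q : E × F => P q.1 q.2) :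
    DefP S fun x => ∀ y, P x y :=
  (DefP.ex (P := fun x y => ¬ P x y) h.not).not.congr fun x => by simp

theorem DefP.comp_coordMap {P : F → Prop} (hP : DefP S P) {φ : E → F} (hφ : IsCoordMap φ) :
    DefP S fun x => P (φ x) := by
  obtain ⟨σ, hσ⟩ := hφ
  have h1 := S.subst_mem hP σ
  refine (congrArg (· ∈ S.defin (Coord.dim E)) ?_).mpr h1
  ext v
  have : (Coord.vec.symm (v ∘ σ) : F) = φ (Coord.vec.symm v) := by
    rw [Equiv.symm_apply_eq]
    funext j
    rw [hσ]; simp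
  simp only [mem_ofPred_eq, this]

theorem IsCoordMap.id : IsCoordMap fun x : E => x := ⟨fun j => j, fun _ _ => rfl⟩

theorem IsCoordMap.fst {φ : E → F × G} (h : IsCoordMap φ) : IsCoordMap fun x => (φ x).1 := by
  obtain ⟨σ, hσ⟩ := h
  refine ⟨fun j => σ (Fin.castAdd _ j), fun x j => ?_⟩
  rw [← hσ, ← Prod.mk.eta (p := φ x), vec_prod, Fin.append_left]

theorem IsCoordMap.snd {φ : E → F × G} (h : IsCoordMap φ) : IsCoordMap fun x => (φ x).2 := by
  obtain ⟨σ, hσ⟩ := h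
  refine ⟨fun j => σ (Fin.natAdd _ j), fun x j => ?_⟩
  rw [← hσ, ← Prod.mk.eta (p := φ x), vec_prod, Fin.append_right]

theorem IsCoordMap.prodMk {φ : E → F} {ψ : E → G} (h : IsCoordMap φ) (h' : IsCoordMap ψ) :
    IsCoordMap fun x => (φ x, ψ x) := by
  obtain ⟨σ, hσ⟩ := h
  obtain ⟨τ, hτ⟩ := h'
  refine ⟨fun j => Fin.addCases (motive := fun _ => Fin (Coord.dim E)) σ τ j, fun x j => ?_⟩
  refine Fin.addCases (fun j => ?_) (fun j => ?_) j
  · beta_reduce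
    rw [vec_prod, Fin.append_left, Fin.addCases_left, hσ]
  · beta_reduce
    rw [vec_prod, Fin.append_right, Fin.addCases_right, hτ]

theorem IsCoordMap.apply {n : ℕ} (i : Fin n) {φ : E → Fin n → ℝ} (h : IsCoordMap φ) :
    IsCoordMap fun x => φ x i := by
  obtain ⟨σ, hσ⟩ := h
  exact ⟨fun _ => σ i, fun x j => hσ x i⟩

theorem DefP.of_poly {P : E → Prop} (p : MvPolynomial (Fin (Coord.dim E)) ℝ)
    (h : ∀ x, P x ↔ MvPolynomial.eval (Coord.vec x) p = 0) : DefP S P := by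
  have := S.algebraic_mem _ p
  refine (congrArg (· ∈ S.defin (Coord.dim E)) ?_).mpr this
  ext v
  simp [h]

theorem IsCoordMap.defMap {φ : E → F} (h : IsCoordMap φ) : DefMap S φ := by
  obtain ⟨σ, hσ⟩ := h
  have : DefP S fun p : E × F => ∀ j : Fin (Coord.dim F), Coord.vec p.2 j = Coord.vec p.1 (σ j) :=
    DefP.forall_finite fun j => DefP.of_poly
      (MvPolynomial.X (Fin.natAdd _ j) - MvPolynomial.X (Fin.castAdd _ (σ j))) fun x => by
        rw [← Prod.mk.eta (p := x), vec_prod]; simp [sub_eq_zero]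
  refine this.congr fun p => ?_
  rw [← (Coord.vec (E := F)).apply_eq_iff_eq, funext_iff]
  simp only [hσ]

@[fun_prop]
theorem DefMap.id : DefMap S fun x : E => x := IsCoordMap.id.defMap

@[fun_prop]
theorem DefMap.const (c : F) : DefMap S fun _ : E => c := by
  have : DefP S fun p : E × F => ∀ j : Fin (Coord.dim F), Coord.vec p.2 j = Coord.vec c j :=
    DefP.forall_finite fun j => DefP.of_poly
      (MvPolynomial.X (Fin.natAdd _ j) - MvPolynomial.C (Coord.vec c j)) fun x => by
        rw [← Prod.mk.eta (p := x), vec_prod]; simp [sub_eq_zero]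
  refine this.congr fun p => ?_
  rw [← (Coord.vec (E := F)).apply_eq_iff_eq, funext_iff]

theorem DefP.comp {P : F → Prop} (hP : DefP S P) {φ : E → F} (hφ : DefMap S φ) :
    DefP S fun x => P (φ x) := by
  have h1 : DefP S fun q : E × F => q.2 = φ q.1 := hφ
  have h2 : DefP S fun q : E × F => P q.2 :=
    hP.comp_coordMap (φ := fun q : E × F => q.2) IsCoordMap.id.snd
  exact (DefP.ex (P := fun x y => y = φ x ∧ P y) (h1.and h2)).congr fun x => by simp

@[fun_prop]
theorem DefMap.comp {ψ : F → G} {φ : E → F} (hψ : DefMap S ψ) (hφ : DefMap S φ) :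
    DefMap S fun x => ψ (φ x) := by
  have h1 : DefP S fun q : (E × G) × F => q.2 = φ q.1.1 :=
    hφ.comp_coordMap (φ := fun q : (E × G) × F => (q.1.1, q.2))
      (IsCoordMap.id.fst.fst.prodMk IsCoordMap.id.snd)
  have h2 : DefP S fun q : (E × G) × F => q.1.2 = ψ q.2 :=
    hψ.comp_coordMap (φ := fun q : (E × G) × F => (q.2, q.1.2))
      (IsCoordMap.id.snd.prodMk IsCoordMap.id.fst.snd)
  exact (DefP.ex (P := fun (x : E × G) y => y = φ x.1 ∧ x.2 = ψ y) (h1.and h2)).congr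
    fun x => by simp

@[fun_prop]
theorem DefMap.prodMk {φ : E → F} {ψ : E → G} (hφ : DefMap S φ) (hψ : DefMap S ψ) :
    DefMap S fun x => (φ x, ψ x) := by
  have h1 : DefP S fun q : E × (F × G) => q.2.1 = φ q.1 :=
    hφ.comp_coordMap (φ := fun q : E × (F × G) => (q.1, q.2.1))
      (IsCoordMap.id.fst.prodMk IsCoordMap.id.snd.fst)
  have h2 : DefP S fun q : E × (F × G) => q.2.2 = ψ q.1 :=
    hψ.comp_coordMap (φ := fun q : E × (F × G) => (q.1, q.2.2))
      (IsCoordMap.id.fst.prodMk IsCoordMap.id.snd.snd)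
  exact (h1.and h2).congr fun x => Prod.ext_iff

@[fun_prop]
theorem DefMap.fst {φ : E → F × G} (h : DefMap S φ) : DefMap S fun x => (φ x).1 :=
  DefMap.comp (ψ := Prod.fst) IsCoordMap.id.fst.defMap h

@[fun_prop]
theorem DefMap.snd {φ : E → F × G} (h : DefMap S φ) : DefMap S fun x => (φ x).2 :=
  DefMap.comp (ψ := Prod.snd) IsCoordMap.id.snd.defMap h

theorem DefMap.apply {n : ℕ} {φ : E → Fin n → ℝ} (h : DefMap S φ) (i : Fin n) :
    DefMap S fun x => φ x i :=
  DefMap.comp (ψ := fun y : Fin n → ℝ => y i) (IsCoordMap.id.apply i).defMap h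

theorem DefMap.pi {n : ℕ} {φ : E → Fin n → ℝ} (h : ∀ i, DefMap S fun x => φ x i) : DefMap S φ := by
  have : DefP S fun p : E × (Fin n → ℝ) => ∀ i, p.2 i = φ p.1 i :=
    DefP.forall_finite fun i => (h i).comp_coordMap (φ := fun p : E × (Fin n → ℝ) => (p.1, p.2 i))
      (IsCoordMap.id.fst.prodMk (IsCoordMap.id.snd.apply i))
  exact this.congr fun p => funext_iff

theorem defMap_update {n : ℕ} (j : Fin n) {φ : E → Fin n → ℝ} {ψ : E → ℝ} (hφ : DefMap S φ)
    (hψ : DefMap S ψ) : DefMap S fun x => Function.update (φ x) j (ψ x) := by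
  refine DefMap.pi fun i => ?_
  by_cases h : i = j
  · subst h; simpa using hψ
  · simpa [Function.update_of_ne h] using hφ.apply i

@[fun_prop]
theorem DefMap.add {φ ψ : E → ℝ} (hφ : DefMap S φ) (hψ : DefMap S ψ) :
    DefMap S fun x => φ x + ψ x := by
  have : DefMap S fun p : ℝ × ℝ => p.1 + p.2 := by
    refine DefP.of_poly (E := (ℝ × ℝ) × ℝ) (MvPolynomial.X (Fin.natAdd (1 + 1) (0 : Fin 1)) -
      (MvPolynomial.X (Fin.castAdd 1 (Fin.castAdd 1 (0 : Fin 1))) +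
        MvPolynomial.X (Fin.castAdd 1 (Fin.natAdd 1 (0 : Fin 1))))) ?_
    rintro ⟨⟨a, b⟩, c⟩
    rw [map_sub, map_add, MvPolynomial.eval_X, MvPolynomial.eval_X, MvPolynomial.eval_X,
      sub_eq_zero]
    exact Iff.rfl
  exact DefMap.comp this (hφ.prodMk hψ)

@[fun_prop]
theorem DefMap.mul {φ ψ : E → ℝ} (hφ : DefMap S φ) (hψ : DefMap S ψ) :
    DefMap S fun x => φ x * ψ x := by
  have : DefMap S fun p : ℝ × ℝ => p.1 * p.2 := by
    refine DefP.of_poly (E := (ℝ × ℝ) × ℝ) (MvPolynomial.X (Fin.natAdd (1 + 1) (0 : Fin 1)) -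
      (MvPolynomial.X (Fin.castAdd 1 (Fin.castAdd 1 (0 : Fin 1))) *
        MvPolynomial.X (Fin.castAdd 1 (Fin.natAdd 1 (0 : Fin 1))))) ?_
    rintro ⟨⟨a, b⟩, c⟩
    rw [map_sub, map_mul, MvPolynomial.eval_X, MvPolynomial.eval_X, MvPolynomial.eval_X,
      sub_eq_zero]
    exact Iff.rfl
  exact DefMap.comp this (hφ.prodMk hψ)

@[fun_prop]
theorem DefMap.neg {φ : E → ℝ} (hφ : DefMap S φ) : DefMap S fun x => -φ x := by
  simpa using (DefMap.const (-1 : ℝ)).mul hφ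

@[fun_prop]
theorem DefMap.sub {φ ψ : E → ℝ} (hφ : DefMap S φ) (hψ : DefMap S ψ) :
    DefMap S fun x => φ x - ψ x := by
  simpa [sub_eq_add_neg] using hφ.add hψ.neg

theorem DefP.eq {φ ψ : E → F} (hφ : DefMap S φ) (hψ : DefMap S ψ) : DefP S fun x => φ x = ψ x :=
  DefP.comp (F := E × F) hψ (DefMap.id.prodMk hφ)

theorem DefP.le {φ ψ : E → ℝ} (hφ : DefMap S φ) (hψ : DefMap S ψ) :
    DefP S fun x => φ x ≤ ψ x := by
  have : DefP S fun q : E × ℝ => ψ q.1 = φ q.1 + q.2 * q.2 := by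
    refine DefP.eq ?_ ?_ <;> fun_prop
  refine (DefP.ex (P := fun x y => ψ x = φ x + y * y) this).congr fun x => ⟨fun h => ⟨√(ψ x - φ x), ?_⟩, ?_⟩
  · rw [Real.mul_self_sqrt (by linarith)]; ring
  · rintro ⟨y, hy⟩
    nlinarith [mul_self_nonneg y]

theorem DefP.lt {φ ψ : E → ℝ} (hφ : DefMap S φ) (hψ : DefMap S ψ) :
    DefP S fun x => φ x < ψ x :=
  (DefP.le hψ hφ).not.congr fun x => by simp

@[fun_prop]
theorem DefMap.abs {φ : E → ℝ} (hφ : DefMap S φ) : DefMap S fun x => |φ x| := by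
  have : DefP S fun p : E × ℝ => (0 ≤ φ p.1 ∧ p.2 = φ p.1) ∨ (φ p.1 < 0 ∧ p.2 = -φ p.1) := by
    refine ((DefP.le ?_ ?_).and (DefP.eq ?_ ?_)).or ((DefP.lt ?_ ?_).and (DefP.eq ?_ ?_)) <;>
      fun_prop
  refine this.congr fun p => ?_
  rcases le_or_gt 0 (φ p.1) with h | h
  · simp [abs_of_nonneg h, h, not_lt.2 h]
  · simp [abs_of_neg h, h, not_le.2 h]

theorem DefMap.finsetSum {ι : Type*} (s : Finset ι) {φ : ι → E → ℝ} (h : ∀ i, DefMap S (φ i)) :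
    DefMap S fun x => ∑ i ∈ s, φ i x := by
  classical
  induction s using Finset.induction_on with
  | empty => simpa using DefMap.const (0 : ℝ)
  | insert a s ha ih => simpa [Finset.sum_insert ha] using (h a).add ih

@[fun_prop]
theorem DefMap.dist {n : ℕ} {φ ψ : E → Fin n → ℝ} (hφ : DefMap S φ) (hψ : DefMap S ψ) :
    DefMap S fun x => Dist.dist (φ x) (ψ x) := by
  have h1 : DefP S fun q : (E × ℝ) × ℝ => (0 ≤ q.2 ∧ ∀ i, |φ q.1.1 i - ψ q.1.1 i| ≤ q.2) ↔
      q.1.2 ≤ q.2 := by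
    have a : DefP S fun q : (E × ℝ) × ℝ => (0 ≤ q.2 ∧ ∀ i, |φ q.1.1 i - ψ q.1.1 i| ≤ q.2) := by
      refine (DefP.le ?_ ?_).and (DefP.forall_finite fun i => DefP.le ?_ ?_)
      · fun_prop
      · fun_prop
      · exact ((DefMap.apply (by fun_prop) i).sub (DefMap.apply (by fun_prop) i)).abs
      · fun_prop
    have b : DefP S fun q : (E × ℝ) × ℝ => q.1.2 ≤ q.2 := DefP.le (by fun_prop) (by fun_prop)
    exact ((a.imp b).and (b.imp a)).congr fun q => iff_def
  refine (DefP.all (P := fun (p : E × ℝ) r => (0 ≤ r ∧ ∀ i, |φ p.1 i - ψ p.1 i| ≤ r) ↔ p.2 ≤ r)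
    h1).congr fun p => ?_
  have key : ∀ r, (0 ≤ r ∧ ∀ i, |φ p.1 i - ψ p.1 i| ≤ r) ↔ Dist.dist (φ p.1) (ψ p.1) ≤ r := by
    intro r
    constructor
    · rintro ⟨h0, h⟩
      exact (dist_pi_le_iff h0).2 h
    · intro h
      have h0 := dist_nonneg.trans h
      exact ⟨h0, (dist_pi_le_iff h0).1 h⟩
  simp only [key]
  exact ⟨fun h r => by rw [h], fun h => le_antisymm ((h _).1 le_rfl) ((h _).2 le_rfl)⟩

theorem RealStructure.DefinableFun.defMap {n : ℕ} {f : (Fin n → ℝ) → ℝ} (h : S.DefinableFun n f) :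
    DefMap S f := h

theorem DefMap.definableFun {n : ℕ} {f : (Fin n → ℝ) → ℝ} (h : DefMap S f) :
    S.DefinableFun n f := h

end Definable

section OMinimal
variable {S : RealStructure}

theorem RealStructure.IsOMinimal.exists_ordConnected (hS : S.IsOMinimal) {P : ℝ → Prop}
    (h : DefP S P) : ∃ (k : ℕ) (I : Fin k → Set ℝ), (∀ i, (I i).OrdConnected) ∧
      ∀ x, P x ↔ ∃ i, x ∈ I i := by
  obtain ⟨k, I, hI, hA⟩ := (hS _).1 h
  refine ⟨k, I, hI, fun x => ?_⟩
  exact Set.ext_iff.1 hA fun _ => x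

theorem RealStructure.IsOMinimal.exists_Icc (hS : S.IsOMinimal) {P : ℝ → Prop}
    (h : DefP S P) (hP : ¬ {x | P x}.Countable) : ∃ a b, a < b ∧ ∀ x ∈ Icc a b, P x := by
  obtain ⟨k, I, hI, hA⟩ := hS.exists_ordConnected h
  by_contra! hc
  refine hP ?_
  have : {x | P x} = ⋃ i, I i := by ext x; simpa using hA x
  rw [this]
  refine countable_iUnion fun i => Set.Subsingleton.countable fun x hx y hy => ?_
  by_contra hne
  rcases lt_or_gt_of_ne hne with hlt | hlt
  · obtain ⟨z, hz, hz'⟩ := hc x y hlt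
    exact hz' ((hA z).2 ⟨i, (hI i).out hx hy hz⟩)
  · obtain ⟨z, hz, hz'⟩ := hc y x hlt
    exact hz' ((hA z).2 ⟨i, (hI i).out hy hx hz⟩)

theorem not_countable_Icc {a b : ℝ} (hab : a < b) : ¬ (Icc a b).Countable := fun h => by
  have := Cardinal.mk_Icc_real hab
  have h2 := Cardinal.le_aleph0_iff_set_countable.2 h
  rw [this] at h2
  exact absurd Cardinal.aleph0_lt_continuum (not_lt.2 h2)

/-- A definable set of reals contains or avoids a right neighbourhood of `0`. -/
theorem RealStructure.IsOMinimal.dichotomy (hS : S.IsOMinimal) {P : ℝ → Prop} (h : DefP S P) :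
    (∃ d > 0, ∀ s, 0 < s → s < d → P s) ∨ ∃ d > 0, ∀ s, 0 < s → s < d → ¬ P s := by
  obtain ⟨k, I, hI, hA⟩ := hS.exists_ordConnected h
  by_cases hc : ∃ i, ∀ d > 0, ∃ s, 0 < s ∧ s < d ∧ s ∈ I i
  · left
    obtain ⟨i, hi⟩ := hc
    obtain ⟨d, hd0, -, hd⟩ := hi 1 one_pos
    refine ⟨d, hd0, fun s hs hsd => (hA s).2 ⟨i, ?_⟩⟩
    obtain ⟨a, -, has, ha⟩ := hi s hs
    exact (hI i).out ha hd ⟨has.le, hsd.le⟩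
  · right
    push Not at hc
    choose d hd hd' using hc
    obtain ⟨e, he, hed⟩ := Finset.exists_pos_forall_le Finset.univ d fun i _ => hd i
    refine ⟨e, he, fun s hs hse hPs => ?_⟩
    obtain ⟨i, hi⟩ := (hA s).1 hPs
    exact hd' i s hs (hse.trans_le (hed i (Finset.mem_univ i))) hi

/-- A definable set of reals is locally constant off a countable set. -/
theorem RealStructure.IsOMinimal.countable_not_locally_const (hS : S.IsOMinimal) {P : ℝ → Prop}
    (h : DefP S P) : {s₀ : ℝ | ¬ ∃ e > 0, ∀ s, |s - s₀| < e → (P s ↔ P s₀)}.Countable := by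
  have hd : DefP S fun s₀ : ℝ => ¬ ∃ e : ℝ, e > 0 ∧ ∀ s : ℝ, |s - s₀| < e → (P s ↔ P s₀) := by
    refine (DefP.ex (P := fun s₀ e : ℝ => e > 0 ∧ ∀ s : ℝ, |s - s₀| < e → (P s ↔ P s₀)) ?_).not
    refine (DefP.lt (by fun_prop) (by fun_prop)).and
      (DefP.all (P := fun (p : ℝ × ℝ) (s : ℝ) => |s - p.1| < p.2 → (P s ↔ P p.1)) ?_)
    refine (DefP.lt (by fun_prop) (by fun_prop)).imp ?_
    have h1 : DefP S fun q : (ℝ × ℝ) × ℝ => P q.2 := h.comp (by fun_prop)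
    have h2 : DefP S fun q : (ℝ × ℝ) × ℝ => P q.1.1 := h.comp (by fun_prop)
    exact ((h1.imp h2).and (h2.imp h1)).congr fun _ => iff_def
  by_contra hc
  obtain ⟨a, b, hab, hI⟩ := hS.exists_Icc hd hc
  have key : ∀ a' b', a' < b' → Icc a' b' ⊆ Icc a b → ∀ c : Prop, ¬ ∀ x ∈ Icc a' b', (P x ↔ c) := by
    intro a' b' hab' hsub c hx
    refine hI ((a' + b') / 2) (hsub ⟨by linarith, by linarith⟩) ⟨(b' - a') / 2, by linarith,
      fun s hs => ?_⟩
    rw [abs_lt] at hs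
    rw [hx s ⟨by linarith, by linarith⟩, hx _ ⟨by linarith, by linarith⟩]
  have hda : DefP S fun s : ℝ => a ≤ s ∧ s ≤ b :=
    (DefP.le (by fun_prop) (by fun_prop)).and (DefP.le (by fun_prop) (by fun_prop))
  by_cases h1 : {s | (a ≤ s ∧ s ≤ b) ∧ P s}.Countable
  · by_cases h2 : {s | (a ≤ s ∧ s ≤ b) ∧ ¬ P s}.Countable
    · refine not_countable_Icc hab ((h1.union h2).mono fun x hx => ?_)
      by_cases hp : P x
      · exact Or.inl ⟨hx, hp⟩
      · exact Or.inr ⟨hx, hp⟩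
    · obtain ⟨a', b', hab', h'⟩ := hS.exists_Icc (hda.and h.not) h2
      exact key a' b' hab' (fun x hx => (h' x hx).1) False fun x hx => by simpa using (h' x hx).2
  · obtain ⟨a', b', hab', h'⟩ := hS.exists_Icc (hda.and h) h1
    exact key a' b' hab' (fun x hx => (h' x hx).1) True fun x hx => by simpa using (h' x hx).2

/-- A pointwise right neighbourhood of `0` can be chosen uniformly on a smaller interval. -/
theorem RealStructure.IsOMinimal.exists_uniform_subinterval (hS : S.IsOMinimal)
    {D : ℝ → ℝ → Prop} (hD : DefP S fun q : ℝ × ℝ => D q.1 q.2) {a b : ℝ} (hab : a < b)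
    (h : ∀ s ∈ Icc a b, ∃ δ > 0, ∀ u, 0 < u → u < δ → D u s) :
    ∃ a' b', a' < b' ∧ Icc a' b' ⊆ Icc a b ∧ ∃ δ > 0, ∀ s ∈ Icc a' b', ∀ u, 0 < u → u < δ →
      D u s := by
  have hd : ∀ k : ℕ, DefP S fun s : ℝ => (a ≤ s ∧ s ≤ b) ∧
      ∀ u : ℝ, 0 < u → u < 1 / ((k : ℝ) + 1) → D u s := fun k => by
    refine ((DefP.le (by fun_prop) (by fun_prop)).and (DefP.le (by fun_prop) (by fun_prop))).and
      (DefP.all (P := fun s u : ℝ => 0 < u → u < 1 / ((k : ℝ) + 1) → D u s) ?_)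
    exact (DefP.lt (by fun_prop) (by fun_prop)).imp ((DefP.lt (by fun_prop) (by fun_prop)).imp
      (hD.comp (φ := fun q : ℝ × ℝ => (q.2, q.1)) (by fun_prop)))
  have : ∃ k : ℕ, ¬ {s | (a ≤ s ∧ s ≤ b) ∧
      ∀ u : ℝ, 0 < u → u < 1 / ((k : ℝ) + 1) → D u s}.Countable := by
    by_contra! hc
    refine not_countable_Icc hab ((countable_iUnion hc).mono fun s hs => ?_)
    obtain ⟨δ, hδ, hs'⟩ := h s hs
    obtain ⟨k, hk⟩ := exists_nat_one_div_lt hδ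
    exact mem_iUnion.2 ⟨k, hs, fun u hu huk => hs' u hu (huk.trans hk)⟩
  obtain ⟨k, hk⟩ := this
  obtain ⟨a', b', hab', h'⟩ := hS.exists_Icc (hd k) hk
  exact ⟨a', b', hab', fun s hs => (h' s hs).1, 1 / ((k : ℝ) + 1), by positivity,
    fun s hs => (h' s hs).2⟩

end OMinimal

section LocalContractibility
variable {S : RealStructure} {A : Type} [Coord A] {n : ℕ}

/-- A family of sets is definable when its total space is. -/
def DefFam (S : RealStructure) (K : A → Set (Fin n → ℝ)) : Prop :=
  DefP S fun q : A × (Fin n → ℝ) => q.2 ∈ K q.1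

theorem DefFam.mem {K : A → Set (Fin n → ℝ)} (h : DefFam S K) {E : Type} [Coord E] {φ : E → A}
    {ψ : E → Fin n → ℝ} (hφ : DefMap S φ) (hψ : DefMap S ψ) : DefP S fun x => ψ x ∈ K (φ x) :=
  DefP.comp (P := fun q : A × (Fin n → ℝ) => q.2 ∈ K q.1) h (hφ.prodMk hψ)

theorem DefFam.comp {K : A → Set (Fin n → ℝ)} (h : DefFam S K) {E : Type} [Coord E] {φ : E → A}
    (hφ : DefMap S φ) : DefFam S fun x => K (φ x) :=
  h.mem (hφ.comp (by fun_prop)) (by fun_prop)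

/-- The family `K` admits a definable modulus of uniform local contractibility. -/
def HasULC (S : RealStructure) (K : A → Set (Fin n → ℝ)) : Prop :=
  ∃ G : A → ℝ → ℝ → Prop, (DefP S fun q : (A × ℝ) × ℝ => G q.1.1 q.1.2 q.2) ∧
    (∀ a r ρ r' ρ', G a r ρ → r ≤ r' → ρ' ≤ ρ → G a r' ρ') ∧
    (∀ a r ρ, G a r ρ → ∀ y ∈ K a, Contr (K a) y ρ r) ∧ ∀ a r, 0 < r → ∃ ρ > 0, G a r ρ

/-- A definable pointwise modulus of local contractibility can be made uniform. -/
theorem HasULC.of_pointwise {K : A → Set (Fin n → ℝ)} (hK : DefFam S K) (hc : ∀ a, IsCompact (K a))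
    (PG : A → (Fin n → ℝ) → ℝ → ℝ → Prop)
    (hPG : DefP S fun q : ((A × (Fin n → ℝ)) × ℝ) × ℝ => PG q.1.1.1 q.1.1.2 q.1.2 q.2)
    (hcontr : ∀ a, ∀ x ∈ K a, ∀ r ρ, PG a x r ρ → Contr (K a) x ρ r)
    (hex : ∀ a, ∀ x ∈ K a, ∀ r > 0, ∃ ρ > 0, PG a x r ρ) : HasULC S K := by
  refine ⟨fun a r ρ => ∀ y, y ∈ K a → ∃ x, x ∈ K a ∧ ∃ r₀ ρ₀ : ℝ, PG a x r₀ ρ₀ ∧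
    dist y x + ρ ≤ ρ₀ ∧ r₀ + dist y x ≤ r, ?_, ?_, ?_, ?_⟩
  · refine DefP.all (DefP.imp ?_ (DefP.ex (DefP.and ?_ (DefP.ex (DefP.ex (DefP.and ?_
      (DefP.and ?_ ?_)))))))
    · exact hK.mem (by fun_prop) (by fun_prop)
    · exact hK.mem (by fun_prop) (by fun_prop)
    · exact hPG.comp (φ := fun q : (((((A × ℝ) × ℝ) × (Fin n → ℝ)) × (Fin n → ℝ)) × ℝ) × ℝ =>
        (((q.1.1.1.1.1.1, q.1.1.2), q.1.2), q.2)) (by fun_prop)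
    · exact DefP.le (by fun_prop) (by fun_prop)
    · exact DefP.le (by fun_prop) (by fun_prop)
  · intro a r ρ r' ρ' h hr hρ y hy
    obtain ⟨x, hx, r₀, ρ₀, h1, h2, h3⟩ := h y hy
    exact ⟨x, hx, r₀, ρ₀, h1, by linarith, by linarith⟩
  · intro a r ρ h y hy
    obtain ⟨x, hx, r₀, ρ₀, h1, h2, h3⟩ := h y hy
    exact (hcontr a x hx r₀ ρ₀ h1).mono h2 h3
  · intro a r hr
    choose! ρ hρ H using fun x hx => hex a x hx (r / 2) (half_pos hr)
    obtain ⟨t, ht, hcov⟩ := (hc a).elim_nhds_subcover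
      (fun x => ball x (min (ρ x / 2) (r / 2))) fun x hx =>
        ball_mem_nhds _ (lt_min (half_pos (hρ x hx)) (half_pos hr))
    obtain ⟨e, he, hle⟩ := t.exists_pos_forall_le (fun x => ρ x / 2) fun x hx =>
      half_pos (hρ x (ht x hx))
    refine ⟨e, he, fun y hy => ?_⟩
    obtain ⟨x, hx, hyx⟩ := mem_iUnion₂.1 (hcov hy)
    rw [mem_ball, lt_min_iff] at hyx
    exact ⟨x, ht x hx, r / 2, ρ x, H x (ht x hx), by linarith [hle x hx], by linarith⟩

/-- A bounded definable one-parameter family with compact fibres is tame at all but countably many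
parameters, definably in auxiliary parameters. -/
theorem HasULC.exists_tame (hS : S.IsOMinimal) {K : A × ℝ → Set (Fin n → ℝ)} (hu : HasULC S K)
    (hK : DefFam S K) (hb : ∀ a, ∃ R, ∀ s, K (a, s) ⊆ closedBall 0 R) :
    ∃ W : A × ℝ → Prop, DefP S W ∧ (∀ a s, W (a, s) → TameAt (fun s => K (a, s)) s) ∧
      ∀ a, {s | ¬ W (a, s)}.Countable := by
  obtain ⟨G, hG, hmono, hcontr, hex⟩ := hu
  refine ⟨fun p => (∀ e : ℝ, e > 0 → ∃ d : ℝ, d > 0 ∧ ∀ s : ℝ, |s - p.2| < d →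
      (∀ y, y ∈ K (p.1, s) → ∃ z, z ∈ K (p.1, p.2) ∧ dist y z < e) ∧
        ∀ y, y ∈ K (p.1, p.2) → ∃ z, z ∈ K (p.1, s) ∧ dist y z < e) ∧
      ∀ r : ℝ, r > 0 → ∃ ρ : ℝ, ρ > 0 ∧ ∃ d : ℝ, d > 0 ∧ ∀ s : ℝ, |s - p.2| < d → G (p.1, s) r ρ,
    ?_, ?_, ?_⟩
  · refine DefP.and ?_ ?_
    · refine DefP.all (DefP.imp ?_ (DefP.ex (DefP.and ?_ (DefP.all (DefP.imp ?_ (DefP.and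
        (DefP.all (DefP.imp ?_ (DefP.ex (DefP.and ?_ ?_))))
        (DefP.all (DefP.imp ?_ (DefP.ex (DefP.and ?_ ?_)))))))))) <;>
      first
        | exact DefP.lt (by fun_prop) (by fun_prop)
        | exact hK.mem (by fun_prop) (by fun_prop)
    · refine DefP.all (DefP.imp ?_ (DefP.ex (DefP.and ?_ (DefP.ex (DefP.and ?_ (DefP.all
        (DefP.imp ?_ ?_)))))))
      · exact DefP.lt (by fun_prop) (by fun_prop)
      · exact DefP.lt (by fun_prop) (by fun_prop)
      · exact DefP.lt (by fun_prop) (by fun_prop)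
      · exact DefP.lt (by fun_prop) (by fun_prop)
      · exact hG.comp (φ := fun q : ((((A × ℝ) × ℝ) × ℝ) × ℝ) × ℝ =>
          (((q.1.1.1.1.1, q.2), q.1.1.1.2), q.1.1.2)) (by fun_prop)
  · rintro a s ⟨h1, h2⟩
    refine ⟨fun e he => ?_, fun r hr => ?_⟩
    · obtain ⟨d, hd, H⟩ := h1 e he
      exact ⟨d, hd, H⟩
    · obtain ⟨ρ, hρ, d, hd, H⟩ := h2 r hr
      exact ⟨ρ, hρ, d, hd, fun s hs => hcontr _ _ _ (H s hs)⟩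
  · intro a
    obtain ⟨R, hR⟩ := hb a
    have d1 : ∀ (i k : ℕ), DefP S fun s : ℝ => ∃ z, z ∈ K (a, s) ∧
        dist z (TopologicalSpace.denseSeq (Fin n → ℝ) i) ≤ 1 / ((k : ℝ) + 1) := fun i k =>
      DefP.ex (DefP.and (hK.mem (by fun_prop) (by fun_prop)) (DefP.le (by fun_prop) (by fun_prop)))
    have d2 : ∀ j k : ℕ, DefP S fun s : ℝ => G (a, s) (1 / ((j : ℝ) + 1)) (1 / ((k : ℝ) + 1)) :=
      fun j k => hG.comp (φ := fun s : ℝ => (((a, s), 1 / ((j : ℝ) + 1)), 1 / ((k : ℝ) + 1)))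
        (by fun_prop)
    refine ((countable_iUnion fun i => countable_iUnion fun k =>
      hS.countable_not_locally_const (d1 i k)).union (countable_iUnion fun i =>
        countable_iUnion fun k => hS.countable_not_locally_const (d2 i k))).mono ?_
    intro s₀ hs₀
    by_contra hcon
    simp only [mem_union, mem_iUnion, mem_ofPred_eq, not_or] at hcon
    push Not at hcon
    obtain ⟨c1, c2⟩ := hcon
    refine hs₀ ⟨fun e he => ?_, fun r hr => ?_⟩
    · obtain ⟨k, hk⟩ := exists_nat_one_div_lt (half_pos he)
      have hk0 : (0 : ℝ) < 1 / ((k : ℝ) + 1) := by positivity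
      obtain ⟨t, ht⟩ := (isCompact_closedBall (0 : Fin n → ℝ) R).elim_finite_subcover
        (fun i => ball (TopologicalSpace.denseSeq (Fin n → ℝ) i) (1 / ((k : ℝ) + 1)))
        (fun _ => isOpen_ball) fun y _ => by
          obtain ⟨i, hi⟩ := (TopologicalSpace.denseRange_denseSeq (Fin n → ℝ)).exists_dist_lt y hk0
          exact mem_iUnion.2 ⟨i, hi⟩
      choose d hd H using fun i => c1 i k
      obtain ⟨d', hd', hle⟩ := t.exists_pos_forall_le d fun i _ => hd i
      have key : ∀ s s', (∀ i ∈ t, (∃ z ∈ K (a, s), dist z (TopologicalSpace.denseSeq _ i) ≤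
          1 / ((k : ℝ) + 1)) → ∃ z ∈ K (a, s'), dist z (TopologicalSpace.denseSeq _ i) ≤
          1 / ((k : ℝ) + 1)) → ∀ y, y ∈ K (a, s) → ∃ z, z ∈ K (a, s') ∧ dist y z < e := by
        intro s s' h y hy
        obtain ⟨i, hi, hyi⟩ : ∃ i ∈ t, dist y (TopologicalSpace.denseSeq _ i) <
          1 / ((k : ℝ) + 1) := by simpa using ht (hR s hy)
        obtain ⟨z, hz, hzi⟩ := h i hi ⟨y, hy, hyi.le⟩
        exact ⟨z, hz, by linarith [dist_triangle_right y z (TopologicalSpace.denseSeq _ i)]⟩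
      refine ⟨d', hd', fun s hs => ⟨key _ _ fun i hi => ?_, key _ _ fun i hi => ?_⟩⟩
      · exact (H i s (hs.trans_le (hle i hi))).1
      · exact (H i s (hs.trans_le (hle i hi))).2
    · obtain ⟨j, hj⟩ := exists_nat_one_div_lt hr
      obtain ⟨ρ, hρ, hGρ⟩ := hex (a, s₀) (1 / ((j : ℝ) + 1)) (by positivity)
      obtain ⟨k, hk⟩ := exists_nat_one_div_lt hρ
      obtain ⟨d, hd, H⟩ := c2 j k
      refine ⟨1 / ((k : ℝ) + 1), by positivity, d, hd, fun s hs => ?_⟩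
      exact hmono _ _ _ _ _ ((H s hs).2 (hmono _ _ _ _ _ hGρ le_rfl hk.le)) hj.le le_rfl

end LocalContractibility

section Charts
variable {n m : ℕ}

theorem IsCompact.continuousOn_invFunOn {X Y : Type*} [TopologicalSpace X] [TopologicalSpace Y]
    [T2Space X] [T2Space Y] [Nonempty X] {g : X → Y} (hg : Continuous g) {H : Set X}
    (hH : IsCompact H) (hinj : InjOn g H) : ContinuousOn (Function.invFunOn g H) (g '' H) := by
  rw [continuousOn_iff_isClosed]
  intro C hC
  refine ⟨g '' (H ∩ C), ((hH.inter_right hC).image hg).isClosed, ?_⟩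
  ext y
  constructor
  · rintro ⟨h1, x, hx, rfl⟩
    rw [mem_preimage, hinj.leftInvOn_invFunOn hx] at h1
    exact ⟨⟨x, ⟨hx, h1⟩, rfl⟩, ⟨x, hx, rfl⟩⟩
  · rintro ⟨⟨x, ⟨hx, h1⟩, rfl⟩, h2⟩
    refine ⟨?_, h2⟩
    rwa [mem_preimage, hinj.leftInvOn_invFunOn hx]

/-- Local contractions can be transferred through a chart. -/
theorem Contr.of_chart {g : (Fin n → ℝ) → (Fin m → ℝ)} (hg : Continuous g)
    {H L : Set (Fin n → ℝ)} (hH : IsCompact H) (hHL : H ⊆ L) (hinj : InjOn g H)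
    {z : Fin n → ℝ} {r ρ r₁ ρ₁ : ℝ} (h1 : L ∩ closedBall z ρ ⊆ H)
    (h2 : ∀ w ∈ L ∩ closedBall z ρ, dist (g w) (g z) ≤ ρ₁)
    (h3 : ∀ w ∈ H, dist (g w) (g z) ≤ r₁ → dist w z ≤ r)
    (hc : Contr (g '' H) (g z) ρ₁ r₁) : Contr L z ρ r := by
  obtain ⟨c, y₁, hcc, hc⟩ := hc
  have hinv := hH.continuousOn_invFunOn hg hinj
  have hmem : ∀ w ∈ L ∩ closedBall z ρ, g w ∈ g '' H ∩ closedBall (g z) ρ₁ := fun w hw =>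
    ⟨⟨w, h1 hw, rfl⟩, h2 w hw⟩
  refine ⟨fun p => Function.invFunOn g H (c (g p.1, p.2)), Function.invFunOn g H y₁, ?_,
    fun w hw => ?_⟩
  · refine hinv.comp (hcc.comp (by fun_prop) fun p hp => ⟨hmem _ hp.1, hp.2⟩) fun p hp => ?_
    exact ((hc _ (hmem _ hp.1)).2.2 _ hp.2).1
  · obtain ⟨c0, c1, c2⟩ := hc _ (hmem w hw)
    refine ⟨?_, ?_, fun τ hτ => ?_⟩
    · beta_reduce
      rw [c0, hinj.leftInvOn_invFunOn (h1 hw)]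
    · beta_reduce
      rw [c1]
    · obtain ⟨⟨v, hv, hv2⟩, h⟩ := c2 τ hτ
      beta_reduce
      rw [← hv2] at h ⊢
      rw [hinj.leftInvOn_invFunOn hv]
      exact ⟨hHL hv, h3 v hv h⟩

/-- Forgetting the `i`-th coordinate. -/
def dropCoord (i : Fin (n + 1)) (z : Fin (n + 1) → ℝ) : Fin n → ℝ := fun j => z (i.succAbove j)

theorem continuous_dropCoord (i : Fin (n + 1)) : Continuous (dropCoord i) := by
  unfold dropCoord; fun_prop

theorem dist_dropCoord_le (i : Fin (n + 1)) (z w : Fin (n + 1) → ℝ) :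
    dist (dropCoord i z) (dropCoord i w) ≤ dist z w :=
  (dist_pi_le_iff dist_nonneg).2 fun _ => dist_le_pi_dist z w _

theorem defMap_dropCoord {S : RealStructure} {E : Type} [Coord E] (i : Fin (n + 1))
    {φ : E → Fin (n + 1) → ℝ} (h : DefMap S φ) : DefMap S fun x => dropCoord i (φ x) :=
  DefMap.pi fun _ => h.apply _

/-- The Euclidean sphere of radius `s` around `x`, intersected with `E`. -/
def link (E : Set (Fin n → ℝ)) (x : Fin n → ℝ) (s : ℝ) : Set (Fin n → ℝ) :=
  {z | z ∈ E ∧ 0 < s ∧ ∑ i, (z i - x i) * (z i - x i) = s * s}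

theorem isCompact_link {E : Set (Fin n → ℝ)} (hE : IsCompact E) (x : Fin n → ℝ) (s : ℝ) :
    IsCompact (link E x s) := by
  by_cases hs : 0 < s
  · have : link E x s = E ∩ {z | ∑ i, (z i - x i) * (z i - x i) = s * s} := by
      ext z; simp [link, hs]
    rw [this]
    exact hE.inter_right (isClosed_eq (by fun_prop) continuous_const)
  · have : link E x s = ∅ := by ext z; simp [link, hs]
    rw [this]; exact isCompact_empty

/-- A closed hemisphere of a link. -/
def hemi (E : Set (Fin n → ℝ)) (x : Fin n → ℝ) (s : ℝ) (p : Fin n × Bool) : Set (Fin n → ℝ) :=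
  {z | z ∈ link E x s ∧ 0 ≤ (if p.2 then 1 else -1) * (z p.1 - x p.1)}

theorem isCompact_hemi {E : Set (Fin n → ℝ)} (hE : IsCompact E) (x : Fin n → ℝ) (s : ℝ)
    (p : Fin n × Bool) : IsCompact (hemi E x s p) :=
  (isCompact_link hE x s).inter_right (isClosed_le continuous_const
    (continuous_const.mul ((continuous_apply p.1).sub continuous_const)))

theorem injOn_dropCoord_hemi (E : Set (Fin (n + 1) → ℝ)) (x : Fin (n + 1) → ℝ) (s : ℝ)
    (p : Fin (n + 1) × Bool) : InjOn (dropCoord p.1) (hemi E x s p) := by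
  obtain ⟨i, κ⟩ := p
  rintro z ⟨⟨-, -, hz⟩, hzκ⟩ w ⟨⟨-, -, hw⟩, hwκ⟩ hzw
  have hj : ∀ j, z (i.succAbove j) = w (i.succAbove j) := fun j => congrFun hzw j
  rw [Fin.sum_univ_succAbove _ i] at hz hw
  simp only [hj] at hz
  have hsq : (z i - x i) * (z i - x i) = (w i - x i) * (w i - x i) := by linarith
  have hi : z i = w i := by
    rcases mul_self_eq_mul_self_iff.1 hsq with h | h
    · linarith
    · simp only at hzκ hwκ
      cases κ <;> simp at hzκ hwκ <;> linarith
  funext k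
  rcases Fin.eq_self_or_eq_succAbove i k with rfl | ⟨j, rfl⟩
  · exact hi
  · exact hj j

end Charts

section Links
variable {S : RealStructure} {A : Type} [Coord A] {n : ℕ}

theorem DefFam.link {E : A → Set (Fin n → ℝ)} (hE : DefFam S E) :
    DefFam S fun b : (A × (Fin n → ℝ)) × ℝ => link (E b.1.1) b.1.2 b.2 := by
  refine (hE.mem ?_ ?_).and ((DefP.lt ?_ ?_).and (DefP.eq (DefMap.finsetSum _ fun i => ?_) ?_))
  all_goals first
    | fun_prop
    | exact ((DefMap.apply (by fun_prop) i).sub (DefMap.apply (by fun_prop) i)).mul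
        ((DefMap.apply (by fun_prop) i).sub (DefMap.apply (by fun_prop) i))

theorem DefFam.hemi {E : A → Set (Fin n → ℝ)} (hE : DefFam S E) (p : Fin n × Bool) :
    DefFam S fun b : (A × (Fin n → ℝ)) × ℝ => hemi (E b.1.1) b.1.2 b.2 p :=
  DefP.and hE.link (DefP.le (DefMap.const 0) ((DefMap.const _).mul
    ((DefMap.apply (by fun_prop) p.1).sub (DefMap.apply (by fun_prop) p.1))))

theorem DefFam.image_dropCoord {K : A → Set (Fin (n + 1) → ℝ)} (hK : DefFam S K)
    (i : Fin (n + 1)) : DefFam S fun a => dropCoord i '' K a := by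
  refine DefP.congr (P := fun q : A × (Fin n → ℝ) => ∃ z, z ∈ K q.1 ∧ dropCoord i z = q.2)
    ?_ fun q => Iff.rfl
  exact DefP.ex (DefP.and (hK.mem (by fun_prop) (by fun_prop))
    (DefP.eq (defMap_dropCoord i (by fun_prop)) (by fun_prop)))

/-- Links in `ℝⁿ⁺¹` are uniformly locally contractible if all families in `ℝⁿ` are. -/
theorem HasULC.link {E : A → Set (Fin (n + 1) → ℝ)} (hE : DefFam S E) (hc : ∀ a, IsCompact (E a))
    (ih : ∀ K : (A × (Fin (n + 1) → ℝ)) × ℝ → Set (Fin n → ℝ), DefFam S K →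
      (∀ a, IsCompact (K a)) → HasULC S K) :
    HasULC S fun b : (A × (Fin (n + 1) → ℝ)) × ℝ => link (E b.1.1) b.1.2 b.2 := by
  have hcH : ∀ b : (A × (Fin (n + 1) → ℝ)) × ℝ, ∀ p, IsCompact (hemi (E b.1.1) b.1.2 b.2 p) :=
    fun b p => isCompact_hemi (hc _) _ _ p
  choose G hG hmono hcontr hex using fun p : Fin (n + 1) × Bool =>
    ih (fun b => dropCoord p.1 '' hemi (E b.1.1) b.1.2 b.2 p) ((hE.hemi p).image_dropCoord p.1)
      fun b => (hcH b p).image (continuous_dropCoord p.1)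
  refine HasULC.of_pointwise hE.link (fun b => isCompact_link (hc _) _ _)
    (fun b z r ρ => 0 ≤ ρ ∧ ∃ p : Fin (n + 1) × Bool, ∃ r₁ ρ₁ : ℝ, G p b r₁ ρ₁ ∧ ρ ≤ ρ₁ ∧
      (∀ w, w ∈ _root_.link (E b.1.1) b.1.2 b.2 → dist w z ≤ ρ →
        w ∈ _root_.hemi (E b.1.1) b.1.2 b.2 p) ∧
      ∀ w, w ∈ _root_.hemi (E b.1.1) b.1.2 b.2 p →
        dist (dropCoord p.1 w) (dropCoord p.1 z) ≤ r₁ → dist w z ≤ r) ?_ ?_ ?_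
  · refine DefP.and ?_ (DefP.exists_finite fun p => DefP.ex (DefP.ex (DefP.and ?_ (DefP.and ?_
      (DefP.and (DefP.all (DefP.imp ?_ (DefP.imp ?_ ?_)))
        (DefP.all (DefP.imp ?_ (DefP.imp ?_ ?_))))))))
    · exact DefP.le (by fun_prop) (by fun_prop)
    · exact (hG p).comp (φ := fun q : ((((((A × (Fin (n + 1) → ℝ)) × ℝ) × (Fin (n + 1) → ℝ)) × ℝ)
        × ℝ) × ℝ) × ℝ => ((q.1.1.1.1.1, q.1.2), q.2)) (by fun_prop)
    all_goals first
      | exact DefP.le (by fun_prop) (by fun_prop)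
      | exact hE.link.mem (by fun_prop) (by fun_prop)
      | exact (hE.hemi p).mem (by fun_prop) (by fun_prop)
      | exact DefP.le ((defMap_dropCoord p.1 (by fun_prop)).dist
          (defMap_dropCoord p.1 (by fun_prop))) (by fun_prop)
  · rintro b z hz r ρ ⟨hρ, p, r₁, ρ₁, h1, h2, h3, h4⟩
    exact Contr.of_chart (continuous_dropCoord p.1) (hcH b p) (fun w hw => hw.1)
      (injOn_dropCoord_hemi _ _ _ p) (fun w hw => h3 w hw.1 hw.2)
      (fun w hw => (dist_dropCoord_le _ _ _).trans (hw.2.trans h2)) h4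
      (hcontr p b _ _ h1 _ ⟨z, h3 z hz (by simpa using hρ), rfl⟩)
  · rintro b z hz r hr
    obtain ⟨i, hi⟩ : ∃ i, z i ≠ b.1.2 i := by
      by_contra! h
      have := hz.2.2
      simp only [h, sub_self, mul_zero, Finset.sum_const_zero] at this
      have h0 := hz.2.1
      nlinarith
    obtain ⟨κ, hκ⟩ : ∃ κ : Bool, 0 < (if κ then 1 else -1) * (z i - b.1.2 i) := by
      rcases lt_or_gt_of_ne hi with h | h
      · exact ⟨false, by simpa using h⟩
      · exact ⟨true, by simpa using h⟩
    have hnear : ∀ w, w ∈ _root_.link (E b.1.1) b.1.2 b.2 →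
        dist w z ≤ (if κ then 1 else -1) * (z i - b.1.2 i) →
        w ∈ _root_.hemi (E b.1.1) b.1.2 b.2 (i, κ) := fun w hw hd => by
      refine ⟨hw, ?_⟩
      have := (dist_le_pi_dist w z i).trans hd
      rw [Real.dist_eq] at this
      cases κ <;> simp at this ⊢ <;> linarith [abs_le.1 this]
    obtain ⟨r₁, hr₁, h4⟩ : ∃ r₁ > 0, ∀ w, w ∈ _root_.hemi (E b.1.1) b.1.2 b.2 (i, κ) →
        dist (dropCoord i w) (dropCoord i z) ≤ r₁ → dist w z ≤ r := by
      have hcl : IsCompact (_root_.hemi (E b.1.1) b.1.2 b.2 (i, κ) ∩ {w | r ≤ dist w z}) :=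
        (hcH b (i, κ)).inter_right (isClosed_le continuous_const (by fun_prop))
      rcases eq_empty_or_nonempty (_root_.hemi (E b.1.1) b.1.2 b.2 (i, κ) ∩ {w | r ≤ dist w z})
        with he | hne
      · refine ⟨1, one_pos, fun w hw _ => ?_⟩
        by_contra h
        exact (he ▸ (⟨hw, (not_le.1 h).le⟩ : w ∈ _ ∩ {w | r ≤ dist w z}) : w ∈ (∅ : Set _))
      · obtain ⟨w₀, hw₀, hmin⟩ := hcl.exists_isMinOn hne
          (f := fun w => dist (dropCoord i w) (dropCoord i z))
          (((continuous_dropCoord i).dist continuous_const).continuousOn)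
        have hpos : 0 < dist (dropCoord i w₀) (dropCoord i z) := by
          refine dist_pos.2 fun h => ?_
          have := injOn_dropCoord_hemi _ _ _ (i, κ) hw₀.1 (hnear z hz (by simpa using hκ.le)) h
          have h2 := hw₀.2
          rw [this] at h2
          simp only [mem_ofPred_eq, dist_self] at h2
          linarith
        refine ⟨dist (dropCoord i w₀) (dropCoord i z) / 2, half_pos hpos, fun w hw hd => ?_⟩
        by_contra h
        have := hmin (a := w) ⟨hw, (not_le.1 h).le⟩
        simp only [mem_ofPred_eq] at this
        linarith
    obtain ⟨ρ₁, hρ₁, hGρ⟩ := hex (i, κ) b r₁ hr₁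
    refine ⟨min ρ₁ ((if κ then 1 else -1) * (z i - b.1.2 i)), lt_min hρ₁ hκ,
      (lt_min hρ₁ hκ).le, (i, κ), r₁, ρ₁, hGρ, min_le_left _ _, fun w hw hd => ?_, h4⟩
    exact hnear w hw (hd.trans (min_le_right _ _))

end Links

section Cone
variable {n : ℕ}

theorem exists_extend_subtype {X Z : Type*} [TopologicalSpace X] [TopologicalSpace Z] [Nonempty Z]
    {B : Set X} {G : B × ℝ → Z} (hG : ContinuousOn G (univ ×ˢ Icc 0 1)) :
    ∃ c : X × ℝ → Z, ContinuousOn c (B ×ˢ Icc 0 1) ∧ ∀ x (h : x ∈ B) τ, c (x, τ) = G (⟨x, h⟩, τ) := by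
  classical
  refine ⟨fun p => if h : p.1 ∈ B then G (⟨p.1, h⟩, p.2) else Classical.arbitrary Z, ?_,
    fun x h τ => by simp [h]⟩
  rw [continuousOn_iff_continuous_domRestrict]
  have h1 : Continuous fun q : ↥(B ×ˢ Icc (0 : ℝ) 1) => ((⟨q.1.1, q.2.1⟩ : B), q.1.2) := by fun_prop
  refine (hG.comp_continuous h1 fun q => ⟨mem_univ _, q.2.2⟩).congr fun q => ?_
  simp [domRestrict, q.2.1]

/-- The part of `E` in the Euclidean ball of squared radius `s ^ 2`. -/
def euclPart (E : Set (Fin n → ℝ)) (x : Fin n → ℝ) (s : ℝ) : Set (Fin n → ℝ) :=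
  {z | z ∈ E ∧ √(∑ i, (z i - x i) * (z i - x i)) ≤ s}

theorem dist_le_eucl (z x : Fin n → ℝ) : dist z x ≤ √(∑ i, (z i - x i) * (z i - x i)) := by
  refine (dist_pi_le_iff (Real.sqrt_nonneg _)).2 fun i => ?_
  rw [Real.dist_eq]
  refine Real.abs_le_sqrt ?_
  rw [sq]
  exact Finset.single_le_sum (f := fun i => (z i - x i) * (z i - x i))
    (fun i _ => mul_self_nonneg _) (Finset.mem_univ i)

theorem eucl_le_dist (z x : Fin n → ℝ) : √(∑ i, (z i - x i) * (z i - x i)) ≤ n * dist z x := by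
  rw [Real.sqrt_le_left (by positivity)]
  have h1 : ∀ i ∈ Finset.univ, (z i - x i) * (z i - x i) ≤ dist z x * dist z x := fun i _ => by
    rw [← abs_mul_abs_self (z i - x i), ← Real.dist_eq]
    exact mul_self_le_mul_self dist_nonneg (dist_le_pi_dist z x i)
  refine (Finset.sum_le_sum h1).trans ?_
  rw [Finset.sum_const, Finset.card_univ, Fintype.card_fin, nsmul_eq_mul, mul_pow, sq (dist z x)]
  refine mul_le_mul_of_nonneg_right ?_ (mul_self_nonneg _)
  rcases Nat.eq_zero_or_pos n with rfl | h
  · simp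
  · have : (1 : ℝ) ≤ n := by exact_mod_cast h
    nlinarith

theorem continuous_eucl (x : Fin n → ℝ) :
    Continuous fun z : Fin n → ℝ => √(∑ i, (z i - x i) * (z i - x i)) := by fun_prop

theorem mem_link_eucl {E : Set (Fin n → ℝ)} {x z : Fin n → ℝ} (hz : z ∈ E)
    (h : 0 < √(∑ i, (z i - x i) * (z i - x i))) :
    z ∈ link E x (√(∑ i, (z i - x i) * (z i - x i))) :=
  ⟨hz, h, (Real.mul_self_sqrt (Finset.sum_nonneg fun _ _ => mul_self_nonneg _)).symm⟩

theorem eucl_of_mem_link {E : Set (Fin n → ℝ)} {x z : Fin n → ℝ} {s : ℝ} (h : z ∈ link E x s) :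
    √(∑ i, (z i - x i) * (z i - x i)) = s := by
  rw [h.2.2, Real.sqrt_mul_self h.2.1.le]

theorem deform_euclPart {E : Set (Fin n → ℝ)} (hE : IsCompact E) {x : Fin n → ℝ} {u v : ℝ}
    (hu : 0 < u) (huv : u ≤ v) (h : ∀ s ∈ Icc u v, TameAt (link E x) s) :
    Deform [] (euclPart E x v) (euclPart E x u) := by
  obtain ⟨R, hR⟩ := hE.isBounded.subset_closedBall 0
  obtain ⟨η, hη, T, hT, H⟩ := exists_transport (l := []) (K := link E x) (a := u) (b := v) (R := R)
    (by simp) (fun s _ => (isCompact_link hE x s).isClosed) (fun s _ => fun z hz => hR hz.1) h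
  set g : (Fin n → ℝ) → ℝ := fun z => √(∑ i, (z i - x i) * (z i - x i)) with hg
  have hgc : Continuous g := continuous_eucl x
  have hcl : ∀ s, IsClosed (euclPart E x s) := fun s =>
    hE.isClosed.inter (isClosed_le hgc continuous_const)
  have := deform_chain (l := []) (K := fun s => euclPart E x (u + v - s)) huv hη
    (fun s _ => hcl _) (fun s _ s' _ hss z hz => ⟨hz.1, hz.2.trans (by linarith)⟩) ?_
  · simpa using this
  intro s hs s' hs' hss hsη
  obtain ⟨q, hq⟩ : ∃ q, q = u + v - s := ⟨_, rfl⟩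
  obtain ⟨p, hp⟩ : ∃ p, p = u + v - s' := ⟨_, rfl⟩
  rw [← hq, ← hp]
  have hup : u ≤ p := by linarith [hs'.2]
  have hqv : q ≤ v := by linarith [hs.1]
  have hpq : p ≤ q := by linarith
  have hqp : q - p ≤ η := by linarith
  let k : (Fin n → ℝ) × ℝ → Fin n → ℝ := fun w =>
    if g w.1 ≤ p then w.1 else T (g w.1, w.1, g w.1 - w.2 * (g w.1 - p))
  have hmem : ∀ z ∈ E, p ≤ g z → g z ≤ q → ∀ τ ∈ Icc (0 : ℝ) 1,
      g z ∈ Icc u v ∧ g z - τ * (g z - p) ∈ Icc u v ∧ |g z - (g z - τ * (g z - p))| ≤ η ∧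
        z ∈ link E x (g z) ∧ p ≤ g z - τ * (g z - p) ∧ g z - τ * (g z - p) ≤ g z := by
    intro z hz h1 h2 τ hτ
    have a1 : 0 ≤ τ * (g z - p) := mul_nonneg hτ.1 (by linarith)
    have a2 : τ * (g z - p) ≤ g z - p := mul_le_of_le_one_left (by linarith) hτ.2
    refine ⟨⟨by linarith, by linarith⟩, ⟨by linarith, by linarith⟩, ?_,
      mem_link_eucl hz (hu.trans_le (hup.trans h1)), by linarith, by linarith⟩
    rw [sub_sub_cancel, abs_of_nonneg a1]; linarith
  have hk1 : ∀ z τ, g z ≤ p → k (z, τ) = z := fun z τ h => by simp only [k, h, if_true]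
  have hk2 : ∀ z ∈ E, p ≤ g z → g z ≤ q → ∀ τ, k (z, τ) = T (g z, z, g z - τ * (g z - p)) := by
    intro z hz h1 h2 τ
    rcases h1.lt_or_eq with h | h
    · simp only [k, not_le.2 h, if_false]
    · rw [hk1 z τ h.symm.le, ← h, sub_self, mul_zero, sub_zero]
      obtain ⟨a1, -, -, a4, -⟩ := hmem z hz h1 h2 0 (by simp)
      rw [← h] at a1 a4
      exact ((H p a1 p a1 (by simpa using hη.le) z a4).2.1 a4).symm
  refine ⟨k, ?_, fun z hz => ?_⟩
  · have hun : euclPart E x q ×ˢ Icc (0 : ℝ) 1 =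
        (euclPart E x q ∩ {z | g z ≤ p}) ×ˢ Icc (0 : ℝ) 1 ∪
          (euclPart E x q ∩ {z | p ≤ g z}) ×ˢ Icc (0 : ℝ) 1 := by
      rw [← union_prod, ← inter_union_distrib_left]
      congr 1
      ext z
      simp only [mem_inter_iff, mem_union, mem_ofPred_eq, le_total, and_true]
    rw [hun]
    refine ContinuousOn.union_of_isClosed ?_ ?_
      (((hcl q).inter (isClosed_le hgc continuous_const)).prod isClosed_Icc)
      (((hcl q).inter (isClosed_le continuous_const hgc)).prod isClosed_Icc)
    · exact continuousOn_fst.congr fun w hw => hk1 w.1 w.2 hw.1.2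
    · refine ContinuousOn.congr
        (f := fun w : (Fin n → ℝ) × ℝ => T (g w.1, w.1, g w.1 - w.2 * (g w.1 - p))) ?_
        fun w hw => hk2 w.1 hw.1.1.1 hw.1.2 hw.1.1.2 w.2
      refine hT.comp (by fun_prop) fun w hw => ?_
      obtain ⟨a1, a2, a3, a4, -⟩ := hmem w.1 hw.1.1.1 hw.1.2 hw.1.1.2 w.2 hw.2
      exact ⟨a1, a2, a3, a4⟩
  · rcases le_total (g z) p with h | h
    · simp only [hk1 z _ h]
      exact ⟨trivial, ⟨hz.1, h⟩, fun τ hτ => ⟨hz, fun _ => trivial, by simp⟩⟩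
    · simp only [hk2 z hz.1 h hz.2]
      refine ⟨?_, ?_, fun τ hτ => ⟨?_, fun hz' => ?_, by simp⟩⟩
      · obtain ⟨a1, a2, a3, a4, -⟩ := hmem z hz.1 h hz.2 0 (by simp)
        have := (H _ a1 _ a2 a3 z a4).2.1 (by simpa using a4)
        exact this
      · obtain ⟨a1, a2, a3, a4, -⟩ := hmem z hz.1 h hz.2 1 (by simp)
        have := (H _ a1 _ a2 a3 z a4).1
        exact ⟨this.1, (eucl_of_mem_link this).trans_le (by linarith)⟩
      · obtain ⟨a1, a2, a3, a4, a5, a6⟩ := hmem z hz.1 h hz.2 τ hτ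
        have := (H _ a1 _ a2 a3 z a4).1
        exact ⟨this.1, (eucl_of_mem_link this).trans_le (a6.trans hz.2)⟩
      · obtain ⟨a1, a2, a3, a4, a5, a6⟩ := hmem z hz.1 h hz.2 τ hτ
        have hgz : g z = p := le_antisymm hz'.2 h
        refine (H _ a1 _ a2 a3 z a4).2.1 ?_
        rw [hgz] at a4 ⊢
        simpa using a4

/-- A set with tame small links at `x` is locally conical, in particular contractible, near `x`. -/
theorem contr_of_tame_link {E : Set (Fin n → ℝ)} (hE : IsCompact E) {x : Fin n → ℝ} {ρ r : ℝ}
    (hx : x ∈ E) (hρ : 0 < ρ) (hr : (n + 1) * ρ ≤ r)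
    (h : ∀ s, 0 < s → s ≤ (n + 1) * ρ → TameAt (link E x) s) : Contr E x ρ r := by
  set d : ℝ := (n + 1) * ρ with hd
  have hd0 : 0 < d := by positivity
  let B : ℕ → Set (Fin n → ℝ) := fun k => euclPart E x (d / 2 ^ k)
  have hBd : ∀ k, ∀ z ∈ B k, dist z x ≤ d / 2 ^ k := fun k z hz => (dist_le_eucl z x).trans hz.2
  have hanti : ∀ k, d / 2 ^ (k + 1) ≤ d / 2 ^ k := fun k =>
    div_le_div_of_nonneg_left hd0.le (by positivity) (pow_le_pow_right₀ (by norm_num) (by omega))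
  have hBB : ∀ k, B (k + 1) ⊆ B k := fun k z hz => ⟨hz.1, hz.2.trans (hanti k)⟩
  have hB0 : ∀ k, B k ⊆ B 0 := fun k => by
    induction k with
    | zero => rfl
    | succ k ih => exact (hBB k).trans ih
  have hle : ∀ k, d / 2 ^ k ≤ d := fun k => by
    rw [div_le_iff₀ (by positivity)]
    exact le_mul_of_one_le_right hd0.le (one_le_pow₀ (by norm_num))
  choose f hf hF using fun k => deform_euclPart hE (u := d / 2 ^ (k + 1)) (v := d / 2 ^ k)
    (by positivity) (hanti k) fun s hs => h s (lt_of_lt_of_le (by positivity) hs.1) (hs.2.trans (hle k))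
  let Rt : ℕ → (Fin n → ℝ) → (Fin n → ℝ) := fun k => Nat.rec id (fun k R z => f k (R z, 1)) k
  have hR0 : ∀ z, Rt 0 z = z := fun _ => rfl
  have hRs : ∀ k z, Rt (k + 1) z = f k (Rt k z, 1) := fun _ _ => rfl
  have hRm : ∀ k, ∀ z ∈ B 0, Rt k z ∈ B k := by
    intro k
    induction k with
    | zero => exact fun z hz => hz
    | succ k ih => exact fun z hz => (hF k _ (ih z hz)).2.1
  have hRc : ∀ k, ContinuousOn (Rt k) (B 0) := by
    intro k
    induction k with
    | zero => exact continuousOn_id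
    | succ k ih => exact (hf k).comp (ih.prodMk continuousOn_const) fun z hz => ⟨hRm k z hz, by simp⟩
  obtain ⟨G, hG, hG0, hG1, hGm⟩ := exists_infinite_concat (X := B 0) (Z := Fin n → ℝ)
    (fun k p => f k (Rt k p.1, p.2))
    (fun k => (hf k).comp (ContinuousOn.prodMk ((hRc k).comp (by fun_prop) fun p _ => p.1.2)
      (by fun_prop)) fun p hp => ⟨hRm k _ p.1.2, hp.2⟩)
    (fun k p => by
      rw [← hRs]
      exact ((hF (k + 1) _ (hRm _ _ p.2)).1).symm)
    (fun _ => x) continuous_const fun z U hU => by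
      obtain ⟨e, he, hU⟩ := Metric.mem_nhds_iff.1 hU
      obtain ⟨N, hN⟩ : ∃ N : ℕ, d / 2 ^ N < e := by
        obtain ⟨N, hN⟩ := exists_pow_lt_of_lt_one (show 0 < e / d by positivity)
          (show (1 / 2 : ℝ) < 1 by norm_num)
        refine ⟨N, ?_⟩
        rw [lt_div_iff₀ hd0] at hN
        rwa [div_eq_mul_one_div, ← one_div_pow, mul_comm]
      refine ⟨univ, univ_mem, N, fun k hk z' _ τ hτ => hU ?_⟩
      have := hBd k _ (((hF k _ (hRm k _ z'.2)).2.2 τ hτ).1)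
      refine this.trans_lt (lt_of_le_of_lt ?_ hN)
      exact div_le_div_of_nonneg_left hd0.le (by positivity) (pow_le_pow_right₀ (by norm_num) hk)
  obtain ⟨c, hc, hcG⟩ := exists_extend_subtype hG
  have hsub : E ∩ closedBall x ρ ⊆ B 0 := fun z hz => by
    refine ⟨hz.1, (eucl_le_dist z x).trans ?_⟩
    have := hz.2
    rw [mem_closedBall] at this
    have h0 : (0 : ℝ) ≤ n := n.cast_nonneg
    have h2 := dist_nonneg (x := z) (y := x)
    rw [pow_zero, div_one, hd]
    nlinarith
  have hxB : x ∈ B 0 := ⟨hx, by simpa using hd0.le⟩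
  refine ⟨c, x, hc.mono (prod_mono hsub Subset.rfl), fun z hz => ?_⟩
  have hz0 := hsub hz
  refine ⟨?_, ?_, fun τ hτ => ?_⟩
  · rw [hcG z hz0, hG0]
    exact (hF 0 _ (hRm 0 _ hz0)).1
  · rw [hcG z hz0, hG1]
  · have hmem : c (z, τ) ∈ B 0 := by
      rw [hcG z hz0]
      rcases hGm ⟨z, hz0⟩ τ hτ with h | ⟨k, τ', hτ', h⟩
      · rw [h]; exact hxB
      · rw [h]
        exact hB0 k (((hF k _ (hRm k _ hz0)).2.2 τ' hτ').1)
    exact ⟨hmem.1, (hBd 0 _ hmem).trans (by simpa using hr)⟩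

end Cone

/-- Definable families of compact sets are uniformly locally contractible, with a definable
modulus. -/
theorem RealStructure.IsOMinimal.hasULC {S : RealStructure} (hS : S.IsOMinimal) (n : ℕ) :
    ∀ (A : Type) [Coord A] (E : A → Set (Fin n → ℝ)), DefFam S E → (∀ a, IsCompact (E a)) →
      HasULC S E := by
  induction n with
  | zero =>
    intro A _ E _ _
    refine ⟨fun _ r _ => 0 ≤ r, DefP.le (by fun_prop) (by fun_prop),
      fun a r ρ r' ρ' h hr _ => h.trans hr, fun a r ρ hr y hy => ?_,
      fun a r hr => ⟨1, one_pos, hr.le⟩⟩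
    refine ⟨Prod.fst, y, continuousOn_fst, fun z hz => ⟨rfl, Subsingleton.elim _ _, fun τ _ => ⟨hz.1, ?_⟩⟩⟩
    rw [mem_closedBall, Subsingleton.elim z y, dist_self]
    exact hr
  | succ n ih =>
    intro A _ E hE hc
    obtain ⟨W, hW, htame, hcount⟩ := (HasULC.link hE hc fun K => ih _ K).exists_tame hS hE.link
      fun p => by
        obtain ⟨R, hR⟩ := (hc p.1).isBounded.subset_closedBall 0
        exact ⟨R, fun s z hz => hR hz.1⟩
    refine HasULC.of_pointwise hE hc (fun a x r ρ => 0 < ρ ∧ ((n + 1 : ℕ) + 1) * ρ ≤ r ∧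
      ∀ s : ℝ, 0 < s → s ≤ ((n + 1 : ℕ) + 1) * ρ → W ((a, x), s)) ?_ ?_ ?_
    · refine DefP.and ?_ (DefP.and ?_ (DefP.all (DefP.imp ?_ (DefP.imp ?_ ?_))))
      · exact DefP.lt (by fun_prop) (by fun_prop)
      · exact DefP.le (by fun_prop) (by fun_prop)
      · exact DefP.lt (by fun_prop) (by fun_prop)
      · exact DefP.le (by fun_prop) (by fun_prop)
      · exact hW.comp (φ := fun q : (((A × (Fin (n + 1) → ℝ)) × ℝ) × ℝ) × ℝ => (q.1.1.1, q.2))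
          (by fun_prop)
    · rintro a x hx r ρ ⟨h1, h2, h3⟩
      exact contr_of_tame_link (hc a) hx h1 h2 fun s hs hsρ => htame (a, x) s (h3 s hs hsρ)
    · intro a x hx r hr
      have hd : DefP S fun s : ℝ => W ((a, x), s) :=
        hW.comp (φ := fun s : ℝ => ((a, x), s)) (by fun_prop)
      rcases hS.dichotomy hd with ⟨d, hd, h⟩ | ⟨d, hd, h⟩
      · have h0 : (0 : ℝ) < (n + 1 : ℕ) + 1 := by positivity
        refine ⟨min (d / 2) r / ((n + 1 : ℕ) + 1), by positivity, by positivity, ?_, fun s hs hsd => ?_⟩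
        · rw [mul_div_cancel₀ _ h0.ne']
          exact min_le_right _ _
        · rw [mul_div_cancel₀ _ h0.ne'] at hsd
          refine h s hs ?_
          linarith [min_le_left (d / 2) r]
      · exfalso
        refine not_countable_Icc (show d / 3 < d / 2 by linarith) ((hcount (a, x)).mono fun s hs => ?_)
        exact h s (by linarith [hs.1]) (by linarith [hs.2])

section Thresholds
variable {S : RealStructure} {A : Type} [Coord A] {n M : ℕ}

/-- Off countably many parameters, a definable compact family is tame with respect to a list. -/
theorem RealStructure.IsOMinimal.exists_tameAtL (hS : S.IsOMinimal) (l : List (Set (Fin n → ℝ)))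
    (hl : ∀ Q ∈ l, IsClosed Q ∧ DefP S fun x => x ∈ Q) {K : A × ℝ → Set (Fin n → ℝ)}
    (hK : DefFam S K) (hc : ∀ p, IsCompact (K p)) (hb : ∀ a, ∃ R, ∀ s, K (a, s) ⊆ closedBall 0 R) :
    ∃ W : A × ℝ → Prop, DefP S W ∧ (∀ a s, W (a, s) → TameAtL l (fun s => K (a, s)) s) ∧
      ∀ a, {s | ¬ W (a, s)}.Countable := by
  induction l generalizing K with
  | nil => exact (hS.hasULC n _ K hK hc).exists_tame hS hK hb
  | cons Q l ih =>
    have hl' : ∀ Q' ∈ l, IsClosed Q' ∧ DefP S fun x => x ∈ Q' := fun Q' h => hl Q' (.tail _ h)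
    obtain ⟨hQc, hQd⟩ := hl Q (.head _)
    obtain ⟨W₁, h1, h1', h1''⟩ := ih hl' hK hc hb
    have hKQ : DefFam S fun p => K p ∩ Q :=
      DefP.and hK (hQd.comp (φ := fun q : (A × ℝ) × (Fin n → ℝ) => q.2) (by fun_prop))
    obtain ⟨W₂, h2, h2', h2''⟩ := ih hl' (K := fun p => K p ∩ Q) hKQ
      (fun p => (hc p).inter_right hQc)
      fun a => (hb a).imp fun R h s => inter_subset_left.trans (h s)
    refine ⟨fun p => W₁ p ∧ W₂ p, h1.and h2, fun a s h => ⟨h1' a s h.1, h2' a s h.2⟩, fun a => ?_⟩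
    refine ((h1'' a).union (h2'' a)).mono fun s hs => ?_
    by_contra hcon
    simp only [mem_union, not_or] at hcon
    exact hs ⟨not_not.1 hcon.1, not_not.1 hcon.2⟩

/-- `B` meets every line in the `j`-th direction in a countable set. -/
def Thin (j : Fin M) (B : (Fin M → ℝ) → Prop) : Prop :=
  ∀ ε : Fin M → ℝ, {s | B (Function.update ε j s)}.Countable

/-- The exceptional parameters of a definable compact family. -/
theorem RealStructure.IsOMinimal.exists_bad (hS : S.IsOMinimal) (l : List (Set (Fin n → ℝ)))
    (hl : ∀ Q ∈ l, IsClosed Q ∧ DefP S fun x => x ∈ Q) {K : (Fin M → ℝ) → Set (Fin n → ℝ)}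
    (hK : DefFam S K) (hc : ∀ p, IsCompact (K p)) {R : ℝ} (hb : ∀ ε, K ε ⊆ closedBall 0 R)
    (j : Fin M) : ∃ B : (Fin M → ℝ) → Prop, DefP S B ∧ Thin j B ∧
      ∀ ε s, ¬ B (Function.update ε j s) → TameAtL l (fun s => K (Function.update ε j s)) s := by
  obtain ⟨W, h1, h2, h3⟩ := hS.exists_tameAtL l hl
    (K := fun p : (Fin M → ℝ) × ℝ => K (Function.update p.1 j p.2))
    (hK.comp (φ := fun p : (Fin M → ℝ) × ℝ => Function.update p.1 j p.2)
      (defMap_update j (by fun_prop) (by fun_prop))) (fun p => hc _) fun a => ⟨R, fun s => hb _⟩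
  refine ⟨fun ε => ¬ W (Function.update ε j 0, ε j), ?_, fun ε => ?_, fun ε s hs => ?_⟩
  · exact (h1.comp (φ := fun ε : Fin M → ℝ => (Function.update ε j 0, ε j))
      ((defMap_update j (by fun_prop) (by fun_prop)).prodMk (DefMap.apply (by fun_prop) j))).not
  · simpa using h3 (Function.update ε j 0)
  · simp only [Function.update_idem, Function.update_self, not_not] at hs
    simpa using h2 _ _ hs

/-- The points where `B` cannot be avoided uniformly as the `i`-th coordinate tends to `0`. -/
def plusBad (i j : Fin M) (B : (Fin M → ℝ) → Prop) (ε : Fin M → ℝ) : Prop :=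
  ¬ ∃ e : ℝ, e > 0 ∧ ∃ d : ℝ, d > 0 ∧ ∀ u s : ℝ, 0 < u → u < d → |s - ε j| < e →
    ¬ B (Function.update (Function.update ε i u) j s)

theorem plusBad_def {i j : Fin M} {B : (Fin M → ℝ) → Prop} (h : DefP S B) :
    DefP S (plusBad i j B) := by
  have key : DefP S fun q : ((Fin M → ℝ) × ℝ) × ℝ => ∀ u s : ℝ, 0 < u → u < q.2 →
      |s - q.1.1 j| < q.1.2 → ¬ B (Function.update (Function.update q.1.1 i u) j s) := by
    refine DefP.all (DefP.all (DefP.imp ?_ (DefP.imp ?_ (DefP.imp ?_ (DefP.not ?_)))))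
    · exact DefP.lt (by fun_prop) (by fun_prop)
    · exact DefP.lt (by fun_prop) (by fun_prop)
    · exact DefP.lt (DefMap.abs (DefMap.sub (by fun_prop) (DefMap.apply (by fun_prop) j)))
        (by fun_prop)
    · exact h.comp (φ := fun q : ((((Fin M → ℝ) × ℝ) × ℝ) × ℝ) × ℝ =>
        Function.update (Function.update q.1.1.1.1 i q.1.2) j q.2)
        (defMap_update j (defMap_update i (by fun_prop) (by fun_prop)) (by fun_prop))
  refine (DefP.ex ((DefP.lt (by fun_prop) (by fun_prop)).and (DefP.ex
    ((DefP.lt (by fun_prop) (by fun_prop)).and key)))).not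

theorem plusBad_update_self {i j : Fin M} (hij : i ≠ j) (B : (Fin M → ℝ) → Prop) (ε : Fin M → ℝ)
    (u : ℝ) : plusBad i j B (Function.update ε i u) ↔ plusBad i j B ε := by
  simp [plusBad, Function.update_of_ne hij.symm]

theorem plusBad_update_of_indep {i j k : Fin M} {B : (Fin M → ℝ) → Prop} (hk : k ≠ j)
    (h : ∀ ε u, B (Function.update ε k u) ↔ B ε) (ε : Fin M → ℝ) (u : ℝ) :
    plusBad i j B (Function.update ε k u) ↔ plusBad i j B ε := by
  have : ∀ v s, B (Function.update (Function.update (Function.update ε k u) i v) j s) ↔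
      B (Function.update (Function.update ε i v) j s) := fun v s => by
    by_cases hki : k = i
    · subst hki; rw [Function.update_idem]
    · rw [Function.update_comm hki, Function.update_comm hk, h]
  simp only [plusBad, this, Function.update_of_ne hk.symm]

theorem plusBad_thin (hS : S.IsOMinimal) {i j : Fin M} (hij : i ≠ j) {B : (Fin M → ℝ) → Prop}
    (h : DefP S B) (hB : Thin j B) : Thin j (plusBad i j B) := by
  intro ε
  have hd : DefP S fun s : ℝ => plusBad i j B (Function.update ε j s) :=
    (plusBad_def h).comp (φ := fun s : ℝ => Function.update ε j s)
      (defMap_update j (by fun_prop) (by fun_prop))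
  by_contra hcon
  obtain ⟨a, b, hab, hI⟩ := hS.exists_Icc hd hcon
  have hB2 : DefP S fun q : ℝ × ℝ => B (Function.update (Function.update ε i q.1) j q.2) :=
    h.comp (φ := fun q : ℝ × ℝ => Function.update (Function.update ε i q.1) j q.2)
      (defMap_update j (defMap_update i (by fun_prop) (by fun_prop)) (by fun_prop))
  -- for all `s` in a subinterval, the points with small `i`-th coordinate avoid `B`
  obtain ⟨a', b', hab', hsub, hgood⟩ : ∃ a' b', a' < b' ∧ Icc a' b' ⊆ Icc a b ∧
      ∀ s ∈ Icc a' b', ∃ δ > 0, ∀ u, 0 < u → u < δ →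
        ¬ B (Function.update (Function.update ε i u) j s) := by
    have hgd : DefP S fun s : ℝ => (a ≤ s ∧ s ≤ b) ∧ ∃ δ : ℝ, δ > 0 ∧ ∀ u : ℝ, 0 < u → u < δ →
        ¬ B (Function.update (Function.update ε i u) j s) := by
      refine ((DefP.le (by fun_prop) (by fun_prop)).and (DefP.le (by fun_prop) (by fun_prop))).and
        (DefP.ex (DefP.and ?_ (DefP.all (DefP.imp ?_ (DefP.imp ?_ (DefP.not ?_))))))
      · exact DefP.lt (by fun_prop) (by fun_prop)
      · exact DefP.lt (by fun_prop) (by fun_prop)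
      · exact DefP.lt (by fun_prop) (by fun_prop)
      · exact hB2.comp (φ := fun q : (ℝ × ℝ) × ℝ => (q.2, q.1.1)) (by fun_prop)
    by_cases hc : {s : ℝ | (a ≤ s ∧ s ≤ b) ∧ ∃ δ : ℝ, δ > 0 ∧ ∀ u : ℝ, 0 < u → u < δ →
        ¬ B (Function.update (Function.update ε i u) j s)}.Countable
    swap
    · obtain ⟨a', b', hab', h'⟩ := hS.exists_Icc hgd hc
      exact ⟨a', b', hab', fun s hs => (h' s hs).1, fun s hs => (h' s hs).2⟩
    exfalso
    -- otherwise `B` contains small `i`-th coordinates uniformly, contradicting thinness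
    have hbd : DefP S fun s : ℝ => (a ≤ s ∧ s ≤ b) ∧ ¬ ((a ≤ s ∧ s ≤ b) ∧
        ∃ δ : ℝ, δ > 0 ∧ ∀ u : ℝ, 0 < u → u < δ →
        ¬ B (Function.update (Function.update ε i u) j s)) :=
      ((DefP.le (by fun_prop) (by fun_prop)).and (DefP.le (by fun_prop) (by fun_prop))).and hgd.not
    have hnc : ¬ {s : ℝ | (a ≤ s ∧ s ≤ b) ∧ ¬ ((a ≤ s ∧ s ≤ b) ∧
        ∃ δ : ℝ, δ > 0 ∧ ∀ u : ℝ, 0 < u → u < δ →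
        ¬ B (Function.update (Function.update ε i u) j s))}.Countable := fun hc' => by
      refine not_countable_Icc hab ((hc.union hc').mono fun s hs => ?_)
      by_cases hp : ((a ≤ s ∧ s ≤ b) ∧ ∃ δ : ℝ, δ > 0 ∧ ∀ u : ℝ, 0 < u → u < δ →
        ¬ B (Function.update (Function.update ε i u) j s))
      · exact Or.inl hp
      · exact Or.inr ⟨hs, hp⟩
    obtain ⟨a', b', hab', h'⟩ := hS.exists_Icc hbd hnc
    have hall : ∀ s ∈ Icc a' b', ∃ δ > 0, ∀ u, 0 < u → u < δ →
        B (Function.update (Function.update ε i u) j s) := by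
      intro s hs
      rcases hS.dichotomy (P := fun u : ℝ => B (Function.update (Function.update ε i u) j s))
        (hB2.comp (φ := fun u : ℝ => (u, s)) (by fun_prop)) with ⟨d, hd, hd'⟩ | ⟨d, hd, hd'⟩
      · exact ⟨d, hd, hd'⟩
      · exact absurd ⟨(h' s hs).1, d, hd, hd'⟩ (h' s hs).2
    obtain ⟨a₂, b₂, hab₂, -, δ, hδ, hu⟩ := hS.exists_uniform_subinterval hB2 hab' hall
    exact not_countable_Icc hab₂ ((hB (Function.update ε i (δ / 2))).mono fun s hs =>
      hu s hs (δ / 2) (by linarith) (by linarith))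
  obtain ⟨a₂, b₂, hab₂, hsub₂, δ, hδ, hu⟩ := hS.exists_uniform_subinterval hB2.not hab' hgood
  refine hI ((a₂ + b₂) / 2) (hsub (hsub₂ ⟨by linarith, by linarith⟩))
    ⟨(b₂ - a₂) / 2, by linarith, δ, hδ, fun u s hu0 hud hs => ?_⟩
  rw [Function.update_self, abs_lt] at hs
  rw [Function.update_comm hij.symm, Function.update_idem]
  exact hu s ⟨by linarith, by linarith⟩ u hu0 hud

theorem plusBad_segment {i j : Fin M} {B : (Fin M → ℝ) → Prop} {ε : Fin M → ℝ} (hij : i ≠ j)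
    {p q : ℝ} (h : ∀ s ∈ Icc p q, ¬ plusBad i j B (Function.update ε j s)) :
    ∃ d > 0, ∀ u, 0 < u → u < d → ∀ s ∈ Icc p q,
      ¬ B (Function.update (Function.update ε i u) j s) := by
  have h' : ∀ s₀ : Icc p q, ∃ e > 0, ∃ d > 0, ∀ u s : ℝ, 0 < u → u < d → |s - s₀| < e →
      ¬ B (Function.update (Function.update ε i u) j s) := fun s₀ => by
    obtain ⟨e, he, d, hd, h1⟩ := not_not.1 (h s₀ s₀.2)
    refine ⟨e, he, d, hd, fun u s hu hud hs => ?_⟩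
    have := h1 u s hu hud (by rwa [Function.update_self])
    rwa [Function.update_comm hij.symm, Function.update_idem] at this
  choose e he d hd h1 using h'
  obtain ⟨t, ht⟩ := isCompact_Icc.elim_finite_subcover (s := Icc p q)
    (fun s₀ : Icc p q => ball (s₀ : ℝ) (e s₀)) (fun _ => isOpen_ball)
    fun s hs => mem_iUnion.2 ⟨⟨s, hs⟩, mem_ball_self (he _)⟩
  obtain ⟨δ, hδ, hδ'⟩ := Finset.exists_pos_forall_le t d fun s₀ _ => hd s₀
  refine ⟨δ, hδ, fun u hu hud s hs => ?_⟩
  obtain ⟨s₀, hs₀, hss⟩ := mem_iUnion₂.1 (ht hs)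
  exact h1 s₀ u s hu (hud.trans_le (hδ' _ hs₀)) hss

/-- Iterating `plusBad` over all coordinates below `i`. -/
def plusIter (j : Fin M) (B : (Fin M → ℝ) → Prop) : ℕ → (Fin M → ℝ) → Prop
  | 0 => B
  | i + 1 => if h : i < M then plusBad ⟨i, h⟩ j (plusIter j B i) else plusIter j B i

theorem plusIter_spec (hS : S.IsOMinimal) {j : Fin M} {B : (Fin M → ℝ) → Prop} (h : DefP S B)
    (hB : Thin j B) (i : ℕ) (hi : i ≤ j) : DefP S (plusIter j B i) ∧ Thin j (plusIter j B i) ∧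
      ∀ k : Fin M, (k : ℕ) < i → ∀ ε u, plusIter j B i (Function.update ε k u) ↔
        plusIter j B i ε := by
  induction i with
  | zero => exact ⟨h, hB, fun k hk => absurd hk (Nat.not_lt_zero _)⟩
  | succ i ih =>
    obtain ⟨h1, h2, h3⟩ := ih (by omega)
    have hiM : i < M := by omega
    have hij : (⟨i, hiM⟩ : Fin M) ≠ j := fun hc => by
      have := congrArg Fin.val hc; simp at this; omega
    simp only [plusIter, hiM, dif_pos]
    refine ⟨plusBad_def h1, plusBad_thin hS hij h1 h2, fun k hk ε u => ?_⟩
    by_cases hki : (k : ℕ) = i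
    · have : k = ⟨i, hiM⟩ := Fin.ext hki
      subst this
      exact plusBad_update_self hij _ _ _
    · refine plusBad_update_of_indep (fun hc => ?_) (h3 k (by omega)) ε u
      subst hc; omega

end Thresholds

section Thresholds
variable {S : RealStructure} {n M : ℕ}

theorem eq_of_update_eq {α : Type*} {B : (Fin M → ℝ) → α} (s : Finset (Fin M))
    (h : ∀ k ∈ s, ∀ ε u, B (Function.update ε k u) = B ε) {ε ε' : Fin M → ℝ}
    (he : ∀ k ∉ s, ε k = ε' k) : B ε = B ε' := by
  induction s using Finset.induction_on generalizing ε with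
  | empty => rw [show ε = ε' from funext fun k => he k (Finset.notMem_empty k)]
  | insert a s ha ih =>
    rw [← h a (Finset.mem_insert_self a s) ε (ε' a)]
    refine ih (fun k hk => h k (Finset.mem_insert_of_mem hk)) fun k hk => ?_
    by_cases hka : k = a
    · subst hka; simp
    · rw [Function.update_of_ne hka]
      exact he k (by simp [hka, hk])

/-- A thin definable set gives a definable threshold below which it is avoided. -/
theorem RealStructure.IsOMinimal.exists_threshold (hS : S.IsOMinimal) {j : Fin M}
    {B : (Fin M → ℝ) → Prop} (h : DefP S B) (hB : Thin j B)
    (hind : ∀ k : Fin M, k < j → ∀ ε u, B (Function.update ε k u) ↔ B ε) :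
    ∃ b : (Fin M → ℝ) → ℝ, DefMap S b ∧
      (∀ ε ε' : Fin M → ℝ, (∀ k, j < k → ε k = ε' k) → b ε = b ε') ∧
      (∀ ε, 0 < b ε ∧ b ε ≤ 1) ∧ ∀ ε s, 0 < s → s < b ε → ¬ B (Function.update ε j s) := by
  let P : (Fin M → ℝ) → ℝ → Prop := fun ε y => (0 < y ∧ y ≤ 1) ∧
    ∀ s : ℝ, 0 < s → s < y → ¬ B (Function.update ε j s)
  have hP : DefP S fun q : (Fin M → ℝ) × ℝ => P q.1 q.2 := by
    refine ((DefP.lt (by fun_prop) (by fun_prop)).and (DefP.le (by fun_prop) (by fun_prop))).and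
      (DefP.all (DefP.imp ?_ (DefP.imp ?_ (DefP.not ?_))))
    · exact DefP.lt (by fun_prop) (by fun_prop)
    · exact DefP.lt (by fun_prop) (by fun_prop)
    · exact h.comp (φ := fun q : ((Fin M → ℝ) × ℝ) × ℝ => Function.update q.1.1 j q.2)
        (defMap_update j (by fun_prop) (by fun_prop))
  have hex : ∀ ε, ∃ y, P ε y ∧ ∀ y', P ε y' → y' ≤ y := by
    intro ε
    have hne : {y | P ε y}.Nonempty := by
      rcases hS.dichotomy (P := fun s : ℝ => B (Function.update ε j s))
        (h.comp (φ := fun s : ℝ => Function.update ε j s)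
          (defMap_update j (by fun_prop) (by fun_prop))) with ⟨d, hd, hd'⟩ | ⟨d, hd, hd'⟩
      · exfalso
        refine not_countable_Icc (show d / 3 < d / 2 by linarith) ((hB ε).mono fun s hs => ?_)
        exact hd' s (by linarith [hs.1]) (by linarith [hs.2])
      · exact ⟨min d 1, ⟨⟨by positivity, min_le_right _ _⟩, fun s hs hsd =>
          hd' s hs (hsd.trans_le (min_le_left _ _))⟩⟩
    have hbd : BddAbove {y | P ε y} := ⟨1, fun y hy => hy.1.2⟩
    refine ⟨sSup {y | P ε y}, ⟨⟨?_, csSup_le hne fun y hy => hy.1.2⟩, fun s hs hsy => ?_⟩,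
      fun y hy => le_csSup hbd hy⟩
    · obtain ⟨y, hy⟩ := hne
      exact hy.1.1.trans_le (le_csSup hbd hy)
    · obtain ⟨y, hy, hys⟩ := exists_lt_of_lt_csSup hne hsy
      exact hy.2 s hs hys
  choose b hb hb' using hex
  have huniq : ∀ ε y, P ε y → (∀ y', P ε y' → y' ≤ y) → y = b ε := fun ε y h1 h2 =>
    le_antisymm (hb' _ _ h1) (h2 _ (hb _))
  refine ⟨b, ?_, fun ε ε' he => ?_, fun ε => (hb ε).1, fun ε => (hb ε).2⟩
  · have hd : DefP S fun q : (Fin M → ℝ) × ℝ => P q.1 q.2 ∧ ∀ y' : ℝ, P q.1 y' → y' ≤ q.2 := by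
      refine hP.and (DefP.all (DefP.imp ?_ ?_))
      · exact hP.comp (φ := fun q : ((Fin M → ℝ) × ℝ) × ℝ => (q.1.1, q.2)) (by fun_prop)
      · exact DefP.le (by fun_prop) (by fun_prop)
    refine hd.congr fun q => ⟨fun hq => ?_, fun hq => huniq _ _ hq.1 hq.2⟩
    rw [hq]
    exact ⟨hb _, hb' _⟩
  · have hPP : ∀ y, P ε y ↔ P ε' y := fun y => by
      have : ∀ s, B (Function.update ε j s) ↔ B (Function.update ε' j s) := fun s => by
        refine Eq.to_iff (eq_of_update_eq (Finset.univ.filter (· < j)) (fun k hk ε u =>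
          propext (hind k (Finset.mem_filter.1 hk).2 ε u)) fun k hk => ?_)
        by_cases hkj : k = j
        · subst hkj; simp
        · rw [Function.update_of_ne hkj, Function.update_of_ne hkj]
          refine he k (lt_of_le_of_ne (not_lt.1 fun hlt => hk ?_) (Ne.symm hkj))
          exact Finset.mem_filter.2 ⟨Finset.mem_univ k, hlt⟩
      simp only [P, this]
    exact huniq _ _ ((hPP _).1 (hb ε)) fun w hw => hb' _ _ ((hPP _).2 hw)

/-- The parameter `ε` can be decreased one coordinate at a time through tame parameters. -/
def GoodParam (l : List (Set (Fin n → ℝ))) (K : (Fin M → ℝ) → Set (Fin n → ℝ))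
    (ε : Fin M → ℝ) : Prop :=
  (∀ j, 0 < ε j) ∧ ∃ B : Fin M → (Fin M → ℝ) → Prop,
    (∀ j ε s, ¬ B j (Function.update ε j s) →
      TameAtL l (fun s => K (Function.update ε j s)) s) ∧
    ∀ j, ∀ s ∈ Ioc 0 (ε j), ¬ plusIter j (B j) j (Function.update ε j s)

theorem RealStructure.IsOMinimal.exists_thresholds (hS : S.IsOMinimal) (l : List (Set (Fin n → ℝ)))
    (hl : ∀ Q ∈ l, IsClosed Q ∧ DefP S fun x => x ∈ Q) {K : (Fin M → ℝ) → Set (Fin n → ℝ)}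
    (hK : DefFam S K) (hc : ∀ p, IsCompact (K p)) {R : ℝ} (hb : ∀ ε, K ε ⊆ closedBall 0 R) :
    ∃ b : Fin M → (Fin M → ℝ) → ℝ, (∀ j, DefMap S (b j)) ∧
      (∀ j (ε ε' : Fin M → ℝ), (∀ k, j < k → ε k = ε' k) → b j ε = b j ε') ∧
      (∀ j ε, 0 < b j ε ∧ b j ε ≤ 1) ∧
      ∀ ε, (∀ j, 0 < ε j ∧ ε j < b j ε) → GoodParam l K ε := by
  choose B hB1 hB2 hB3 using hS.exists_bad (M := M) l hl hK hc hb
  have h : ∀ j, _ := fun j => plusIter_spec hS (hB1 j) (hB2 j) j le_rfl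
  choose b h1 h2 h3 h4 using fun j => hS.exists_threshold (h j).1 (h j).2.1 (h j).2.2
  refine ⟨b, h1, h2, h3, fun ε hε => ⟨fun j => (hε j).1, B, hB3, fun j s hs => ?_⟩⟩
  exact h4 j ε s hs.1 (hs.2.trans_lt (hε j).2)

/-- The coordinates below `j` are taken from `ε'`, the others from `ε`. -/
def mixParam (ε' ε : Fin M → ℝ) (j : Fin M) : Fin M → ℝ := fun k => if k < j then ε' k else ε k

theorem GoodParam.exists_next {l : List (Set (Fin n → ℝ))} {K : (Fin M → ℝ) → Set (Fin n → ℝ)}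
    {ε : Fin M → ℝ} (h : GoodParam l K ε) {b : Fin M → (Fin M → ℝ) → ℝ}
    (hb : ∀ j (ε ε' : Fin M → ℝ), (∀ k, j < k → ε k = ε' k) → b j ε = b j ε')
    (hb0 : ∀ j ε, 0 < b j ε) {η : ℝ} (hη : 0 < η) :
    ∃ ε' : Fin M → ℝ, (∀ j, 0 < ε' j ∧ ε' j < ε j ∧ ε' j < η ∧ ε' j < b j ε') ∧
      ∀ j, ∀ s ∈ Icc (ε' j) (ε j),
        TameAtL l (fun s => K (Function.update (mixParam ε' ε j) j s)) s := by
  obtain ⟨hpos, B, hB, hgood⟩ := h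
  have key : ∀ i ≤ M, ∃ ε' : Fin M → ℝ, (∀ k : Fin M, (k : ℕ) < i → ε' k = ε k) ∧
      (∀ k : Fin M, i ≤ k → 0 < ε' k ∧ ε' k < ε k ∧ ε' k < η ∧ ε' k < b k ε') ∧
      ∀ j : Fin M, i ≤ j → ∀ s ∈ Icc (ε' j) (ε j),
        ¬ plusIter j (B j) i (Function.update (mixParam ε' ε j) j s) := by
    intro i hi
    refine Nat.decreasingInduction' (P := fun i => ∃ ε' : Fin M → ℝ,
      (∀ k : Fin M, (k : ℕ) < i → ε' k = ε k) ∧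
      (∀ k : Fin M, i ≤ k → 0 < ε' k ∧ ε' k < ε k ∧ ε' k < η ∧ ε' k < b k ε') ∧
      ∀ j : Fin M, i ≤ j → ∀ s ∈ Icc (ε' j) (ε j),
        ¬ plusIter j (B j) i (Function.update (mixParam ε' ε j) j s)) ?_ hi
      ⟨ε, fun _ _ => rfl, fun k hk => by omega, fun k hk => by omega⟩
    rintro i hiM - ⟨ε', h1, h2, h3⟩
    have hd : ∀ j : Fin M, ∃ d > 0, i + 1 ≤ j → ∀ u, 0 < u → u < d → ∀ s ∈ Icc (ε' j) (ε j),
        ¬ plusIter j (B j) i (Function.update (Function.update (mixParam ε' ε j) ⟨i, hiM⟩ u) j s) := by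
      intro j
      by_cases hj : i + 1 ≤ (j : ℕ)
      · have hij : (⟨i, hiM⟩ : Fin M) ≠ j := fun hc => by
          have := congrArg Fin.val hc; simp at this; omega
        obtain ⟨d, hd, hd'⟩ := plusBad_segment (B := plusIter j (B j) i) (ε := mixParam ε' ε j)
          (p := ε' j) (q := ε j) hij fun s hs => by
            have := h3 j hj s hs
            simpa only [plusIter, hiM, dif_pos] using this
        exact ⟨d, hd, fun _ => hd'⟩
      · exact ⟨1, one_pos, fun hc => absurd hc hj⟩
    choose d hd0 hd using hd
    obtain ⟨δ, hδ, hδ'⟩ := Finset.exists_pos_forall_le Finset.univ d fun j _ => hd0 j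
    set a : Fin M := ⟨i, hiM⟩ with ha
    obtain ⟨u, hu0, hu⟩ := exists_between (show (0 : ℝ) < min (min (ε a) η) (min (b a ε') δ) from
      lt_min (lt_min (hpos a) hη) (lt_min (hb0 a ε') hδ))
    have hu1 : u < ε a := hu.trans_le ((min_le_left _ _).trans (min_le_left _ _))
    have hu2 : u < η := hu.trans_le ((min_le_left _ _).trans (min_le_right _ _))
    have hu3 : u < b a ε' := hu.trans_le ((min_le_right _ _).trans (min_le_left _ _))
    have hu4 : u < δ := hu.trans_le ((min_le_right _ _).trans (min_le_right _ _))
    have hbk : ∀ k : Fin M, i ≤ k → b k (Function.update ε' a u) = b k ε' := fun k hk =>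
      hb k _ _ fun k' hk' => Function.update_of_ne (fun hc => by
        subst hc; rw [Fin.lt_def] at hk'; simp [ha] at hk'; omega) _ _
    refine ⟨Function.update ε' a u, fun k hk => ?_, fun k hk => ?_, fun j hj s hs => ?_⟩
    · rw [Function.update_of_ne (fun hc => by subst hc; simp [ha] at hk)]
      exact h1 k (by omega)
    · rw [hbk k hk]
      by_cases hka : k = a
      · subst hka
        rw [Function.update_self]
        exact ⟨hu0, hu1, hu2, hu3⟩
      · rw [Function.update_of_ne hka]
        exact h2 k (Nat.lt_of_le_of_ne hk fun hc => hka (Fin.ext hc.symm))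
    · by_cases hja : j = a
      · subst hja
        rw [Function.update_self] at hs
        have : Function.update (mixParam (Function.update ε' a u) ε a) a s =
            Function.update ε a s := by
          funext k
          by_cases hka : k = a
          · subst hka; simp
          · rw [Function.update_of_ne hka, Function.update_of_ne hka]
            simp only [mixParam, Function.update_of_ne hka]
            split_ifs with hlt
            · exact h1 k (by rw [Fin.lt_def] at hlt; simp [ha] at hlt; omega)
            · rfl
        rw [this]
        exact hgood a s ⟨hu0.trans_le hs.1, hs.2⟩
      · have hij : i + 1 ≤ (j : ℕ) := Nat.lt_of_le_of_ne hj fun hc => hja (Fin.ext hc.symm)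
        rw [Function.update_of_ne hja] at hs
        have : mixParam (Function.update ε' a u) ε j = Function.update (mixParam ε' ε j) a u := by
          funext k
          by_cases hka : k = a
          · subst hka
            have haj : a < j := hij
            simp only [mixParam, if_pos haj, Function.update_self]
          · simp [mixParam, Function.update_of_ne hka]
        rw [this]
        exact hd j hij u hu0 (hu4.trans_le (hδ' j (Finset.mem_univ j))) s hs
  obtain ⟨ε', -, h2, h3⟩ := key 0 (Nat.zero_le _)
  exact ⟨ε', fun k => h2 k (Nat.zero_le _), fun j s hs => hB j _ s (h3 j (Nat.zero_le _) s hs)⟩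

end Thresholds

section Limit
variable {Z : Type} [MetricSpace Z]

/-- Mutually inverse homotopy equivalences between `Y` and `Y'` controlled by `d`. -/
structure ControlledEquiv (Y Y' : Set Z) (d : ℝ) (F B : Z → Z) (Φ Ψ : Z × ℝ → Z) : Prop where
  contF : ContinuousOn F Y
  mapsF : MapsTo F Y Y'
  distF : ∀ y ∈ Y, dist (F y) y ≤ d
  contB : ContinuousOn B Y'
  mapsB : MapsTo B Y' Y
  distB : ∀ y ∈ Y', dist (B y) y ≤ d
  contΦ : ContinuousOn Φ (Y ×ˢ Icc 0 1)
  zeroΦ : ∀ y ∈ Y, Φ (y, 0) = y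
  oneΦ : ∀ y ∈ Y, Φ (y, 1) = B (F y)
  mapsΦ : ∀ y ∈ Y, ∀ τ ∈ Icc (0 : ℝ) 1, Φ (y, τ) ∈ Y
  distΦ : ∀ y ∈ Y, ∀ τ ∈ Icc (0 : ℝ) 1, dist (Φ (y, τ)) y ≤ d
  contΨ : ContinuousOn Ψ (Y' ×ˢ Icc 0 1)
  zeroΨ : ∀ y ∈ Y', Ψ (y, 0) = y
  oneΨ : ∀ y ∈ Y', Ψ (y, 1) = F (B y)
  mapsΨ : ∀ y ∈ Y', ∀ τ ∈ Icc (0 : ℝ) 1, Ψ (y, τ) ∈ Y'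
  distΨ : ∀ y ∈ Y', ∀ τ ∈ Icc (0 : ℝ) 1, dist (Ψ (y, τ)) y ≤ d

theorem ContinuousMap.homotopic_of_continuousOn {X : Type} [TopologicalSpace X] {T : Set Z}
    (f g : C(X, T)) (G : X × ℝ → Z) (hG : ContinuousOn G (univ ×ˢ Icc 0 1))
    (h0 : ∀ x, G (x, 0) = f x) (h1 : ∀ x, G (x, 1) = g x)
    (hT : ∀ x, ∀ τ ∈ Icc (0 : ℝ) 1, G (x, τ) ∈ T) : f.Homotopic g := by
  refine ⟨⟨⟨fun p => ⟨G (p.2, p.1), hT _ _ p.1.2⟩, ?_⟩, fun x => Subtype.ext (by simpa using h0 x),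
    fun x => Subtype.ext (by simpa using h1 x)⟩⟩
  refine Continuous.subtype_mk ?_ _
  have : Continuous fun p : unitInterval × X => (p.2, (p.1 : ℝ)) := by fun_prop
  exact hG.comp_continuous this fun p => ⟨mem_univ _, p.1.2⟩

/-- The composite `F (k + m - 1) ∘ ⋯ ∘ F k`. -/
def forwardIter (F : ℕ → Z → Z) (k : ℕ) : ℕ → Z → Z
  | 0, y => y
  | m + 1, y => F (k + m) (forwardIter F k m y)

/-- The composite `B k ∘ ⋯ ∘ B (k + m - 1)`. -/
def backwardIter (B : ℕ → Z → Z) (k : ℕ) : ℕ → Z → Z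
  | 0, w => w
  | m + 1, w => backwardIter B k m (B (k + m) w)

variable {Y : ℕ → Set Z} {F B : ℕ → Z → Z} {Φ Ψ : ℕ → Z × ℝ → Z}

theorem forwardIter_succ' (F : ℕ → Z → Z) (k m : ℕ) (y : Z) :
    forwardIter F k (m + 1) y = forwardIter F (k + 1) m (F k y) := by
  induction m with
  | zero => rfl
  | succ m ih =>
    rw [forwardIter, ih, forwardIter]
    congr 1; omega

theorem backwardIter_succ' (B : ℕ → Z → Z) (k m : ℕ) (w : Z) :
    backwardIter B k (m + 1) w = B k (backwardIter B (k + 1) m w) := by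
  induction m generalizing w with
  | zero => rfl
  | succ m ih =>
    rw [backwardIter, ih, backwardIter]
    congr 3; omega

theorem backwardIter_add (B : ℕ → Z → Z) (k m p : ℕ) (w : Z) :
    backwardIter B k (m + p) w = backwardIter B k m (backwardIter B (k + m) p w) := by
  induction p generalizing w with
  | zero => rfl
  | succ p ih =>
    rw [← add_assoc, backwardIter, ih, backwardIter]
    congr 3; omega

theorem forwardIter_mem
    (h : ∀ q, ControlledEquiv (Y q) (Y (q + 1)) ((1 / 2 : ℝ) ^ q) (F q) (B q) (Φ q) (Ψ q))
    (k m : ℕ) : MapsTo (forwardIter F k m) (Y k) (Y (k + m)) := by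
  intro y hy
  induction m with
  | zero => exact hy
  | succ m ih => exact (h (k + m)).mapsF ih

theorem forwardIter_continuousOn
    (h : ∀ q, ControlledEquiv (Y q) (Y (q + 1)) ((1 / 2 : ℝ) ^ q) (F q) (B q) (Φ q) (Ψ q))
    (k m : ℕ) : ContinuousOn (forwardIter F k m) (Y k) := by
  induction m with
  | zero => exact continuousOn_id
  | succ m ih => exact (h (k + m)).contF.comp ih (forwardIter_mem h k m)

theorem forwardIter_dist_succ
    (h : ∀ q, ControlledEquiv (Y q) (Y (q + 1)) ((1 / 2 : ℝ) ^ q) (F q) (B q) (Φ q) (Ψ q))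
    (k m : ℕ) {y : Z} (hy : y ∈ Y k) :
    dist (forwardIter F k m y) (forwardIter F k (m + 1) y) ≤ (1 / 2 : ℝ) ^ (k + m) := by
  rw [dist_comm]
  exact (h (k + m)).distF _ (forwardIter_mem h k m hy)

theorem backwardIter_mem
    (h : ∀ q, ControlledEquiv (Y q) (Y (q + 1)) ((1 / 2 : ℝ) ^ q) (F q) (B q) (Φ q) (Ψ q))
    (k m : ℕ) : MapsTo (backwardIter B k m) (Y (k + m)) (Y k) := by
  induction m with
  | zero => exact fun y hy => hy
  | succ m ih => exact fun y hy => ih ((h (k + m)).mapsB hy)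

theorem backwardIter_continuousOn
    (h : ∀ q, ControlledEquiv (Y q) (Y (q + 1)) ((1 / 2 : ℝ) ^ q) (F q) (B q) (Φ q) (Ψ q))
    (k m : ℕ) : ContinuousOn (backwardIter B k m) (Y (k + m)) := by
  induction m with
  | zero => exact continuousOn_id
  | succ m ih => exact ih.comp (h (k + m)).contB fun y hy => (h (k + m)).mapsB hy

theorem backwardIter_dist
    (h : ∀ q, ControlledEquiv (Y q) (Y (q + 1)) ((1 / 2 : ℝ) ^ q) (F q) (B q) (Φ q) (Ψ q))
    (k m : ℕ) {w : Z} (hw : w ∈ Y (k + m)) :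
    dist (backwardIter B k m w) w ≤ 2 * (1 / 2 : ℝ) ^ k - 2 * (1 / 2 : ℝ) ^ (k + m) := by
  induction m generalizing w with
  | zero => simp [backwardIter]
  | succ m ih =>
    have h1 := ih ((h (k + m)).mapsB hw)
    have h2 := (h (k + m)).distB w hw
    have h3 := dist_triangle (backwardIter B k m (B (k + m) w)) (B (k + m) w) w
    have h4 : (1 / 2 : ℝ) ^ (k + (m + 1)) = (1 / 2) ^ (k + m) / 2 := by rw [← add_assoc, pow_succ]; ring
    rw [backwardIter, h4]
    linarith

/-- Passing to the limit along a sequence of controlled homotopy equivalences. -/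
theorem homotopyEquiv_limit [CompleteSpace Z]
    (h : ∀ q, ControlledEquiv (Y q) (Y (q + 1)) ((1 / 2 : ℝ) ^ q) (F q) (B q) (Φ q) (Ψ q))
    {X : Set Z}
    (hX : ∀ (k : ℕ) (y : ℕ → Z) (z : Z), (∀ m, y m ∈ Y (k + m)) →
      (∀ m, y (m + 1) = F (k + m) (y m)) → Tendsto y atTop (𝓝 z) → z ∈ X)
    (hfix : ∀ x ∈ X, ∃ q₀, (∀ q ≥ q₀, x ∈ Y q ∧ B q x = x) ∧ ∀ k ≥ q₀, ∀ e > 0, ∃ δ > 0, ∃ Q,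
      ∀ m ≥ Q, ∀ w ∈ Y (k + m), dist w x < δ → dist (backwardIter B k m w) x < e) :
    Nonempty (ContinuousMap.HomotopyEquiv (Y 0) X) := by
  -- the forward limit
  have hβ : ∀ k, ∀ y ∈ Y k, ∃ z, Tendsto (fun m => forwardIter F k m y) atTop (𝓝 z) ∧
      ∀ m, dist (forwardIter F k m y) z ≤ 2 * (1 / 2 : ℝ) ^ (k + m) := by
    intro k y hy
    have hd : ∀ m, dist (forwardIter F k m y) (forwardIter F k (m + 1) y) ≤
        (2 * (1 / 2 : ℝ) ^ k) / 2 / 2 ^ m := fun m => by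
      refine (forwardIter_dist_succ h k m hy).trans_eq ?_
      rw [pow_add, one_div_pow 2 m]; ring
    obtain ⟨z, hz⟩ := cauchySeq_tendsto_of_complete (cauchySeq_of_le_geometric_two hd)
    refine ⟨z, hz, fun m => (dist_le_of_le_geometric_two_of_tendsto hd hz m).trans_eq ?_⟩
    rw [pow_add, one_div_pow 2 m]; ring
  have hβ' : ∀ k y, ∃ z, y ∈ Y k → Tendsto (fun m => forwardIter F k m y) atTop (𝓝 z) ∧
      ∀ m, dist (forwardIter F k m y) z ≤ 2 * (1 / 2 : ℝ) ^ (k + m) := fun k y => by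
    by_cases hy : y ∈ Y k
    · exact (hβ k y hy).imp fun z hz _ => hz
    · exact ⟨y, fun hc => absurd hc hy⟩
  choose β hβt using hβ'
  have hβlim := fun k y (hy : y ∈ Y k) => (hβt k y hy).1
  have hβd := fun k y (hy : y ∈ Y k) => (hβt k y hy).2
  have hβX : ∀ k, MapsTo (β k) (Y k) X := fun k y hy =>
    hX k _ _ (fun m => forwardIter_mem h k m hy) (fun m => rfl) (hβlim k y hy)
  have hβF : ∀ k, ∀ y ∈ Y k, β (k + 1) (F k y) = β k y := fun k y hy => by
    refine tendsto_nhds_unique (hβlim (k + 1) _ ((h k).mapsF hy)) ?_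
    exact ((hβlim k y hy).comp (tendsto_add_atTop_nat 1)).congr fun m => forwardIter_succ' F k m y
  have hpow : Tendsto (fun m : ℕ => 4 * (1 / 2 : ℝ) ^ m) atTop (𝓝 0) := by
    simpa using (tendsto_pow_atTop_nhds_zero_of_lt_one (show (0 : ℝ) ≤ 1 / 2 by norm_num)
      (by norm_num)).const_mul 4
  have hpowe : ∀ e > 0, ∃ N, ∀ m ≥ N, 4 * (1 / 2 : ℝ) ^ m < e := fun e he =>
    eventually_atTop.1 (hpow.eventually_lt_const he)
  have hpos : ∀ k : ℕ, (0 : ℝ) < (1 / 2) ^ k := fun k => by positivity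
  have hβcont : ∀ k, ContinuousOn (β k) (Y k) := by
    intro k
    refine (Metric.tendstoUniformlyOn_iff.2 fun e he => ?_ :
      TendstoUniformlyOn (fun m => forwardIter F k m) (β k) atTop (Y k)).continuousOn
        (Eventually.frequently (Eventually.of_forall fun m => forwardIter_continuousOn h k m))
    obtain ⟨N, hN⟩ := hpowe e he
    filter_upwards [eventually_ge_atTop N] with m hm y hy
    rw [dist_comm]
    have := hN (k + m) (by omega)
    linarith [hβd k y hy m, hpos (k + m)]
  -- the backward limit
  choose! q₀ hq₀ hq₁ using hfix
  have hBfix : ∀ x ∈ X, ∀ k, q₀ x ≤ k → ∀ m, backwardIter B k m x = x := fun x hx k hk m => by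
    induction m with
    | zero => rfl
    | succ m ih => rw [backwardIter, (hq₀ x hx (k + m) (by omega)).2, ih]
  obtain ⟨α, hα⟩ : ∃ α : ℕ → Z → Z, ∀ k, ∀ x ∈ X, ∀ m, q₀ x ≤ k + m →
      backwardIter B k m x = α k x := by
    refine ⟨fun k x => backwardIter B k (q₀ x) x, fun k x hx m hm => ?_⟩
    have key : ∀ m, q₀ x ≤ k + m → ∀ p, backwardIter B k (m + p) x = backwardIter B k m x :=
      fun m hm p => by rw [backwardIter_add, hBfix x hx _ hm]
    change _ = backwardIter B k (q₀ x) x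
    rw [← key m hm (q₀ x), ← key (q₀ x) (by omega) m, add_comm]
  have hαY : ∀ k, MapsTo (α k) X (Y k) := fun k x hx => by
    rw [← hα k x hx (q₀ x) (by omega)]
    exact backwardIter_mem h k _ (hq₀ x hx _ (by omega)).1
  have hαB : ∀ k, ∀ x ∈ X, B k (α (k + 1) x) = α k x := fun k x hx => by
    rw [← hα k x hx (q₀ x + 1) (by omega), ← hα (k + 1) x hx (q₀ x) (by omega), backwardIter_succ']
  have hαd : ∀ k, ∀ x ∈ X, dist (α k x) x ≤ 2 * (1 / 2 : ℝ) ^ k := fun k x hx => by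
    rw [← hα k x hx (q₀ x) (by omega)]
    linarith [backwardIter_dist h k (q₀ x) (hq₀ x hx _ (by omega)).1, hpos (k + q₀ x)]
  have hL : ∀ x ∈ X, ∀ k, ∀ e > 0, ∃ δ > 0, ∃ Q, ∀ m ≥ Q, ∀ w ∈ Y (k + m), dist w x < δ →
      dist (backwardIter B k m w) (α k x) < e := by
    intro x hx k e he
    have hxY := (hq₀ x hx (k + q₀ x) (by omega)).1
    obtain ⟨δ₁, hδ₁, h1⟩ := Metric.continuousOn_iff.1 (backwardIter_continuousOn h k (q₀ x)) x hxY e he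
    obtain ⟨δ, hδ, Q, hQ⟩ := hq₁ x hx (k + q₀ x) (by omega) δ₁ hδ₁
    refine ⟨δ, hδ, q₀ x + Q, fun m hm w hw hwx => ?_⟩
    obtain ⟨p, rfl⟩ := Nat.exists_eq_add_of_le (show q₀ x ≤ m by omega)
    have hw' : w ∈ Y (k + q₀ x + p) := by rwa [add_assoc]
    rw [backwardIter_add, ← hα k x hx (q₀ x) (by omega)]
    exact h1 _ (backwardIter_mem h _ _ hw') (hQ p (by omega) w hw' hwx)
  have hαcont : ∀ k, ContinuousOn (α k) X := by
    intro k
    refine Metric.continuousOn_iff.2 fun x hx e he => ?_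
    obtain ⟨δ, hδ, Q, hQ⟩ := hL x hx k e he
    refine ⟨δ, hδ, fun x' hx' hd => ?_⟩
    rw [← hα k x' hx' (Q + q₀ x') (by omega)]
    exact hQ _ (by omega) x' (hq₀ x' hx' _ (by omega)).1 hd
  let f : C(Y 0, X) := ⟨fun y => ⟨β 0 y, hβX 0 y.2⟩,
    Continuous.subtype_mk (continuousOn_iff_continuous_domRestrict.1 (hβcont 0)) _⟩
  let g : C(X, Y 0) := ⟨fun x => ⟨α 0 x, hαY 0 x.2⟩,
    Continuous.subtype_mk (continuousOn_iff_continuous_domRestrict.1 (hαcont 0)) _⟩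
  have hY0 : ∀ k, MapsTo (forwardIter F 0 k) (Y 0) (Y k) := fun k => by
    simpa using forwardIter_mem h 0 k
  have hB0 : ∀ k, MapsTo (backwardIter B 0 k) (Y k) (Y 0) := fun k => by
    simpa using backwardIter_mem h 0 k
  have hB0c : ∀ k, ContinuousOn (backwardIter B 0 k) (Y k) := fun k => by
    simpa using backwardIter_continuousOn h 0 k
  refine ⟨⟨f, g, ?_, ?_⟩⟩
  · -- `α 0 ∘ β 0` is homotopic to the identity
    obtain ⟨G, hG, hG0, hG1, hGv⟩ := exists_infinite_concat
      (fun k (p : Y 0 × ℝ) => backwardIter B 0 k (Φ k (forwardIter F 0 k p.1, p.2)))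
      (fun k => by
        refine (hB0c k).comp ((h k).contΦ.comp (ContinuousOn.prodMk ?_ continuousOn_snd) ?_) ?_
        · exact (forwardIter_continuousOn h 0 k).comp (by fun_prop) fun p _ => p.1.2
        · exact fun p hp => ⟨hY0 k p.1.2, hp.2⟩
        · exact fun p hp => (h k).mapsΦ _ (hY0 k p.1.2) _ hp.2)
      (fun k y => by
        rw [(h k).oneΦ _ (hY0 k y.2), (h (k + 1)).zeroΦ _ (hY0 _ y.2), backwardIter, forwardIter,
          zero_add])
      (fun y => α 0 (β 0 y))
      ((continuousOn_iff_continuous_domRestrict.1 ((hαcont 0).comp (hβcont 0) (hβX 0))))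
      (fun y U hU => by
        obtain ⟨e, he, heU⟩ := Metric.mem_nhds_iff.1 hU
        obtain ⟨δ, hδ, Q, hQ⟩ := hL (β 0 y) (hβX 0 y.2) 0 e he
        obtain ⟨N, hN⟩ := hpowe (δ / 2) (by linarith)
        have hc := continuousOn_iff_continuous_domRestrict.1 (hβcont 0)
        refine ⟨_, (Metric.continuous_iff'.1 hc y (δ / 2) (by linarith)), max N Q,
          fun k hk y' hy' τ hτ => heU ?_⟩
        have hyk := hY0 k y'.2
        refine hQ k ((le_max_right _ _).trans hk) _
          (by rw [zero_add]; exact (h k).mapsΦ _ hyk _ hτ) ?_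
        have h1 := (h k).distΦ _ hyk τ hτ
        have h2 := hβd 0 _ y'.2 k
        rw [zero_add] at h2
        have h3 : dist (β 0 y') (β 0 y) < δ / 2 := hy'
        have h4 := hN k ((le_max_left _ _).trans hk)
        have h5 := dist_triangle4 (Φ k (forwardIter F 0 k y', τ)) (forwardIter F 0 k y') (β 0 y')
          (β 0 y)
        linarith [hpos k])
    refine (ContinuousMap.homotopic_of_continuousOn _ _ G hG (fun y => ?_) (fun y => ?_)
      fun y τ hτ => ?_).symm
    · rw [hG0 y]
      exact (h 0).zeroΦ _ y.2
    · exact hG1 y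
    · rcases hGv y τ hτ with h1 | ⟨k, τ', hτ', h1⟩
      · rw [h1]; exact hαY 0 (hβX 0 y.2)
      · rw [h1]; exact hB0 k ((h k).mapsΦ _ (hY0 k y.2) _ hτ')
  · have hrev : ∀ τ ∈ Icc (0 : ℝ) 1, 1 - τ ∈ Icc (0 : ℝ) 1 := fun τ hτ =>
      ⟨by linarith [hτ.2], by linarith [hτ.1]⟩
    obtain ⟨G, hG, hG0, hG1, hGv⟩ := exists_infinite_concat
      (fun k (p : X × ℝ) => β (k + 1) (Ψ k (α (k + 1) p.1, 1 - p.2)))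
      (fun k => by
        refine (hβcont (k + 1)).comp ((h k).contΨ.comp (ContinuousOn.prodMk ?_ (by fun_prop)) ?_) ?_
        · exact (hαcont (k + 1)).comp (by fun_prop) fun p _ => p.1.2
        · exact fun p hp => ⟨hαY _ p.1.2, hrev _ hp.2⟩
        · exact fun p hp => (h k).mapsΨ _ (hαY _ p.1.2) _ (hrev _ hp.2))
      (fun k x => by
        have hx := hαY (k + 1) x.2
        rw [sub_self, (h k).zeroΨ _ hx, sub_zero, (h (k + 1)).oneΨ _ (hαY _ x.2), hαB _ _ x.2,
          hβF _ _ hx])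
      (fun x => (x : Z)) continuous_subtype_val
      (fun x U hU => by
        obtain ⟨e, he, heU⟩ := Metric.mem_nhds_iff.1 hU
        obtain ⟨N, hN⟩ := hpowe (e / 2) (by linarith)
        refine ⟨ball x (e / 2), ball_mem_nhds _ (by linarith), N, fun k hk x' hx' τ hτ => heU ?_⟩
        have hx1 := hαY (k + 1) x'.2
        have h1 := (h k).distΨ _ hx1 _ (hrev τ hτ)
        have h2 := hβd (k + 1) _ ((h k).mapsΨ _ hx1 _ (hrev τ hτ)) 0
        have h3 := hαd (k + 1) _ x'.2
        have h4 := hN k hk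
        have h5 : dist (x' : Z) x < e / 2 := hx'
        simp only [forwardIter, add_zero, pow_succ] at h2
        rw [dist_comm] at h2
        rw [pow_succ] at h3
        have h6 := dist_triangle4 (β (k + 1) (Ψ k (α (k + 1) x', 1 - τ)))
          (Ψ k (α (k + 1) x', 1 - τ)) (α (k + 1) x') x'
        have h7 := dist_triangle (β (k + 1) (Ψ k (α (k + 1) x', 1 - τ))) x' x
        rw [mem_ball]
        linarith [hpos k])
    refine ContinuousMap.homotopic_of_continuousOn _ _ G hG (fun x => ?_) (fun x => ?_)
      fun x τ hτ => ?_
    · rw [hG0 x]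
      change β 1 (Ψ 0 (α 1 x, 1 - 0)) = β 0 (α 0 x)
      rw [sub_zero, (h 0).oneΨ _ (hαY 1 x.2), hαB 0 _ x.2]
      exact hβF 0 _ (hαY 0 x.2)
    · exact hG1 x
    · rcases hGv x τ hτ with h1 | ⟨k, τ', hτ', h1⟩
      · rw [h1]; exact x.2
      · rw [h1]; exact hβX _ ((h k).mapsΨ _ (hαY _ x.2) _ (hrev _ hτ'))

end Limit

section Sequence
variable {S : RealStructure} {n M t : ℕ}

/-- A map preserving sufficiently many half-spaces moves points little, and finitely many level
sets can be preserved as well. -/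
theorem exists_constraint_list (f : Fin t → (Fin n → ℝ) → ℝ) (hf : ∀ i, DefMap S (f i))
    (hfc : ∀ i, Continuous (f i)) (R : ℝ) {d : ℝ} (hd : 0 < d) (C : Finset ℝ) :
    ∃ l : List (Set (Fin n → ℝ)), (∀ Q ∈ l, IsClosed Q ∧ DefP S fun x => x ∈ Q) ∧
      (∀ x ∈ closedBall 0 R, ∀ y, (∀ Q ∈ l, x ∈ Q → y ∈ Q) → dist y x ≤ d) ∧
      ∀ c ∈ C, ∀ i, {x | f i x ≤ c} ∈ l ∧ {x | c ≤ f i x} ∈ l ∧ {x | f i x ≤ -c} ∈ l ∧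
        {x | -c ≤ f i x} ∈ l := by
  classical
  let T : ℤ := ⌈R / d⌉ + 1
  let G : Set (Set (Fin n → ℝ)) :=
    (range fun p : Fin n × Finset.Icc (-T) T => {x : Fin n → ℝ | x p.1 ≤ (p.2 : ℤ) * d}) ∪
    (range fun p : Fin n × Finset.Icc (-T) T => {x : Fin n → ℝ | (p.2 : ℤ) * d ≤ x p.1}) ∪
    (range fun p : Fin t × C => {x | f p.1 x ≤ p.2}) ∪
    (range fun p : Fin t × C => {x | p.2 ≤ f p.1 x}) ∪
    (range fun p : Fin t × C => {x | f p.1 x ≤ -p.2}) ∪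
    (range fun p : Fin t × C => {x | -p.2 ≤ f p.1 x})
  have hG : G.Finite := by
    refine Set.Finite.union (Set.Finite.union (Set.Finite.union (Set.Finite.union
      (Set.Finite.union ?_ ?_) ?_) ?_) ?_) ?_ <;> exact Set.finite_range _
  have hmem : ∀ Q, Q ∈ hG.toFinset.toList ↔ Q ∈ G := fun Q => by simp
  refine ⟨hG.toFinset.toList, fun Q hQ => ?_, fun x hx y hxy => ?_, fun c hc i => ?_⟩
  · rw [hmem] at hQ
    rcases hQ with ((((⟨p, rfl⟩ | ⟨p, rfl⟩) | ⟨p, rfl⟩) | ⟨p, rfl⟩) | ⟨p, rfl⟩) | ⟨p, rfl⟩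
    · exact ⟨isClosed_le (continuous_apply _) continuous_const,
        DefP.le (DefMap.apply (by fun_prop) _) (by fun_prop)⟩
    · exact ⟨isClosed_le continuous_const (continuous_apply _),
        DefP.le (by fun_prop) (DefMap.apply (by fun_prop) _)⟩
    · exact ⟨isClosed_le (hfc _) continuous_const, DefP.le (hf _) (by fun_prop)⟩
    · exact ⟨isClosed_le continuous_const (hfc _), DefP.le (by fun_prop) (hf _)⟩
    · exact ⟨isClosed_le (hfc _) continuous_const, DefP.le (hf _) (by fun_prop)⟩
    · exact ⟨isClosed_le continuous_const (hfc _), DefP.le (by fun_prop) (hf _)⟩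
  · refine (dist_pi_le_iff hd.le).2 fun i => ?_
    have hxi : |x i| ≤ R := by
      have h1 := norm_le_pi_norm x i
      rw [mem_closedBall, dist_zero_right] at hx
      exact h1.trans hx
    rw [abs_le] at hxi
    set z : ℤ := ⌊x i / d⌋ with hz
    have h1 : (z : ℝ) * d ≤ x i := by
      have := Int.floor_le (x i / d)
      rwa [le_div_iff₀ hd] at this
    have h2 : x i ≤ ((z + 1 : ℤ) : ℝ) * d := by
      have := Int.lt_floor_add_one (x i / d)
      rw [div_lt_iff₀ hd] at this
      push_cast
      exact this.le
    have hR : R / d ≤ ⌈R / d⌉ := Int.le_ceil _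
    have hzT : -T ≤ z := by
      refine Int.le_floor.2 ?_
      rw [le_div_iff₀ hd]
      rw [div_le_iff₀ hd] at hR
      push_cast [T]
      nlinarith
    have hzT' : z + 1 ≤ T := by
      have h3 : (z : ℝ) ≤ R / d := (Int.floor_le _).trans (by gcongr; exact hxi.2)
      have h4 : z ≤ ⌈R / d⌉ := by exact_mod_cast h3.trans hR
      simp only [T]; omega
    have h3 := hxy {x | (z : ℝ) * d ≤ x i} ((hmem _).2 (Or.inl (Or.inl (Or.inl (Or.inl (Or.inr
      ⟨(i, ⟨z, Finset.mem_Icc.2 ⟨hzT, by omega⟩⟩), rfl⟩)))))) h1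
    have h4 := hxy {x | x i ≤ ((z + 1 : ℤ) : ℝ) * d} ((hmem _).2 (Or.inl (Or.inl (Or.inl (Or.inl (Or.inl
      ⟨(i, ⟨z + 1, Finset.mem_Icc.2 ⟨by omega, hzT'⟩⟩), rfl⟩)))))) h2
    have h3 : (z : ℝ) * d ≤ y i := h3
    have h4 : y i ≤ ((z + 1 : ℤ) : ℝ) * d := h4
    push_cast at h2 h4
    rw [Real.dist_eq, abs_le]
    constructor <;> linarith
  · simp only [hmem]
    exact ⟨Or.inl (Or.inl (Or.inl (Or.inr ⟨(i, ⟨c, hc⟩), rfl⟩))),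
      Or.inl (Or.inl (Or.inr ⟨(i, ⟨c, hc⟩), rfl⟩)), Or.inl (Or.inr ⟨(i, ⟨c, hc⟩), rfl⟩),
      Or.inr ⟨(i, ⟨c, hc⟩), rfl⟩⟩

/-- The maps of a controlled equivalence fix the common points and preserve the sets in `l`. -/
structure PreservesList (l : List (Set (Fin n → ℝ))) (Y Y' : Set (Fin n → ℝ))
    (F B : (Fin n → ℝ) → Fin n → ℝ) : Prop where
  fixF : ∀ y ∈ Y, y ∈ Y' → F y = y
  fixB : ∀ y ∈ Y, y ∈ Y' → B y = y
  presF : ∀ y ∈ Y, ∀ Q ∈ l, y ∈ Q → F y ∈ Q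
  presB : ∀ y ∈ Y', ∀ Q ∈ l, y ∈ Q → B y ∈ Q

theorem Deform.exists_controlledEquiv_of_subset {l : List (Set (Fin n → ℝ))} {Y Y' : Set (Fin n → ℝ)}
    {R d : ℝ} (hd : 0 ≤ d) (hR : Y ⊆ closedBall 0 R)
    (hl : ∀ x ∈ closedBall 0 R, ∀ y, (∀ Q ∈ l, x ∈ Q → y ∈ Q) → dist y x ≤ d)
    (hs : Y' ⊆ Y) (h : Deform l Y Y') :
    ∃ F B Φ Ψ, ControlledEquiv Y Y' d F B Φ Ψ ∧ PreservesList l Y Y' F B := by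
  obtain ⟨h, hc, H⟩ := h
  have h1 : (1 : ℝ) ∈ Icc (0 : ℝ) 1 := ⟨zero_le_one, le_rfl⟩
  have hdist : ∀ y ∈ Y, ∀ τ ∈ Icc (0 : ℝ) 1, dist (h (y, τ)) y ≤ d := fun y hy τ hτ =>
    hl y (hR hy) _ ((H y hy).2.2 τ hτ).2.2
  refine ⟨fun y => h (y, 1), fun y => y, h, Prod.fst, ?_, ?_⟩
  · exact {
      contF := hc.comp (by fun_prop) fun y hy => ⟨hy, h1⟩
      mapsF := fun y hy => (H y hy).2.1
      distF := fun y hy => hdist y hy 1 h1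
      contB := continuousOn_id
      mapsB := hs
      distB := fun y _ => by rwa [dist_self]
      contΦ := hc
      zeroΦ := fun y hy => (H y hy).1
      oneΦ := fun y hy => rfl
      mapsΦ := fun y hy τ hτ => ((H y hy).2.2 τ hτ).1
      distΦ := hdist
      contΨ := continuousOn_fst
      zeroΨ := fun y _ => rfl
      oneΨ := fun y hy => (((H y (hs hy)).2.2 1 h1).2.1 hy).symm
      mapsΨ := fun y hy _ _ => hy
      distΨ := fun y _ _ _ => by rwa [dist_self] }
  · exact {
      fixF := fun y hy hy' => ((H y hy).2.2 1 h1).2.1 hy'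
      fixB := fun _ _ _ => rfl
      presF := fun y hy Q hQ => ((H y hy).2.2 1 h1).2.2 Q hQ
      presB := fun _ _ _ _ => id }

theorem ControlledEquiv.symm {Z : Type} [MetricSpace Z] {Y Y' : Set Z} {d : ℝ} {F B : Z → Z}
    {Φ Ψ : Z × ℝ → Z} (h : ControlledEquiv Y Y' d F B Φ Ψ) : ControlledEquiv Y' Y d B F Ψ Φ :=
  ⟨h.contB, h.mapsB, h.distB, h.contF, h.mapsF, h.distF, h.contΨ, h.zeroΨ, h.oneΨ, h.mapsΨ,
    h.distΨ, h.contΦ, h.zeroΦ, h.oneΦ, h.mapsΦ, h.distΦ⟩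

theorem Deform.exists_controlledEquiv_of_superset {l : List (Set (Fin n → ℝ))}
    {Y Y' : Set (Fin n → ℝ)} {R d : ℝ} (hd : 0 ≤ d) (hR : Y' ⊆ closedBall 0 R)
    (hl : ∀ x ∈ closedBall 0 R, ∀ y, (∀ Q ∈ l, x ∈ Q → y ∈ Q) → dist y x ≤ d)
    (hs : Y ⊆ Y') (h : Deform l Y' Y) :
    ∃ F B Φ Ψ, ControlledEquiv Y Y' d F B Φ Ψ ∧ PreservesList l Y Y' F B := by
  obtain ⟨F, B, Φ, Ψ, h1, h2⟩ := Deform.exists_controlledEquiv_of_subset hd hR hl hs h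
  exact ⟨B, F, Ψ, Φ, h1.symm, fun y hy hy' => h2.fixB y hy' hy, fun y hy hy' => h2.fixF y hy' hy,
    h2.presB, h2.presF⟩

theorem RealStructure.IsOMinimal.exists_param_seq (hS : S.IsOMinimal)
    {K : (Fin M → ℝ) → Set (Fin n → ℝ)} (hK : DefFam S K) (hc : ∀ p, IsCompact (K p)) {R : ℝ}
    (hR : ∀ ε, K ε ⊆ closedBall 0 R) (L : ℕ → Finset ℝ → List (Set (Fin n → ℝ)))
    (hL : ∀ k C, ∀ Q ∈ L k C, IsClosed Q ∧ DefP S fun x => x ∈ Q) :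
    ∃ b : Fin M → (Fin M → ℝ) → ℝ, (∀ j, DefMap S (b j)) ∧
      (∀ j (ε ε' : Fin M → ℝ), (∀ k, j < k → ε k = ε' k) → b j ε = b j ε') ∧
      (∀ j ε, 0 < b j ε ∧ b j ε ≤ 1) ∧
      ∀ ε, (∀ j, 0 < ε j ∧ ε j < b j ε) → ∃ E : ℕ → Fin M → ℝ, E 0 = ε ∧ (∀ k j, 0 < E k j) ∧
        (∀ k i j, E (k + 1) i < E k j) ∧ (∀ k j, E (k + 1) j < (1 / 2 : ℝ) ^ k) ∧
        ∀ k, ∃ C : Finset ℝ, (∀ i < k, ∀ j, E i j ∈ C) ∧ ∀ j, ∀ s ∈ Icc (E (k + 1) j) (E k j),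
          TameAtL (L k C) (fun s => K (Function.update (mixParam (E (k + 1)) (E k) j) j s)) s := by
  classical
  choose b hb1 hb2 hb3 hb4 using fun k C => hS.exists_thresholds (L k C) (hL k C) hK hc hR
  refine ⟨b 0 ∅, hb1 0 ∅, hb2 0 ∅, hb3 0 ∅, fun ε hε => ?_⟩
  let St := {p : ℕ × (Fin M → ℝ) × Finset ℝ // GoodParam (L p.1 p.2.2) K p.2.1}
  have hnext : ∀ p : St, ∃ p' : St, p'.1.1 = p.1.1 + 1 ∧
      p'.1.2.2 = p.1.2.2 ∪ Finset.univ.image p.1.2.1 ∧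
      (∀ i j, p'.1.2.1 i < p.1.2.1 j) ∧ (∀ i, p'.1.2.1 i < (1 / 2 : ℝ) ^ p.1.1) ∧
      ∀ j, ∀ s ∈ Icc (p'.1.2.1 j) (p.1.2.1 j), TameAtL (L p.1.1 p.1.2.2)
        (fun s => K (Function.update (mixParam p'.1.2.1 p.1.2.1 j) j s)) s := by
    rintro ⟨⟨k, ε, C⟩, h⟩
    obtain ⟨e, he, he'⟩ := Finset.exists_pos_forall_le Finset.univ ε fun j _ => h.1 j
    set C' := C ∪ Finset.univ.image ε
    obtain ⟨ε', h1, h2⟩ := h.exists_next (hb2 (k + 1) C') (fun j ε => (hb3 (k + 1) C' j ε).1)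
      (η := min e ((1 / 2) ^ k)) (by positivity)
    refine ⟨⟨(k + 1, ε', C'), hb4 _ _ _ fun j => ⟨(h1 j).1, (h1 j).2.2.2⟩⟩, rfl, rfl,
      fun i j => ?_, fun i => ?_, h2⟩
    · exact (h1 i).2.2.1.trans_le ((min_le_left _ _).trans (he' j (Finset.mem_univ j)))
    · exact (h1 i).2.2.1.trans_le (min_le_right _ _)
  choose nx hn1 hn2 hn3 hn4 hn5 using hnext
  let s : ℕ → St := fun k => nx^[k] ⟨(0, ε, ∅), hb4 0 ∅ ε hε⟩
  have hs : ∀ k, s (k + 1) = nx (s k) := fun k => Function.iterate_succ_apply' _ _ _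
  have hsk : ∀ k, (s k).1.1 = k := fun k => by
    induction k with
    | zero => rfl
    | succ k ih => rw [hs, hn1, ih]
  have hsC : ∀ k, ∀ i < k, ∀ j, (s i).1.2.1 j ∈ (s k).1.2.2 := fun k => by
    induction k with
    | zero => exact fun i hi => absurd hi (Nat.not_lt_zero _)
    | succ k ih =>
      intro i hi j
      rw [hs, hn2, Finset.mem_union]
      rcases Nat.lt_succ_iff_lt_or_eq.1 hi with h | rfl
      · exact Or.inl (ih i h j)
      · exact Or.inr (Finset.mem_image_of_mem _ (Finset.mem_univ j))
  refine ⟨fun k => (s k).1.2.1, rfl, fun k => (s k).2.1, fun k i j => ?_, fun k j => ?_,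
    fun k => ⟨(s k).1.2.2, hsC k, fun j u hu => ?_⟩⟩
  · simp only [hs]; exact hn3 _ _ _
  · simp only [hs]; have := hn4 (s k) j; rwa [hsk] at this
  · simp only [hs] at hu ⊢; have := hn5 (s k) j u hu; rwa [hsk] at this

/-- The parameter after `q` single-coordinate changes in the round-robin from `E k` to
`E (k + 1)`. -/
def stepParam (E : ℕ → Fin M → ℝ) (q : ℕ) : Fin M → ℝ :=
  fun a => if (a : ℕ) < q % M then E (q / M + 1) a else E (q / M) a

theorem stepParam_zero (E : ℕ → Fin M → ℝ) : stepParam E 0 = E 0 := by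
  funext a
  simp [stepParam]

theorem stepParam_eq_update (E : ℕ → Fin M → ℝ) (q : ℕ) (h : q % M < M) :
    stepParam E q = Function.update (mixParam (E (q / M + 1)) (E (q / M)) ⟨q % M, h⟩) ⟨q % M, h⟩
      (E (q / M) ⟨q % M, h⟩) := by
  funext a
  by_cases ha : a = ⟨q % M, h⟩
  · subst ha; simp [stepParam]
  · rw [Function.update_of_ne ha]; rfl

theorem stepParam_succ (E : ℕ → Fin M → ℝ) (q : ℕ) (h : q % M < M) :
    stepParam E (q + 1) = Function.update (mixParam (E (q / M + 1)) (E (q / M)) ⟨q % M, h⟩)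
      ⟨q % M, h⟩ (E (q / M + 1) ⟨q % M, h⟩) := by
  funext a
  have hM : 0 < M := by omega
  have haM := a.2
  have hq := Nat.div_add_mod q M
  by_cases hl : q % M + 1 < M
  · have h1 : (q + 1) % M = q % M + 1 := by
      rw [Nat.add_mod, Nat.mod_eq_of_lt (show 1 < M by omega), Nat.mod_eq_of_lt hl]
    have h2 : (q + 1) / M = q / M := by
      rw [Nat.succ_div, if_neg (fun hd => by rw [Nat.dvd_iff_mod_eq_zero, h1] at hd; omega), add_zero]
    by_cases ha : a = ⟨q % M, h⟩
    · subst ha; simp [stepParam, h1, h2]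
    · have ha' : (a : ℕ) ≠ q % M := fun hc => ha (Fin.ext hc)
      rw [Function.update_of_ne ha]
      simp only [stepParam, mixParam, h1, h2, Fin.lt_def]
      by_cases hlt : (a : ℕ) < q % M
      · rw [if_pos hlt, if_pos (by omega)]
      · rw [if_neg hlt, if_neg (by omega)]
  · have hqM : q % M + 1 = M := by omega
    have hq1 : q + 1 = M * (q / M + 1) := by rw [mul_add, mul_one]; omega
    have h1 : (q + 1) % M = 0 := by rw [hq1, Nat.mul_mod_right]
    have h2 : (q + 1) / M = q / M + 1 := by rw [hq1, Nat.mul_div_cancel_left _ hM]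
    by_cases ha : a = ⟨q % M, h⟩
    · subst ha; simp [stepParam, h1, h2]
    · have ha' : (a : ℕ) ≠ q % M := fun hc => ha (Fin.ext hc)
      rw [Function.update_of_ne ha]
      simp only [stepParam, mixParam, h1, h2, Fin.lt_def]
      rw [if_neg (by omega), if_pos (by omega)]

theorem stepParam_succ_of_ne (E : ℕ → Fin M → ℝ) (q : ℕ) (a : Fin M) (ha : (a : ℕ) ≠ q % M) :
    stepParam E (q + 1) a = stepParam E q a := by
  have h : q % M < M := Nat.mod_lt _ (by have := a.2; omega)
  have ha' : a ≠ ⟨q % M, h⟩ := fun hc => ha (congrArg Fin.val hc)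
  rw [stepParam_succ E q h, stepParam_eq_update E q h, Function.update_of_ne ha',
    Function.update_of_ne ha']

theorem RealStructure.IsOMinimal.exists_controlled_seq (hS : S.IsOMinimal) (hM : 0 < M)
    {K : (Fin M → ℝ) → Set (Fin n → ℝ)} (hK : DefFam S K) (hc : ∀ p, IsCompact (K p)) {R : ℝ}
    (hR : ∀ ε, K ε ⊆ closedBall 0 R)
    (hmono : ∀ j : Fin M, (∀ ε, Monotone fun s => K (Function.update ε j s)) ∨
      ∀ ε, Antitone fun s => K (Function.update ε j s))
    (f : Fin t → (Fin n → ℝ) → ℝ) (hf : ∀ i, DefMap S (f i)) (hfc : ∀ i, Continuous (f i)) :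
    ∃ b : Fin M → (Fin M → ℝ) → ℝ, (∀ j, DefMap S (b j)) ∧
      (∀ j (ε ε' : Fin M → ℝ), (∀ k, j < k → ε k = ε' k) → b j ε = b j ε') ∧
      (∀ j ε, 0 < b j ε ∧ b j ε ≤ 1) ∧
      ∀ ε, (∀ j, 0 < ε j ∧ ε j < b j ε) → ∃ E : ℕ → Fin M → ℝ, E 0 = ε ∧ (∀ k j, 0 < E k j) ∧
        (∀ k i j, E (k + 1) i < E k j) ∧ (∀ k j, E (k + 1) j < (1 / 2 : ℝ) ^ k) ∧
        ∃ (F B : ℕ → (Fin n → ℝ) → Fin n → ℝ) (Φ Ψ : ℕ → (Fin n → ℝ) × ℝ → Fin n → ℝ),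
          ∀ q, ControlledEquiv (K (stepParam E q)) (K (stepParam E (q + 1)))
            ((1 / 2 : ℝ) ^ q) (F q) (B q) (Φ q) (Ψ q) ∧
          ∃ l, PreservesList l (K (stepParam E q)) (K (stepParam E (q + 1))) (F q) (B q) ∧
            ∀ r < q / M, ∀ j i, {x | f i x ≤ E r j} ∈ l ∧ {x | E r j ≤ f i x} ∈ l ∧
              {x | f i x ≤ -E r j} ∈ l ∧ {x | -E r j ≤ f i x} ∈ l := by
  choose L hL1 hL2 hL3 using fun (k : ℕ) (C : Finset ℝ) =>
    exists_constraint_list (S := S) f hf hfc R (show (0 : ℝ) < (1 / 2) ^ ((k + 1) * M) by positivity) C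
  obtain ⟨b, hb1, hb2, hb3, hb4⟩ := hS.exists_param_seq hK hc hR L hL1
  refine ⟨b, hb1, hb2, hb3, fun ε hε => ?_⟩
  obtain ⟨E, hE0, hE1, hE2, hE3, hE4⟩ := hb4 ε hε
  refine ⟨E, hE0, hE1, hE2, hE3, ?_⟩
  have key : ∀ q, ∃ F B Φ Ψ, ControlledEquiv (K (stepParam E q)) (K (stepParam E (q + 1)))
      ((1 / 2 : ℝ) ^ q) F B Φ Ψ ∧
      ∃ l, PreservesList l (K (stepParam E q)) (K (stepParam E (q + 1))) F B ∧
        ∀ r < q / M, ∀ j i, {x | f i x ≤ E r j} ∈ l ∧ {x | E r j ≤ f i x} ∈ l ∧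
          {x | f i x ≤ -E r j} ∈ l ∧ {x | -E r j ≤ f i x} ∈ l := by
    intro q
    have h : q % M < M := Nat.mod_lt _ hM
    obtain ⟨C, hC1, hC2⟩ := hE4 (q / M)
    have htame := hC2 ⟨q % M, h⟩
    rw [stepParam_succ E q h, stepParam_eq_update E q h]
    set P := mixParam (E (q / M + 1)) (E (q / M)) ⟨q % M, h⟩
    have hle : E (q / M + 1) ⟨q % M, h⟩ ≤ E (q / M) ⟨q % M, h⟩ := (hE2 _ _ _).le
    have hcl : ∀ Q ∈ L (q / M) C, IsClosed Q := fun Q hQ => (hL1 _ _ Q hQ).1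
    have hdq : (1 / 2 : ℝ) ^ ((q / M + 1) * M) ≤ (1 / 2) ^ q := by
      refine pow_le_pow_of_le_one (by norm_num) (by norm_num) ?_
      have := Nat.div_add_mod q M
      rw [add_mul, one_mul, mul_comm]; omega
    have hdist : ∀ x ∈ closedBall 0 R, ∀ y, (∀ Q ∈ L (q / M) C, x ∈ Q → y ∈ Q) →
        dist y x ≤ (1 / 2 : ℝ) ^ q := fun x hx y hy => (hL2 _ C x hx y hy).trans hdq
    rcases hmono ⟨q % M, h⟩ with hm | hm
    · obtain ⟨F, B, Φ, Ψ, h1, h2⟩ := Deform.exists_controlledEquiv_of_subset (by positivity) (hR _)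
        hdist (hm P hle) (deform_of_monotone hcl hle (fun s _ => (hc _).isClosed) (fun s _ => hR _)
          htame ((hm P).monotoneOn _))
      exact ⟨F, B, Φ, Ψ, h1, _, h2, fun r hr j i => hL3 _ C _ (hC1 r hr j) i⟩
    · obtain ⟨F, B, Φ, Ψ, h1, h2⟩ := Deform.exists_controlledEquiv_of_superset (by positivity) (hR _)
        hdist (hm P hle) (deform_of_antitone hcl hle (fun s _ => (hc _).isClosed) (fun s _ => hR _)
          htame ((hm P).antitoneOn _))
      exact ⟨F, B, Φ, Ψ, h1, _, h2, fun r hr j i => hL3 _ C _ (hC1 r hr j) i⟩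
  choose F B Φ Ψ h1 h2 using key
  exact ⟨F, B, Φ, Ψ, fun q => ⟨h1 q, h2 q⟩⟩

end Sequence

section SignSets
variable {S : RealStructure} {n t : ℕ} {f : Fin t → (Fin n → ℝ) → ℝ}

theorem FGFormula.eval_defP (hf : ∀ i, DefMap S (f i)) (φ : FGFormula t) :
    DefP S fun x => x ∈ φ.eval n 0 f Fin.elim0 := by
  induction φ with
  | eq i => exact (DefP.forall_finite fun l => l.elim0).and (DefP.eq (hf i) (by fun_prop))
  | ge i => exact (DefP.forall_finite fun l => l.elim0).and (DefP.le (by fun_prop) (hf i))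
  | le i => exact (DefP.forall_finite fun l => l.elim0).and (DefP.le (hf i) (by fun_prop))
  | and φ ψ h1 h2 => exact h1.and h2
  | or φ ψ h1 h2 => exact h1.or h2

theorem FGFormula.eval_isClosed (hf : ∀ i, Continuous (f i)) (φ : FGFormula t) :
    IsClosed (φ.eval n 0 f Fin.elim0) := by
  induction φ with
  | eq i =>
    simpa [FGFormula.eval] using isClosed_eq (hf i) continuous_const
  | ge i =>
    simpa [FGFormula.eval] using isClosed_le continuous_const (hf i)
  | le i =>
    simpa [FGFormula.eval] using isClosed_le (hf i) continuous_const
  | and φ ψ h1 h2 => exact h1.inter h2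
  | or φ ψ h1 h2 => exact h1.union h2

theorem FGFormula.mem_eval_of_sign_eq (φ : FGFormula t) {x y : Fin n → ℝ}
    (h : ∀ i, SignType.sign (f i y) = SignType.sign (f i x)) (hx : x ∈ φ.eval n 0 f Fin.elim0) :
    y ∈ φ.eval n 0 f Fin.elim0 := by
  induction φ with
  | eq i =>
    refine ⟨fun l => l.elim0, ?_⟩
    rw [← sign_eq_zero_iff, h, sign_eq_zero_iff]
    exact hx.2
  | ge i =>
    refine ⟨fun l => l.elim0, ?_⟩
    rw [← sign_nonneg_iff, h, sign_nonneg_iff]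
    exact hx.2
  | le i =>
    refine ⟨fun l => l.elim0, ?_⟩
    rw [← sign_nonpos_iff, h, sign_nonpos_iff]
    exact hx.2
  | and φ ψ h1 h2 => exact ⟨h1 hx.1, h2 hx.2⟩
  | or φ ψ h1 h2 => exact hx.imp h1 h2

/-- Extension of a finite parameter vector by zero. -/
def extendParam {M : ℕ} (ε : Fin M → ℝ) : ℕ → ℝ := fun j => if h : j < M then ε ⟨j, h⟩ else 0

theorem levelOf_le (σ : Fin t → SignType) : levelOf σ ≤ t :=
  (Finset.card_le_univ _).trans_eq (Fintype.card_fin t)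

theorem levelOf_pos {σ : Fin t → SignType} {i : Fin t} (h : σ i = 0) : 0 < levelOf σ :=
  Finset.card_pos.2 ⟨i, Finset.mem_filter.2 ⟨Finset.mem_univ i, h⟩⟩

variable {Sset : Set (Fin n → ℝ)} {SIGNS Sig : Set (Fin t → SignType)}

theorem RealiCp_mono {e e' : ℕ → ℝ} {σ : Fin t → SignType}
    (h : 0 < levelOf σ → e (2 * levelOf σ) ≤ e' (2 * levelOf σ)) :
    RealiCp n f Sset e σ ⊆ RealiCp n f Sset e' σ := fun _ hx =>
  ⟨hx.1, fun i => ⟨fun hi => ((hx.2 i).1 hi).trans (h (levelOf_pos hi)), (hx.2 i).2⟩⟩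

theorem RealiOp_mono {e e' : ℕ → ℝ} {σ : Fin t → SignType}
    (h : 0 < levelOf σ → e (2 * levelOf σ - 1) ≤ e' (2 * levelOf σ - 1)) :
    RealiOp n f Sset e σ ⊆ RealiOp n f Sset e' σ := fun _ hx =>
  ⟨hx.1, fun i => ⟨fun hi => ((hx.2 i).1 hi).trans_le (h (levelOf_pos hi)), (hx.2 i).2⟩⟩

/-- The points lying in a thickening of some `σ ∈ Sig` that is not removed afterwards. -/
def thickSet (n : ℕ) {t : ℕ} (f : Fin t → (Fin n → ℝ) → ℝ) (Sset : Set (Fin n → ℝ))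
    (SIGNS Sig : Set (Fin t → SignType)) (e : ℕ → ℝ) : Set (Fin n → ℝ) :=
  {x | ∃ σ, σ ∈ Sig ∧ x ∈ RealiCp n f Sset e σ ∧ ∀ τ, τ ∈ SIGNS ∧ τ ∉ Sig ∧
    levelOf σ ≤ levelOf τ → x ∉ RealiOp n f Sset e τ}

theorem thickSet_subset (e : ℕ → ℝ) : thickSet n f Sset SIGNS Sig e ⊆ Sset :=
  fun _ ⟨_, _, hx, _⟩ => hx.1

theorem thickSet_mono {e e' : ℕ → ℝ} (h : ∀ m, 0 < m → m ≤ t → e (2 * m) ≤ e' (2 * m))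
    (h' : ∀ m, 0 < m → m ≤ t → e' (2 * m - 1) ≤ e (2 * m - 1)) :
    thickSet n f Sset SIGNS Sig e ⊆ thickSet n f Sset SIGNS Sig e' := by
  rintro x ⟨σ, h1, h2, h3⟩
  exact ⟨σ, h1, RealiCp_mono (fun hp => h _ hp (levelOf_le σ)) h2, fun τ hτ hx =>
    h3 τ hτ (RealiOp_mono (fun hp => h' _ hp (levelOf_le τ)) hx)⟩

theorem isClosed_thickSet (hf : ∀ i, Continuous (f i)) (hs : IsClosed Sset) (e : ℕ → ℝ) :
    IsClosed (thickSet n f Sset SIGNS Sig e) := by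
  have hC : ∀ σ, IsClosed (RealiCp n f Sset e σ) := fun σ => by
    refine hs.inter ?_
    simp only [Set.ofPred_forall, Set.ofPred_and]
    refine isClosed_iInter fun i => ?_
    refine IsClosed.inter ?_ (IsClosed.inter ?_ ?_) <;> refine isClosed_iInter fun _ => ?_
    · exact isClosed_le (hf i).abs continuous_const
    · exact isClosed_le continuous_const (hf i)
    · exact isClosed_le (hf i) continuous_const
  have hO : ∀ σ, IsClosed (Sset \ RealiOp n f Sset e σ) := fun σ => by
    have : Sset \ RealiOp n f Sset e σ = Sset ∩ {x | ∀ i, (σ i = 0 → |f i x| < e (2 * levelOf σ - 1)) ∧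
      (σ i = 1 → 0 < f i x) ∧ (σ i = -1 → f i x < 0)}ᶜ := by
      ext x; simp only [RealiOp, Set.mem_sdiff, mem_inter_iff, mem_compl_iff]; tauto
    rw [this]
    refine hs.inter (isClosed_compl_iff.2 ?_)
    simp only [Set.ofPred_forall, Set.ofPred_and]
    refine isOpen_iInter_of_finite fun i => ?_
    refine IsOpen.inter ?_ (IsOpen.inter ?_ ?_) <;> refine isOpen_iInter_of_finite fun _ => ?_
    · exact isOpen_lt (hf i).abs continuous_const
    · exact isOpen_lt continuous_const (hf i)
    · exact isOpen_lt (hf i) continuous_const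
  have : thickSet n f Sset SIGNS Sig e = ⋃ σ : Sig, (RealiCp n f Sset e σ ∩
      ⋂ τ : {τ // τ ∈ SIGNS ∧ τ ∉ Sig ∧ levelOf σ.1 ≤ levelOf τ}, Sset \ RealiOp n f Sset e τ) := by
    ext x
    simp only [mem_iUnion, mem_inter_iff, mem_iInter]
    constructor
    · rintro ⟨σ, h1, h2, h3⟩
      exact ⟨⟨σ, h1⟩, h2, fun τ => ⟨h2.1, h3 τ.1 τ.2⟩⟩
    · rintro ⟨σ, h2, h3⟩
      exact ⟨σ, σ.2, h2, fun τ hτ => (h3 ⟨τ, hτ⟩).2⟩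
  rw [this]
  exact isClosed_iUnion_of_finite fun σ => (hC σ).inter (isClosed_iInter fun τ => hO τ)

theorem DefMap.extendParam {M : ℕ} {E : Type} [Coord E] {ε : E → Fin M → ℝ} (h : DefMap S ε) (k : ℕ) :
    DefMap S fun x => extendParam (ε x) k := by
  by_cases hk : k < M
  · simpa only [_root_.extendParam, dif_pos hk] using h.apply ⟨k, hk⟩
  · simpa only [_root_.extendParam, dif_neg hk] using DefMap.const 0

theorem defFam_thickSet (hf : ∀ i, DefMap S (f i)) (hs : DefP S fun x => x ∈ Sset) (M : ℕ) :
    DefFam S fun ε : Fin M → ℝ => thickSet n f Sset SIGNS Sig (extendParam ε) := by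
  have hf' : ∀ i, DefMap S fun q : (Fin M → ℝ) × (Fin n → ℝ) => f i q.2 := fun i =>
    DefMap.comp (hf i) (by fun_prop)
  have hs' : DefP S fun q : (Fin M → ℝ) × (Fin n → ℝ) => q.2 ∈ Sset := hs.comp (by fun_prop)
  have he : ∀ k, DefMap S fun q : (Fin M → ℝ) × (Fin n → ℝ) => extendParam q.1 k := fun k =>
    DefMap.extendParam (by fun_prop) k
  refine DefP.exists_finite fun σ => (DefP.const _).and (DefP.and ?_ (DefP.forall_finite fun τ =>
    (DefP.const _).imp (DefP.not ?_)))
  · exact hs'.and (DefP.forall_finite fun i => ((DefP.const _).imp (DefP.le (hf' i).abs (he _))).and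
      (((DefP.const _).imp (DefP.le (by fun_prop) (hf' i))).and
        ((DefP.const _).imp (DefP.le (hf' i) (by fun_prop)))))
  · exact hs'.and (DefP.forall_finite fun i => ((DefP.const _).imp (DefP.lt (hf' i).abs (he _))).and
      (((DefP.const _).imp (DefP.lt (by fun_prop) (hf' i))).and
        ((DefP.const _).imp (DefP.lt (hf' i) (by fun_prop)))))

theorem mem_Xseq_iff {e : ℕ → ℝ} {x : Fin n → ℝ} (p : ℕ) : x ∈ Xseq n f Sset SIGNS Sig e p ↔
    (x ∈ Xseq n f Sset SIGNS Sig e 0 ∧ ∀ τ, τ ∈ SIGNS ∧ τ ∉ Sig → levelOf τ < p →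
      x ∉ RealiOp n f Sset e τ) ∨
    ∃ σ, σ ∈ Sig ∧ levelOf σ < p ∧ x ∈ RealiCp n f Sset e σ ∧
      ∀ τ, τ ∈ SIGNS ∧ τ ∉ Sig → levelOf σ ≤ levelOf τ → levelOf τ < p →
        x ∉ RealiOp n f Sset e τ := by
  induction p with
  | zero => simp
  | succ p ih =>
    have : x ∈ Xseq n f Sset SIGNS Sig e (p + 1) ↔ (x ∈ Xseq n f Sset SIGNS Sig e p ∨
        ∃ σ, σ ∈ Sig ∧ levelOf σ = p ∧ x ∈ RealiCp n f Sset e σ) ∧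
        ∀ τ, τ ∈ SIGNS ∧ τ ∉ Sig → levelOf τ = p → x ∉ RealiOp n f Sset e τ := by
      simp only [Xseq, Set.mem_sdiff, mem_union, mem_iUnion, Set.mem_ofPred_eq, exists_prop]
      refine and_congr (or_congr Iff.rfl (exists_congr fun σ => by tauto)) ?_
      push Not
      exact forall_congr' fun τ => by tauto
    rw [this, ih]
    constructor
    · rintro ⟨(⟨h1, h2⟩ | ⟨σ, h1, h2, h3, h4⟩) | ⟨σ, h1, h2, h3⟩, h5⟩
      · refine Or.inl ⟨h1, fun τ hτ hl => ?_⟩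
        rcases Nat.lt_succ_iff_lt_or_eq.1 hl with h | h
        exacts [h2 τ hτ h, h5 τ hτ h]
      · refine Or.inr ⟨σ, h1, by omega, h3, fun τ hτ hl hl' => ?_⟩
        rcases Nat.lt_succ_iff_lt_or_eq.1 hl' with h | h
        exacts [h4 τ hτ hl h, h5 τ hτ h]
      · exact Or.inr ⟨σ, h1, by omega, h3, fun τ hτ hl hl' => h5 τ hτ (by omega)⟩
    · rintro (⟨h1, h2⟩ | ⟨σ, h1, h2, h3, h4⟩)
      · exact ⟨Or.inl (Or.inl ⟨h1, fun τ hτ hl => h2 τ hτ (by omega)⟩), fun τ hτ hl =>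
          h2 τ hτ (by omega)⟩
      · refine ⟨?_, fun τ hτ hl => h4 τ hτ (by omega) (by omega)⟩
        by_cases hl : levelOf σ < p
        · exact Or.inl (Or.inr ⟨σ, h1, hl, h3, fun τ hτ hl hl' => h4 τ hτ hl (by omega)⟩)
        · exact Or.inr ⟨σ, h1, by omega, h3⟩

theorem Xseq_eq_thickSet (hs : ∀ σ ∈ Sig, signRe n f σ ⊆ Sset) {e : ℕ → ℝ}
    (he : ∀ m, 0 < m → m ≤ t → 0 ≤ e (2 * m)) :
    Xseq n f Sset SIGNS Sig e (t + 1) = thickSet n f Sset SIGNS Sig e := by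
  ext x
  have hlt : ∀ σ : Fin t → SignType, levelOf σ < t + 1 := fun σ => Nat.lt_succ_of_le (levelOf_le σ)
  rw [mem_Xseq_iff]
  constructor
  · rintro (⟨h1, h2⟩ | ⟨σ, h1, h2, h3, h4⟩)
    · obtain ⟨σ, hσ, hx⟩ := mem_iUnion₂.1 h1
      refine ⟨σ, hσ, ⟨hs σ hσ hx, fun i => ⟨fun h => ?_, fun h => ?_, fun h => ?_⟩⟩,
        fun τ hτ => h2 τ ⟨hτ.1, hτ.2.1⟩ (hlt τ)⟩
      · have := sign_eq_zero_iff.1 ((hx i).trans h)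
        rw [this, abs_zero]
        exact he _ (levelOf_pos h) (levelOf_le σ)
      · exact (sign_eq_one_iff.1 ((hx i).trans h)).le
      · exact (sign_eq_neg_one_iff.1 ((hx i).trans h)).le
    · exact ⟨σ, h1, h3, fun τ hτ => h4 τ ⟨hτ.1, hτ.2.1⟩ hτ.2.2 (hlt τ)⟩
  · rintro ⟨σ, h1, h3, h4⟩
    exact Or.inr ⟨σ, h1, hlt σ, h3, fun τ hτ hl _ => h4 τ ⟨hτ.1, hτ.2, hl⟩⟩

/-- The points where the functions not vanishing under `σ` have the sign prescribed by `σ` and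
absolute value at least `κ`. -/
def farSet (f : Fin t → (Fin n → ℝ) → ℝ) (σ : Fin t → SignType) (κ : ℝ) : Set (Fin n → ℝ) :=
  {x | ∀ i, (σ i = 1 → κ ≤ f i x) ∧ (σ i = -1 → f i x ≤ -κ)}

theorem level_lt_or_eq {σ τ : Fin t → SignType} {κ : ℝ} (hκ : 0 < κ) {x : Fin n → ℝ}
    (hx : x ∈ farSet f σ κ)
    (h : ∀ i, (τ i = 0 → |f i x| < κ) ∧ (τ i = 1 → 0 ≤ f i x) ∧ (τ i = -1 → f i x ≤ 0)) :
    levelOf τ < levelOf σ ∨ τ = σ := by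
  have h0 : ∀ i, τ i = 0 → σ i = 0 := fun i hi => by
    have := abs_lt.1 ((h i).1 hi)
    obtain ⟨h1, h2⟩ := hx i
    rcases hσ : σ i with _ | _ | _
    · rfl
    · linarith [h2 hσ]
    · linarith [h1 hσ]
  have h1 : ∀ i, τ i ≠ 0 → σ i ≠ 0 → τ i = σ i := fun i hτ hσ => by
    obtain ⟨h1, h2⟩ := hx i
    obtain ⟨-, h3, h4⟩ := h i
    rcases hσ' : σ i with _ | _ | _ <;> rcases hτ' : τ i with _ | _ | _
    all_goals first
      | rfl
      | exact absurd hσ' hσ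
      | exact absurd hτ' hτ
      | linarith [h2 hσ', h3 hτ']
      | linarith [h1 hσ', h4 hτ']
  have hsub : (Finset.univ.filter fun i => τ i = 0) ⊆ Finset.univ.filter fun i => σ i = 0 :=
    fun i hi => Finset.mem_filter.2 ⟨Finset.mem_univ i, h0 i (Finset.mem_filter.1 hi).2⟩
  rcases (Finset.card_le_card hsub).lt_or_eq with h | h
  · exact Or.inl h
  · right
    have heq := Finset.eq_of_subset_of_card_le hsub h.ge
    funext i
    by_cases hi : σ i = 0
    · have : i ∈ Finset.univ.filter fun i => τ i = 0 := by
        rw [heq]; exact Finset.mem_filter.2 ⟨Finset.mem_univ i, hi⟩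
      rw [(Finset.mem_filter.1 this).2, hi]
    · exact h1 i (fun hc => hi (h0 i hc)) hi

theorem level_lt_or_eq_of_mem_RealiCp {σ τ : Fin t → SignType} {κ : ℝ} (hκ : 0 < κ)
    {x : Fin n → ℝ} (hx : x ∈ farSet f σ κ) {e : ℕ → ℝ} (he : ∀ k, e k < κ)
    (h : x ∈ RealiCp n f Sset e τ) : levelOf τ < levelOf σ ∨ τ = σ :=
  level_lt_or_eq hκ hx fun i => ⟨fun hi => ((h.2 i).1 hi).trans_lt (he _), (h.2 i).2⟩

theorem level_lt_or_eq_of_mem_RealiOp {σ τ : Fin t → SignType} {κ : ℝ} (hκ : 0 < κ)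
    {x : Fin n → ℝ} (hx : x ∈ farSet f σ κ) {e : ℕ → ℝ} (he : ∀ k, e k < κ)
    (h : x ∈ RealiOp n f Sset e τ) : levelOf τ < levelOf σ ∨ τ = σ :=
  level_lt_or_eq hκ hx fun i => ⟨fun hi => ((h.2 i).1 hi).trans (he _),
    fun hi => ((h.2 i).2.1 hi).le, fun hi => ((h.2 i).2.2 hi).le⟩

theorem mem_thickSet_of_near {σ : Fin t → SignType} {κ : ℝ} (hκ : 0 < κ) (hσ : σ ∈ Sig)
    {x : Fin n → ℝ} (hxS : x ∈ Sset) (hx : x ∈ farSet f σ κ) {e : ℕ → ℝ} (he : ∀ k, e k < κ)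
    (h : ∀ i, σ i = 0 → |f i x| ≤ e (2 * levelOf σ)) : x ∈ thickSet n f Sset SIGNS Sig e := by
  refine ⟨σ, hσ, ⟨hxS, fun i => ⟨h i, fun hi => hκ.le.trans ((hx i).1 hi), fun hi => ?_⟩⟩, ?_⟩
  · linarith [(hx i).2 hi]
  · rintro τ ⟨-, h2, h3⟩ hxτ
    rcases level_lt_or_eq_of_mem_RealiOp hκ hx he hxτ with h4 | rfl
    · omega
    · exact h2 hσ

theorem exists_ge_of_mem_thickSet {σ : Fin t → SignType} {κ : ℝ} (hκ : 0 < κ) (hσ : σ ∉ Sig)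
    (hσ' : σ ∈ SIGNS) {x : Fin n → ℝ} (hx : x ∈ farSet f σ κ) {e : ℕ → ℝ} (he : ∀ k, e k < κ)
    (h : x ∈ thickSet n f Sset SIGNS Sig e) : ∃ i, σ i = 0 ∧ e (2 * levelOf σ - 1) ≤ |f i x| := by
  obtain ⟨τ, h1, h2, h3⟩ := h
  by_contra! hc
  have hl : levelOf τ < levelOf σ := by
    rcases level_lt_or_eq_of_mem_RealiCp hκ hx he h2 with h4 | rfl
    · exact h4
    · exact absurd h1 hσ
  refine h3 σ ⟨hσ', hσ, hl.le⟩ ⟨h2.1, fun i => ⟨hc i, fun hi => hκ.trans_le ((hx i).1 hi),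
    fun hi => ?_⟩⟩
  linarith [(hx i).2 hi]

theorem mem_thickSet_congr {σ : Fin t → SignType} {κ : ℝ} (hκ : 0 < κ) {x : Fin n → ℝ}
    (hx : x ∈ farSet f σ κ) {e e' : ℕ → ℝ} (he : ∀ k, e k < κ) (he' : ∀ k, e' k < κ)
    (h1 : ∀ k < 2 * levelOf σ, e k = e' k) (h2 : σ ∈ Sig → e (2 * levelOf σ) = e' (2 * levelOf σ))
    (h : x ∈ thickSet n f Sset SIGNS Sig e) : x ∈ thickSet n f Sset SIGNS Sig e' := by
  obtain ⟨τ, h3, h4, h5⟩ := h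
  refine ⟨τ, h3, RealiCp_mono (fun _ => ?_) h4, fun τ' hτ' hx' => h5 τ' hτ' (RealiOp_mono
    (fun hp => ?_) hx')⟩
  · rcases level_lt_or_eq_of_mem_RealiCp hκ hx he h4 with h | rfl
    · exact (h1 _ (by omega)).le
    · exact (h2 h3).le
  · have : levelOf τ' ≤ levelOf σ := by
      rcases level_lt_or_eq_of_mem_RealiOp hκ hx he' hx' with h | rfl
      exacts [h.le, le_rfl]
    exact (h1 _ (by omega)).ge

end SignSets

section Limit
variable {n t : ℕ} {f : Fin t → (Fin n → ℝ) → ℝ} {Sset : Set (Fin n → ℝ)}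
  {SIGNS Sig : Set (Fin t → SignType)}

theorem param_lt_of_lt {M : ℕ} {E : ℕ → Fin M → ℝ} (hE : ∀ k i j, E (k + 1) i < E k j) {r s : ℕ}
    (h : r < s) (a b : Fin M) : E s a < E r b := by
  induction s, h using Nat.le_induction generalizing a with
  | base => exact hE r a b
  | succ s hs ih => exact (hE s a a).trans (ih a)

theorem param_le_of_le {M : ℕ} {E : ℕ → Fin M → ℝ} (hE : ∀ k i j, E (k + 1) i < E k j) {r s : ℕ}
    (h : r ≤ s) (a : Fin M) : E s a ≤ E r a := by
  rcases h.lt_or_eq with h | rfl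
  · exact (param_lt_of_lt hE h a a).le
  · exact le_rfl

theorem extendParam_stepParam_lt {M : ℕ} (hM : 0 < M) {E : ℕ → Fin M → ℝ} (hpos : ∀ k j, 0 < E k j)
    (hE : ∀ k i j, E (k + 1) i < E k j) {r q : ℕ} (h : (r + 1) * M ≤ q) (b : Fin M) (k : ℕ) :
    extendParam (stepParam E q) k < E r b := by
  unfold extendParam
  split_ifs with hk
  · have hq : r < q / M := (Nat.le_div_iff_mul_le hM).2 h
    unfold stepParam
    split_ifs
    · exact param_lt_of_lt hE (by omega) _ _
    · exact param_lt_of_lt hE hq _ _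
  · exact hpos r b

theorem extendParam_stepParam_succ {M : ℕ} {E : ℕ → Fin M → ℝ} {q k : ℕ} (h : k ≠ q % M) :
    extendParam (stepParam E (q + 1)) k = extendParam (stepParam E q) k := by
  unfold extendParam
  split_ifs with hk
  · exact stepParam_succ_of_ne E q ⟨k, hk⟩ h
  · rfl

theorem extendParam_stepParam_succ_le {M : ℕ} {E : ℕ → Fin M → ℝ}
    (hE : ∀ k i j, E (k + 1) i < E k j) (q k : ℕ) :
    extendParam (stepParam E (q + 1)) k ≤ extendParam (stepParam E q) k := by
  by_cases h : k = q % M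
  · unfold extendParam
    split_ifs with hk
    · subst h
      rw [stepParam_succ E q hk, stepParam_eq_update E q hk, Function.update_self,
        Function.update_self]
      exact (hE _ _ _).le
    · rfl
  · exact (extendParam_stepParam_succ h).le

theorem le_extendParam_stepParam {M : ℕ} {E : ℕ → Fin M → ℝ} (hE : ∀ k i j, E (k + 1) i < E k j)
    {r q : ℕ} (a : Fin M) (h : q ≤ r * M + a) : E r a ≤ extendParam (stepParam E q) a := by
  have hM : 0 < M := by have := a.2; omega
  have hq := Nat.div_add_mod q M
  have hr : q / M ≤ r := by
    rw [← Nat.lt_succ_iff, Nat.div_lt_iff_lt_mul hM]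
    have := a.2
    calc q ≤ r * M + a := h
      _ < r.succ * M := by rw [Nat.succ_mul]; omega
  rw [extendParam, dif_pos a.2]
  unfold stepParam
  split_ifs with hlt
  · refine param_le_of_le hE ?_ a
    rcases hr.lt_or_eq with hr | hr
    · exact hr
    · rw [hr] at hq
      have : M * r = r * M := mul_comm _ _
      simp only at hlt
      omega
  · exact param_le_of_le hE hr a

theorem lt_div_of_mod_lt {M : ℕ} {r q a : ℕ} (h : r * M + a ≤ q) (hq : q % M < a) :
    r < q / M := by
  have h1 := Nat.div_add_mod q M
  by_contra! hc
  have h2 : M * (q / M) ≤ M * r := Nat.mul_le_mul_left M hc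
  have h3 : M * r = r * M := mul_comm _ _
  omega

theorem extendParam_stepParam_self {M : ℕ} (E : ℕ → Fin M → ℝ) (r : ℕ) (a : Fin M) :
    extendParam (stepParam E (r * M + a)) a = E r a := by
  have hM : 0 < M := by have := a.2; omega
  have h1 : (r * M + a) % M = a := by
    rw [mul_comm, Nat.mul_add_mod, Nat.mod_eq_of_lt a.2]
  have h2 : (r * M + a) / M = r := by
    rw [mul_comm, Nat.mul_add_div hM, Nat.div_eq_of_lt a.2, add_zero]
  rw [extendParam, dif_pos a.2]
  simp [stepParam, h1, h2]

theorem exists_eventually_mem_farSet (hf : ∀ i, Continuous (f i)) {M : ℕ} {E : ℕ → Fin M → ℝ}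
    (hE : ∀ k j, E (k + 1) j < (1 / 2 : ℝ) ^ k) (a : Fin M) (x : Fin n → ℝ) :
    ∃ r, ∀ᶠ y in 𝓝 x, y ∈ farSet f (fun i => SignType.sign (f i x)) (E r a) := by
  have h : ∀ᶠ κ in 𝓝[>] (0 : ℝ), ∀ i, f i x ≠ 0 → κ < |f i x| := by
    refine eventually_all.2 fun i => ?_
    by_cases hi : f i x = 0
    · exact Eventually.of_forall fun κ h => absurd hi h
    · filter_upwards [Ioo_mem_nhdsGT (abs_pos.2 hi)] with κ hκ _ using hκ.2
  obtain ⟨κ, h1, h2⟩ := (h.and self_mem_nhdsWithin).exists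
  obtain ⟨r, hr⟩ := exists_pow_lt_of_lt_one h2 (show (1 / 2 : ℝ) < 1 by norm_num)
  refine ⟨r + 1, eventually_all.2 fun i => ?_⟩
  have hκ : E (r + 1) a < κ := (hE r a).trans hr
  rcases lt_trichotomy (f i x) 0 with hi | hi | hi
  · have h3 : f i x < -E (r + 1) a := by
      have := h1 i hi.ne
      rw [abs_of_neg hi] at this
      linarith
    filter_upwards [(hf i).continuousAt.eventually_lt_const h3] with y hy
    simp [sign_neg hi, hy.le]
  · simp [hi]
  · have h3 : E (r + 1) a < f i x := by
      have := h1 i hi.ne'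
      rw [abs_of_pos hi] at this
      linarith
    filter_upwards [(hf i).continuousAt.eventually_const_lt h3] with y hy
    simp [sign_pos hi, hy.le]

variable {M : ℕ} {E : ℕ → Fin M → ℝ} {F B : ℕ → (Fin n → ℝ) → Fin n → ℝ}

/-- The maps `F` and `B` fix the common points of consecutive sets, and preserve the sublevel and
superlevel sets of the `f i` at sufficiently large parameter values. -/
def PreservesLevels (f : Fin t → (Fin n → ℝ) → ℝ) (E : ℕ → Fin M → ℝ)
    (Y : ℕ → Set (Fin n → ℝ)) (F B : ℕ → (Fin n → ℝ) → Fin n → ℝ) : Prop :=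
  ∀ q, ∃ l, PreservesList l (Y q) (Y (q + 1)) (F q) (B q) ∧
    ∀ r < q / M, ∀ j i, {x | f i x ≤ E r j} ∈ l ∧ {x | E r j ≤ f i x} ∈ l ∧
      {x | f i x ≤ -E r j} ∈ l ∧ {x | -E r j ≤ f i x} ∈ l

theorem mem_of_tendsto_of_preservesLevels (ht : 2 * t < M) (hf : ∀ i, Continuous (f i)) (hs : IsClosed Sset)
    (hpos : ∀ k j, 0 < E k j) (hE : ∀ k i j, E (k + 1) i < E k j)
    (hE' : ∀ k j, E (k + 1) j < (1 / 2 : ℝ) ^ k)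
    (hsig : ∀ x ∈ Sset, (fun i => SignType.sign (f i x)) ∈ SIGNS)
    (hP : PreservesLevels f E
      (fun q => thickSet n f Sset SIGNS Sig (extendParam (stepParam E q))) F B)
    {k : ℕ} {y : ℕ → Fin n → ℝ} {z : Fin n → ℝ}
    (hy : ∀ m, y m ∈ thickSet n f Sset SIGNS Sig (extendParam (stepParam E (k + m))))
    (hyF : ∀ m, y (m + 1) = F (k + m) (y m)) (hz : Tendsto y atTop (𝓝 z)) :
    z ∈ ⋃ σ ∈ Sig, signRe n f σ := by
  have hM : 0 < M := by omega
  have hzS : z ∈ Sset := hs.mem_of_tendsto hz (Eventually.of_forall fun m => thickSet_subset _ (hy m))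
  by_cases hσ : (fun i => SignType.sign (f i z)) ∈ Sig
  · exact mem_iUnion₂.2 ⟨_, hσ, fun i => rfl⟩
  exfalso
  obtain ⟨r, hr⟩ := exists_eventually_mem_farSet hf hE' ⟨0, hM⟩ z
  set σ : Fin t → SignType := fun i => SignType.sign (f i z) with hσdef
  obtain ⟨m₀, hm₀⟩ := eventually_atTop.1 (hz.eventually hr)
  have hκ := hpos r ⟨0, hM⟩
  set κ := E r ⟨0, hM⟩ with hκdef
  have hlev := levelOf_le σ
  set a : Fin M := ⟨2 * levelOf σ - 1, by omega⟩ with ha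
  obtain ⟨r₁, hr₁, hr₁'⟩ : ∃ r₁, r + 1 ≤ r₁ ∧ k + m₀ ≤ r₁ * M + a :=
    ⟨r + 1 + (k + m₀), by omega, by nlinarith⟩
  have hlarge : ∀ q, r₁ * M + a ≤ q → ∀ j, extendParam (stepParam E q) j < κ := fun q hq j =>
    extendParam_stepParam_lt hM hpos hE
      (((Nat.mul_le_mul_right M hr₁).trans (Nat.le_add_right _ _)).trans hq) _ j
  obtain ⟨m₁, hm₁⟩ : ∃ m₁, k + m₁ = r₁ * M + a := ⟨r₁ * M + a - k, by omega⟩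
  obtain ⟨i, hi, hge⟩ := exists_ge_of_mem_thickSet hκ hσ (hsig z hzS) (hm₀ m₁ (by omega))
    (hlarge _ hm₁.ge) (hy m₁)
  have hl0 := levelOf_pos hi
  rw [hm₁, show 2 * levelOf σ - 1 = (a : ℕ) from rfl, extendParam_stepParam_self] at hge
  have hfz : f i z = 0 := sign_eq_zero_iff.1 hi
  have key : ∀ m ≥ m₁, E r₁ a ≤ |f i (y m)| := by
    intro m hm
    induction m, hm using Nat.le_induction with
    | base => exact hge
    | succ m hm ih =>
      obtain ⟨l, hl, hl'⟩ := hP (k + m)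
      have hq : r₁ * M + a ≤ k + m := by omega
      have hfar := hm₀ m (by omega)
      rw [hyF]
      by_cases hlt : (k + m) % M < a
      · obtain ⟨-, h2, h3, -⟩ := hl' r₁ (lt_div_of_mod_lt hq hlt) a i
        rcases le_abs.1 ih with h | h
        · exact le_abs.2 (Or.inl (hl.presF _ (hy m) _ h2 h))
        · have := hl.presF _ (hy m) _ h3 (show f i (y m) ≤ -E r₁ a by linarith)
          exact le_abs.2 (Or.inr (by linarith [show f i (F (k + m) (y m)) ≤ -E r₁ a from this]))
      · have hmem : y m ∈ thickSet n f Sset SIGNS Sig (extendParam (stepParam E (k + m + 1))) := by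
          rcases (not_lt.1 hlt).eq_or_lt with heq | hgt
          · refine thickSet_mono (fun m hm _ => ?_) (fun m hm _ => ?_) (hy m)
            · exact (extendParam_stepParam_succ (by simp only [a] at heq; omega)).ge
            · by_cases hma : 2 * m - 1 = a
              · rw [hma]
                exact extendParam_stepParam_succ_le hE _ _
              · exact (extendParam_stepParam_succ (by omega)).le
          · exact mem_thickSet_congr hκ hfar (hlarge _ hq) (hlarge _ (by omega))
              (fun j hj => (extendParam_stepParam_succ (by simp only [a] at hgt; omega)).symm)
              (fun h => absurd h hσ) (hy m)
        rw [hl.fixF _ (hy m) hmem]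
        exact ih
  have h1 : Tendsto (fun m => |f i (y m)|) atTop (𝓝 |f i z|) :=
    ((hf i).abs.tendsto z).comp hz
  have h2 := ge_of_tendsto h1 (eventually_atTop.2 ⟨m₁, key⟩)
  rw [hfz, abs_zero] at h2
  linarith [hpos r₁ a]

end Limit

section Limit
variable {n t : ℕ} {f : Fin t → (Fin n → ℝ) → ℝ} {Sset : Set (Fin n → ℝ)}
  {SIGNS Sig : Set (Fin t → SignType)}
variable {M : ℕ} {E : ℕ → Fin M → ℝ} {F B : ℕ → (Fin n → ℝ) → Fin n → ℝ}

/-- The points of `Sset` where the functions vanishing under `σ` have absolute value at most `c`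
and the others are far from zero with the right sign. -/
def boxSet (f : Fin t → (Fin n → ℝ) → ℝ) (Sset : Set (Fin n → ℝ)) (σ : Fin t → SignType)
    (κ c : ℝ) : Set (Fin n → ℝ) :=
  {v | v ∈ Sset ∧ v ∈ farSet f σ κ ∧ ∀ i, σ i = 0 → |f i v| ≤ c}

theorem mapsTo_boxSet {σ : Fin t → SignType} (a₀ a : Fin M)
    (ha : (a : ℕ) = 2 * levelOf σ)
    (hpos : ∀ k j, 0 < E k j) (hE : ∀ k i j, E (k + 1) i < E k j)
    (hP : PreservesLevels f E
      (fun q => thickSet n f Sset SIGNS Sig (extendParam (stepParam E q))) F B)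
    (hB : ∀ q, MapsTo (B q) (thickSet n f Sset SIGNS Sig (extendParam (stepParam E (q + 1))))
      (thickSet n f Sset SIGNS Sig (extendParam (stepParam E q)))) {r r₁ q : ℕ} (hr : r < r₁)
    (hq : r₁ * M + a + 1 ≤ q) {w : Fin n → ℝ}
    (hw : w ∈ thickSet n f Sset SIGNS Sig (extendParam (stepParam E (q + 1))))
    (hw' : w ∈ boxSet f Sset σ (E r a₀) (E r₁ a)) : B q w ∈ boxSet f Sset σ (E r a₀) (E r₁ a) := by
  have hM : 0 < M := a.pos
  have hlarge : ∀ q, r₁ * M ≤ q → ∀ j, extendParam (stepParam E q) j < E r a₀ := fun q hq j =>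
    extendParam_stepParam_lt hM hpos hE ((Nat.mul_le_mul_right M hr).trans hq) _ j
  obtain ⟨l, hl, hl'⟩ := hP q
  by_cases hlt : (a : ℕ) < q % M
  · have hmem : w ∈ thickSet n f Sset SIGNS Sig (extendParam (stepParam E q)) :=
      mem_thickSet_congr (hpos r a₀) hw'.2.1 (hlarge _ (by omega)) (hlarge _ (by omega))
        (fun j hj => extendParam_stepParam_succ (by omega))
        (fun h => extendParam_stepParam_succ (by omega)) hw
    rw [hl.fixB _ hmem hw]
    exact hw'
  · have hr₁ : r₁ < q / M := by
      have h1 := Nat.div_add_mod q M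
      by_contra! hc
      have h2 : M * (q / M) ≤ M * r₁ := Nat.mul_le_mul_left M hc
      have h3 : M * r₁ = r₁ * M := mul_comm _ _
      omega
    refine ⟨thickSet_subset _ (hB q hw), fun i => ⟨fun hi => ?_, fun hi => ?_⟩, fun i hi => ?_⟩
    · exact hl.presB _ hw _ (hl' r (hr.trans hr₁) a₀ i).2.1 ((hw'.2.1 i).1 hi)
    · exact hl.presB _ hw _ (hl' r (hr.trans hr₁) a₀ i).2.2.1 ((hw'.2.1 i).2 hi)
    · obtain ⟨h1, h2⟩ := abs_le.1 (hw'.2.2 i hi)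
      obtain ⟨h3, -, -, h4⟩ := hl' r₁ hr₁ a i
      exact abs_le.2 ⟨hl.presB _ hw _ h4 h1, hl.presB _ hw _ h3 h2⟩

theorem exists_fixed_of_preservesLevels (ht : 2 * t < M) (hf : ∀ i, Continuous (f i))
    (hpos : ∀ k j, 0 < E k j) (hE : ∀ k i j, E (k + 1) i < E k j)
    (hE' : ∀ k j, E (k + 1) j < (1 / 2 : ℝ) ^ k)
    (hsub : ∀ σ ∈ Sig, signRe n f σ ⊆ Sset)
    (hP : PreservesLevels f E
      (fun q => thickSet n f Sset SIGNS Sig (extendParam (stepParam E q))) F B)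
    {Φ Ψ : ℕ → (Fin n → ℝ) × ℝ → Fin n → ℝ}
    (hC : ∀ q, ControlledEquiv (thickSet n f Sset SIGNS Sig (extendParam (stepParam E q)))
      (thickSet n f Sset SIGNS Sig (extendParam (stepParam E (q + 1))))
      ((1 / 2 : ℝ) ^ q) (F q) (B q) (Φ q) (Ψ q))
    {x : Fin n → ℝ} (hx : x ∈ ⋃ σ ∈ Sig, signRe n f σ) :
    ∃ q₀, (∀ q ≥ q₀, x ∈ thickSet n f Sset SIGNS Sig (extendParam (stepParam E q)) ∧ B q x = x) ∧
      ∀ k ≥ q₀, ∀ e > 0, ∃ δ > 0, ∃ Q, ∀ m ≥ Q,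
        ∀ w ∈ thickSet n f Sset SIGNS Sig (extendParam (stepParam E (k + m))), dist w x < δ →
          dist (backwardIter B k m w) x < e := by
  have hM : 0 < M := by omega
  obtain ⟨σ, hσ, hxσ⟩ := mem_iUnion₂.1 hx
  obtain ⟨r, hr⟩ := exists_eventually_mem_farSet hf hE' ⟨0, hM⟩ x
  rw [show (fun i => SignType.sign (f i x)) = σ from funext hxσ] at hr
  have hκ := hpos r ⟨0, hM⟩
  have hxS := hsub σ hσ hxσ
  have hxfar := hr.self_of_nhds
  have hlev := levelOf_le σ
  have hx0 : ∀ i, σ i = 0 → f i x = 0 := fun i hi => sign_eq_zero_iff.1 ((hxσ i).trans hi)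
  obtain ⟨a, ha⟩ : ∃ a : Fin M, (a : ℕ) = 2 * levelOf σ := ⟨⟨2 * levelOf σ, by omega⟩, rfl⟩
  have hlarge : ∀ q, (r + 1) * M ≤ q → ∀ j, extendParam (stepParam E q) j < E r ⟨0, hM⟩ :=
    fun q hq j => extendParam_stepParam_lt hM hpos hE hq _ j
  have hxY : ∀ q, (r + 1) * M ≤ q →
      x ∈ thickSet n f Sset SIGNS Sig (extendParam (stepParam E q)) := fun q hq => by
    refine mem_thickSet_of_near hκ hσ hxS hxfar (hlarge q hq) fun i hi => ?_
    rw [hx0 i hi, abs_zero, extendParam, dif_pos (by omega)]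
    unfold stepParam
    split_ifs <;> exact (hpos _ _).le
  refine ⟨(r + 1) * M, fun q hq => ⟨hxY q hq, ?_⟩, fun k hk e he => ?_⟩
  · obtain ⟨l, hl, -⟩ := hP q
    exact hl.fixB x (hxY q hq) (hxY (q + 1) (by omega))
  obtain ⟨s, hs⟩ := exists_pow_lt_of_lt_one (show 0 < e / 4 by linarith)
    (show (1 / 2 : ℝ) < 1 by norm_num)
  obtain ⟨r₁, hr₁, hr₁k, hr₁s⟩ : ∃ r₁, r < r₁ ∧ k ≤ r₁ * M ∧ s ≤ r₁ * M :=
    ⟨r + 1 + (k + s), by omega, by nlinarith, by nlinarith⟩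
  obtain ⟨p₁, hp₁⟩ : ∃ p₁, k + p₁ = r₁ * M + a + 1 := ⟨r₁ * M + a + 1 - k, by omega⟩
  have hbox : ∀ᶠ v in 𝓝 x, v ∈ Sset → v ∈ boxSet f Sset σ (E r ⟨0, hM⟩) (E r₁ a) := by
    have h : ∀ᶠ v in 𝓝 x, ∀ i, σ i = 0 → |f i v| ≤ E r₁ a := eventually_all.2 fun i => by
      by_cases hi : σ i = 0
      · have : |f i x| < E r₁ a := by rw [hx0 i hi, abs_zero]; exact hpos _ _
        filter_upwards [(hf i).abs.continuousAt.eventually_lt_const this] with v hv _ using hv.le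
      · exact Eventually.of_forall fun v h => absurd h hi
    filter_upwards [hr, h] with v h1 h2 h3 using ⟨h3, h1, h2⟩
  obtain ⟨δ, hδ, hδ'⟩ := Metric.eventually_nhds_iff.1 hbox
  have hback : ∀ p, ∀ w ∈ thickSet n f Sset SIGNS Sig (extendParam (stepParam E (k + p₁ + p))),
      w ∈ boxSet f Sset σ (E r ⟨0, hM⟩) (E r₁ a) →
      backwardIter B (k + p₁) p w ∈ boxSet f Sset σ (E r ⟨0, hM⟩) (E r₁ a) := by
    intro p
    induction p with
    | zero => exact fun w _ hw => hw
    | succ p ih =>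
      exact fun w hw hw' => ih _ ((hC _).mapsB hw) (mapsTo_boxSet _ a ha hpos hE hP
        (fun q => (hC q).mapsB) hr₁ (by omega) hw hw')
  have hfixed : ∀ m ≤ p₁, ∀ v ∈ boxSet f Sset σ (E r ⟨0, hM⟩) (E r₁ a),
      v ∈ thickSet n f Sset SIGNS Sig (extendParam (stepParam E (k + m))) →
      backwardIter B k m v = v := by
    intro m
    induction m with
    | zero => exact fun _ v _ _ => rfl
    | succ m ih =>
      intro hm v hv hvY
      have hvY' : v ∈ thickSet n f Sset SIGNS Sig (extendParam (stepParam E (k + m))) := by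
        refine mem_thickSet_of_near hκ hσ hv.1 hv.2.1 (hlarge _ (by omega)) fun i hi => ?_
        rw [← ha]
        exact (hv.2.2 i hi).trans (le_extendParam_stepParam hE a (by omega))
      obtain ⟨l, hl, -⟩ := hP (k + m)
      rw [backwardIter, hl.fixB v hvY' hvY]
      exact ih (by omega) v hv hvY'
  refine ⟨min δ (e / 2), lt_min hδ (by linarith), p₁, fun m hm w hw hwx => ?_⟩
  obtain ⟨p, rfl⟩ := Nat.exists_eq_add_of_le hm
  rw [← add_assoc] at hw
  have h1 := hback p w hw (hδ' (hwx.trans_le (min_le_left _ _)) (thickSet_subset _ hw))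
  rw [backwardIter_add, hfixed p₁ le_rfl _ h1 (backwardIter_mem hC _ _ hw)]
  have h2 := backwardIter_dist hC (k + p₁) p hw
  have h3 := dist_triangle (backwardIter B (k + p₁) p w) w x
  have h4 : (1 / 2 : ℝ) ^ (k + p₁) ≤ (1 / 2 : ℝ) ^ s :=
    pow_le_pow_of_le_one (by norm_num) (by norm_num) (by omega)
  have h5 : (0 : ℝ) < (1 / 2 : ℝ) ^ (k + p₁ + p) := by positivity
  have h6 := hwx.trans_le (min_le_right _ _)
  linarith

end Limit

section
variable {n t : ℕ} {f : Fin t → (Fin n → ℝ) → ℝ} {Sset : Set (Fin n → ℝ)}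
  {SIGNS Sig : Set (Fin t → SignType)}

theorem extendParam_update {M : ℕ} (ε : Fin M → ℝ) (j : Fin M) (s : ℝ) :
    extendParam (Function.update ε j s) = Function.update (extendParam ε) j s := by
  funext k
  by_cases hk : k = j
  · subst hk
    simp [extendParam]
  · rw [Function.update_of_ne hk]
    unfold extendParam
    split_ifs with h
    · exact Function.update_of_ne (fun hc => hk (congrArg Fin.val hc)) _ _
    · rfl

theorem monotone_or_antitone_thickSet {M : ℕ} (j : Fin M) :
    (∀ ε : Fin M → ℝ, Monotone fun s =>
      thickSet n f Sset SIGNS Sig (extendParam (Function.update ε j s))) ∨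
    ∀ ε : Fin M → ℝ, Antitone fun s =>
      thickSet n f Sset SIGNS Sig (extendParam (Function.update ε j s)) := by
  simp only [extendParam_update]
  rcases Nat.even_or_odd' (j : ℕ) with ⟨c, hc | hc⟩
  · refine Or.inl fun ε s s' h => thickSet_mono (fun m _ _ => ?_) fun m _ _ => ?_
    · exact Function.update_mono h _
    · rw [Function.update_of_ne (by omega), Function.update_of_ne (by omega)]
  · refine Or.inr fun ε s s' h => thickSet_mono (fun m _ _ => ?_) fun m _ _ => ?_
    · rw [Function.update_of_ne (by omega), Function.update_of_ne (by omega)]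
    · exact Function.update_mono h _

end

/-- Under the stated construction (with the `εᵢ` sufficiently small, i.e.
satisfying a suitable chain of positive definable bounds each depending only on the later
`ε`'s), the closed set `X' = X^{t+1}` is homotopy equivalent to `X`. -/
theorem Xseq_homotopy_equiv
    (S : RealStructure) (hS : S.IsOMinimal)
    (n t : ℕ) (f : Fin t → ((Fin n → ℝ) → ℝ))
    (hdef : ∀ i, S.DefinableFun n (f i)) (hcont : ∀ i, Continuous (f i))
    (φ : FGFormula t) (Sset : Set (Fin n → ℝ))
    (hSset : Sset = φ.eval n 0 f Fin.elim0)
    (hSbd : Bornology.IsBounded Sset)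
    (SIGNS : Set (Fin t → SignType))
    (hSIGNS : SIGNS = {σ | (signRe n f σ).Nonempty ∧ signRe n f σ ⊆ Sset})
    (Sig : Set (Fin t → SignType)) (hSig : Sig ⊆ SIGNS) :
    ∃ b : ℕ → ((Fin (2 * t + 1) → ℝ) → ℝ),
      (∀ k, S.DefinableFun (2 * t + 1) (b k)) ∧
      (∀ (k : ℕ) (ε ε' : Fin (2 * t + 1) → ℝ),
        (∀ j : Fin (2 * t + 1), k < (j : ℕ) → ε j = ε' j) → b k ε = b k ε') ∧
      (∀ (k : ℕ) (ε : Fin (2 * t + 1) → ℝ), 0 < b k ε ∧ b k ε ≤ 1) ∧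
      ∀ ε : Fin (2 * t + 1) → ℝ,
        (∀ k : Fin (2 * t + 1), 0 < (k : ℕ) → 0 < ε k ∧ ε k < b (k : ℕ) ε) →
        Nonempty (ContinuousMap.HomotopyEquiv
          (Xseq n f Sset SIGNS Sig (fun j => if h : j < 2 * t + 1 then ε ⟨j, h⟩ else 0) (t + 1))
          (Xseq n f Sset SIGNS Sig (fun j => if h : j < 2 * t + 1 then ε ⟨j, h⟩ else 0) 0)) := by
  have hf : ∀ i, DefMap S (f i) := fun i => (hdef i).defMap
  have hSc : IsClosed Sset := by rw [hSset]; exact φ.eval_isClosed hcont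
  have hSd : DefP S fun x => x ∈ Sset := by rw [hSset]; exact φ.eval_defP hf
  obtain ⟨R, hR⟩ := hSbd.subset_closedBall 0
  have hsub : ∀ σ ∈ Sig, signRe n f σ ⊆ Sset := fun σ hσ => by
    have := hSig hσ
    rw [hSIGNS] at this
    exact this.2
  have hsig : ∀ x ∈ Sset, (fun i => SignType.sign (f i x)) ∈ SIGNS := fun x hx => by
    rw [hSIGNS]
    refine ⟨⟨x, fun i => rfl⟩, fun y hy => ?_⟩
    rw [hSset] at hx ⊢
    exact φ.mem_eval_of_sign_eq hy hx
  obtain ⟨b, hb1, hb2, hb3, hb4⟩ := hS.exists_controlled_seq (Nat.succ_pos (2 * t))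
    (defFam_thickSet (SIGNS := SIGNS) (Sig := Sig) hf hSd (2 * t + 1))
    (fun ε => (isCompact_closedBall (0 : Fin n → ℝ) R).of_isClosed_subset
      (isClosed_thickSet hcont hSc _) ((thickSet_subset _).trans hR))
    (fun ε => (thickSet_subset _).trans hR)
    monotone_or_antitone_thickSet f hf hcont
  refine ⟨fun k => if h : k < 2 * t + 1 then b ⟨k, h⟩ else fun _ => 1, fun k => ?_,
    fun k ε ε' h => ?_, fun k ε => ?_, fun ε hε => ?_⟩
  · beta_reduce
    split_ifs with h
    exacts [(hb1 _).definableFun, (DefMap.const 1).definableFun]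
  · beta_reduce
    split_ifs with hk
    exacts [hb2 _ _ _ fun j hj => h j hj, rfl]
  · beta_reduce
    split_ifs with hk
    exacts [hb3 _ _, ⟨one_pos, le_rfl⟩]
  have hε' : ∀ j : Fin (2 * t + 1), 0 < (j : ℕ) → 0 < ε j ∧ ε j < b j ε := fun j hj => by
    have := hε j hj
    beta_reduce at this
    rwa [dif_pos j.2] at this
  set ε₁ := Function.update ε 0 (b 0 ε / 2) with hε₁
  have hε₁0 : ∀ j : Fin (2 * t + 1), 0 < (j : ℕ) → ε₁ j = ε j := fun j hj =>
    Function.update_of_ne (fun h => by rw [h] at hj; exact lt_irrefl _ hj) _ _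
  have hbε : ∀ j, b j ε₁ = b j ε := fun j =>
    hb2 j _ _ fun k hk => hε₁0 k ((Nat.zero_le _).trans_lt hk)
  have hε₁b : ∀ j, 0 < ε₁ j ∧ ε₁ j < b j ε₁ := fun j => by
    rw [hbε]
    by_cases hj : j = 0
    · have := (hb3 0 ε).1
      rw [hj, hε₁, Function.update_self]
      exact ⟨half_pos this, half_lt_self this⟩
    · have hj' : 0 < (j : ℕ) := Nat.pos_of_ne_zero fun h => hj (Fin.ext h)
      rw [hε₁0 j hj']
      exact hε' j hj'
  obtain ⟨E, hE0, hpos, hE, hE', F, B, Φ, Ψ, hC⟩ := hb4 ε₁ hε₁b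
  have hP : PreservesLevels f E
    (fun q => thickSet n f Sset SIGNS Sig (extendParam (stepParam E q))) F B := fun q => (hC q).2
  have heq : ∀ k, 0 < k → extendParam (stepParam E 0) k = extendParam ε k := fun k hk => by
    rw [stepParam_zero, hE0]
    unfold extendParam
    split_ifs
    exacts [hε₁0 _ hk, rfl]
  have hY0 : thickSet n f Sset SIGNS Sig (extendParam (stepParam E 0)) =
      Xseq n f Sset SIGNS Sig (extendParam ε) (t + 1) := by
    rw [Xseq_eq_thickSet hsub fun m hm hmt => ?_]
    · exact (thickSet_mono (fun m hm _ => (heq _ (by omega)).le)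
        fun m hm _ => (heq _ (by omega)).ge).antisymm
        (thickSet_mono (fun m hm _ => (heq _ (by omega)).ge)
        fun m hm _ => (heq _ (by omega)).le)
    · rw [extendParam, dif_pos (by omega)]
      exact (hε' ⟨2 * m, by omega⟩ (show 0 < 2 * m by omega)).1.le
  have h := homotopyEquiv_limit (fun q => (hC q).1) (X := ⋃ σ ∈ Sig, signRe n f σ)
    (fun k y z hy hyF hz => mem_of_tendsto_of_preservesLevels (by omega) hcont hSc hpos hE hE' hsig
      hP hy hyF hz)
    (fun x hx => exists_fixed_of_preservesLevels (by omega) hcont hpos hE hE' hsub hP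
      (fun q => (hC q).1) hx)
  rw [hY0] at h
  exact h
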